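/- arXiv:2602.24270 — 6 statements merged into one kernel-verified Lean document; each statement's English description precedes it below -/
import Mathlib

section
/- There exists a function f : ℕ⁺ → ℕ such that for every positive integer k and every connected finite graph G of pathwidth less than k, there exist a tree T that is a spanning tree of G and bags (W_x)_{x ∈ V(T)} such that (T, (W_x)_{x ∈ V(T)}) is a tree decomposition of G of width at most f(k), and moreover x ∈ W_x for every vertex x of G. -/
open SimpleGraph

/-- `(T, W)` is a tree/forest decomposition of `G` (connectivity and edge-cover
conditions): for every vertex `u` of `G`, the set of decomposition nodes whose
bag contains `u` induces a nonempty connected subgraph of `T`, and every edge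
of `G` is contained in some bag. -/
def IsTreeDecompOn {V α : Type*} (G : SimpleGraph V) (T : SimpleGraph α) (W : α → Set V) : Prop :=
  (∀ u : V, (T.induce {x | u ∈ W x}).Connected) ∧
  (∀ u v : V, G.Adj u v → ∃ x, u ∈ W x ∧ v ∈ W x)

/-- `(W 1, …, W m)` is a path decomposition of `G`: every vertex appears in a
nonempty set of bags forming an interval of indices, and every edge of `G` is
contained in some bag. -/
def IsPathDecomp {V : Type*} (G : SimpleGraph V) (m : ℕ) (W : Fin m → Set V) : Prop :=
  (∀ u : V, ∃ i, u ∈ W i) ∧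
  (∀ u : V, ∀ i j l : Fin m, i ≤ j → j ≤ l → u ∈ W i → u ∈ W l → u ∈ W j) ∧
  (∀ u v : V, G.Adj u v → ∃ i, u ∈ W i ∧ v ∈ W i)

/-- `G` has pathwidth less than `k`: it has a path decomposition all of whose
bags have at most `k` vertices (i.e. of width at most `k - 1`). -/
def PathwidthLt {V : Type*} (G : SimpleGraph V) (k : ℕ) : Prop :=
  ∃ (m : ℕ) (W : Fin m → Set V), IsPathDecomp G m W ∧ ∀ i, (W i).ncard ≤ k

namespace SpanTD

variable {V : Type}

/-- restriction of a graph to pairs inside a set -/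
def rest (F : SimpleGraph V) (s : Set V) : SimpleGraph V where
  Adj a b := F.Adj a b ∧ a ∈ s ∧ b ∈ s
  symm := ⟨fun _ _ h => ⟨h.1.symm, h.2.2, h.2.1⟩⟩
  loopless := ⟨fun _ h => h.1.ne rfl⟩

def Good (G : SimpleGraph V) (w : ℕ) : Prop :=
  ∃ F : SimpleGraph V, F ≤ G ∧ F.IsAcyclic ∧ (∀ x y, G.Reachable x y → F.Reachable x y) ∧
  ∃ S : V → Set V, (∀ u, u ∈ S u) ∧ (∀ u, ∀ x ∈ S u, (rest F (S u)).Reachable u x) ∧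
    (∀ u v, G.Adj u v → ∃ x, x ∈ S u ∧ x ∈ S v) ∧ ∀ x, {u | x ∈ S u}.ncard ≤ w

lemma Good.mono {G : SimpleGraph V} {w w' : ℕ} (h : Good G w) (hw : w ≤ w') : Good G w' := by
  obtain ⟨F, h1, h2, h3, S, h4, h5, h6, h7⟩ := h
  exact ⟨F, h1, h2, h3, S, h4, h5, h6, fun x => (h7 x).trans hw⟩

lemma rest_mono {F F' : SimpleGraph V} {s s' : Set V} (hs : s ⊆ s')
    (h : ∀ a b, F.Adj a b → a ∈ s → b ∈ s → F'.Adj a b) : rest F s ≤ rest F' s' := by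
  intro a b hab
  exact ⟨h a b hab.1 hab.2.1 hab.2.2, hs hab.2.1, hs hab.2.2⟩

lemma rest_le (F : SimpleGraph V) (s : Set V) : rest F s ≤ F := fun _ _ h => h.1

/-- the reachable set is connected -/
lemma rest_reach {F F' : SimpleGraph V} (hF : F' ≤ F) {s : Set V} (u x : V)
    (h : F'.Reachable u x) (hs : ∀ z, F'.Reachable u z → z ∈ s) : (rest F s).Reachable u x := by
  obtain ⟨p⟩ := h
  have : ∀ (a b : V) (p : F'.Walk a b), F'.Reachable u a → (rest F s).Reachable a b := by
    intro a b p
    induction p with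
    | nil => intro _; exact Reachable.refl _
    | cons hab q ih =>
      intro ha
      have hb := ha.trans hab.reachable
      have : (rest F s).Adj _ _ := ⟨hF hab, hs _ ha, hs _ hb⟩
      exact this.reachable.trans (ih hb)
  exact this u x p (Reachable.refl _)

lemma good_bot [Finite V] : Good (⊥ : SimpleGraph V) 1 := by
  refine ⟨⊥, le_rfl, isAcyclic_bot, fun _ _ h => h, fun u => {u}, fun u => rfl, ?_, ?_, ?_⟩
  · rintro u x rfl
    exact Reachable.refl _
  · intro u v h; exact h.elim
  · intro x
    have : {u : V | x ∈ ({u} : Set V)} = {x} := by ext u; simp [eq_comm]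
    rw [this, Set.ncard_singleton]

lemma good_apex [Finite V] (G : SimpleGraph V) (X : Set V) (w : ℕ) (h : Good (rest G Xᶜ) w) :
    Good G (w + X.ncard) := by
  obtain ⟨F0, h1, h2, h3, S, h4, h5, h6, h7⟩ := h
  obtain ⟨F, f1, f2, f3, f4⟩ :=
    exists_isAcyclic_reachable_eq_le_of_le_of_isAcyclic (h1.trans (rest_le G _)) h2
  classical
  refine ⟨F, f2, f3, fun x y => by rw [f4]; exact id,
    fun u => {z | (u ∈ X ∧ F.Reachable u z) ∨ (u ∉ X ∧ z ∈ S u)}, ?_, ?_, ?_, ?_⟩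
  · intro u
    by_cases hu : u ∈ X
    · exact Or.inl ⟨hu, Reachable.refl _⟩
    · exact Or.inr ⟨hu, h4 u⟩
  · rintro u x (⟨hu, hx⟩ | ⟨hu, hx⟩)
    · exact rest_reach le_rfl u x hx (fun z hz => Or.inl ⟨hu, hz⟩)
    · refine (h5 u x hx).mono (rest_mono (fun z hz => Or.inr ⟨hu, hz⟩) (fun a b hab _ _ => f1 hab))
  · intro u v huv
    have hr : F.Reachable u v := by rw [f4]; exact huv.reachable
    by_cases hu : u ∈ X
    · refine ⟨v, Or.inl ⟨hu, hr⟩, ?_⟩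
      by_cases hv : v ∈ X
      · exact Or.inl ⟨hv, Reachable.refl _⟩
      · exact Or.inr ⟨hv, h4 v⟩
    · by_cases hv : v ∈ X
      · exact ⟨u, Or.inr ⟨hu, h4 u⟩, Or.inl ⟨hv, hr.symm⟩⟩
      · obtain ⟨x, hx, hx'⟩ := h6 u v ⟨huv, hu, hv⟩
        exact ⟨x, Or.inr ⟨hu, hx⟩, Or.inr ⟨hv, hx'⟩⟩
  · intro x
    calc _ ≤ ({u | x ∈ S u} ∪ X).ncard := by
            apply Set.ncard_le_ncard _ (Set.toFinite _)
            rintro u (⟨hu, -⟩ | ⟨-, hu⟩)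
            · exact Or.inr hu
            · exact Or.inl hu
      _ ≤ _ := (Set.ncard_union_le _ _).trans (Nat.add_le_add_right (h7 x) _)

lemma good_small [Finite V] (G : SimpleGraph V) (X : Set V) (h : ∀ u v, G.Adj u v → u ∈ X) :
    Good G (1 + X.ncard) := by
  apply good_apex
  have : rest G Xᶜ = ⊥ := by
    ext u v
    simp only [bot_adj, iff_false]
    rintro ⟨h1, h2, -⟩
    exact h2 (h _ _ h1)
  rw [this]; exact good_bot

/-- a walk leaving the first side passes through the separator -/
lemma reach_sep {H H1 : SimpleGraph V} {U1 U2 S : Set V} {x y : V} (hxy : H.Reachable x y)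
    (hH : ∀ a b, H.Adj a b → (H1.Adj a b ∧ b ∈ U1) ∨ a ∈ U2) (hS : ∀ a, a ∈ U1 → a ∈ U2 → a ∈ S)
    (hx : x ∈ U1) (hy : y ∈ U2) : ∃ z ∈ S, H1.Reachable x z := by
  obtain ⟨p⟩ := hxy
  induction p with
  | nil => exact ⟨_, hS _ hx hy, Reachable.refl _⟩
  | cons hab q ih =>
    rcases hH _ _ hab with ⟨h, hb⟩ | h
    · obtain ⟨z, hz, hr⟩ := ih hb hy
      exact ⟨z, hz, h.reachable.trans hr⟩
    · exact ⟨_, hS _ hx h, Reachable.refl _⟩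

lemma reach_side {H N : SimpleGraph V} {U U' S X : Set V}
    (hN : N ≤ H)
    (hNU : ∀ a b, N.Adj a b → a ∈ U)
    (hH : ∀ a b, H.Adj a b → N.Adj a b ∨ b ∈ U') (hS : ∀ a, a ∈ U → a ∈ U' → a ∈ S)
    (hX : X ⊆ U)
    (hT : ∀ p ∈ S, ∀ p' ∈ S, ∀ x ∈ X, ∀ y ∈ X, N.Reachable p x → N.Reachable p' y →
      H.Reachable p p' → N.Reachable p p')
    {x y : V} (hx : x ∈ X) (hy : y ∈ X) (hxy : H.Reachable x y) : N.Reachable x y := by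
  have key : ∀ (v y : V) (p : H.Walk v y), y ∈ X → N.Reachable v y ∨ ∃ s ∈ S, N.Reachable s y := by
    intro v y p
    induction p with
    | nil => intro _; exact Or.inl (Reachable.refl _)
    | @cons a b c hab q ih =>
      intro hy
      rcases ih hy with h | h
      · rcases hH _ _ hab with h' | h'
        · exact Or.inl (h'.reachable.trans h)
        · refine Or.inr ⟨b, hS _ ?_ h', h⟩
          obtain ⟨r⟩ := h
          cases r with
          | nil => exact hX hy
          | cons h _ => exact hNU _ _ h
      · exact Or.inr h
  obtain ⟨p⟩ := hxy
  rcases key x y p hy with h | ⟨s, hs, h⟩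
  · exact h
  rcases key y x p.reverse hx with h' | ⟨s', hs', h'⟩
  · exact h'.symm
  have := hT s hs s' hs' y hy x hx h h'
    ((h.mono hN).trans (p.reverse.reachable.trans (h'.mono hN).symm))
  exact h'.symm.trans (this.symm.trans h)

lemma removed_aux [Finite V] (F' : SimpleGraph V) (B : Set V) : ∀ (n : ℕ) (F : SimpleGraph V),
    F' ≤ F → F.IsAcyclic →
    (∀ x y, F.Adj x y → ¬ F'.Adj x y → ∃ b ∈ B, F'.Reachable x b) →
    (F.edgeSet \ F'.edgeSet).ncard = n →
    (F.connectedComponentMk '' B).ncard + n ≤ (F'.connectedComponentMk '' B).ncard := by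
  intro n
  induction n with
  | zero =>
    intro F hle hac hB hn
    rw [Set.ncard_eq_zero (Set.toFinite _), Set.sdiff_eq_empty] at hn
    have : F = F' := le_antisymm (edgeSet_subset_edgeSet.1 hn) hle
    subst this
    simp
  | succ n ih =>
    intro F hle hac hB hn
    obtain ⟨e, he⟩ : (F.edgeSet \ F'.edgeSet).Nonempty := by
      rw [← Set.ncard_pos (Set.toFinite _)]; omega
    induction e with | h x y
    have hxy : F.Adj x y := he.1
    have hxy' : ¬ F'.Adj x y := he.2
    set H := F.deleteEdges {s(x, y)} with hH
    have hHF : H ≤ F := deleteEdges_le _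
    have hF'H : F' ≤ H := by
      intro a b hab
      rw [hH, deleteEdges_adj]
      refine ⟨hle hab, fun h => ?_⟩
      have h : s(a, b) = s(x, y) := h
      apply hxy'
      rw [← mem_edgeSet, ← h]; exact hab
    have hbr : ¬ H.Reachable x y := by
      have := isAcyclic_iff_forall_adj_isBridge.1 hac hxy
      rw [isBridge_iff] at this
      exact this
    have h1 := ih H hF'H (hac.anti hHF) (fun a b hab => hB a b (hHF hab)) (by
      have : H.edgeSet \ F'.edgeSet = (F.edgeSet \ F'.edgeSet) \ {s(x, y)} := by
        rw [hH, edgeSet_deleteEdges]; ext; simp; tauto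
      rw [this, Set.ncard_sdiff_singleton_of_mem he]; omega)
    obtain ⟨b, hb, hxb⟩ := hB x y hxy hxy'
    obtain ⟨c, hc, hyc⟩ := hB y x hxy.symm (fun h => hxy' h.symm)
    have himg : F.connectedComponentMk '' B =
        (ConnectedComponent.map (Hom.ofLE hHF)) '' (H.connectedComponentMk '' B) := by
      rw [Set.image_image]; rfl
    have hlt : (F.connectedComponentMk '' B).ncard < (H.connectedComponentMk '' B).ncard := by
      rw [himg]
      refine lt_of_le_of_ne (Set.ncard_image_le (Set.toFinite _)) (fun heq => ?_)
      have hinj := (Set.ncard_image_iff (Set.toFinite _)).1 heq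
      have := hinj (Set.mem_image_of_mem _ hb) (Set.mem_image_of_mem _ hc) (by
        simp only [ConnectedComponent.map_mk]
        apply ConnectedComponent.sound
        exact (hxb.mono hle).symm.trans (hxy.reachable.trans (hyc.mono hle)))
      have := ConnectedComponent.exact this
      exact hbr ((hxb.mono hF'H).trans (this.trans (hyc.mono hF'H).symm))
    omega

lemma removed_le [Finite V] (F F' : SimpleGraph V) (B : Set V)
    (hle : F' ≤ F) (hac : F.IsAcyclic)
    (hB : ∀ x y, F.Adj x y → ¬ F'.Adj x y → ∃ b ∈ B, F'.Reachable x b) :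
    (F.edgeSet \ F'.edgeSet).ncard ≤ B.ncard := by
  have h := removed_aux F' B _ F hle hac hB rfl
  have h2 := Set.ncard_image_le (f := F'.connectedComponentMk) (Set.toFinite B)
  omega

/-- part of `F` lying in the levels satisfying `P` -/
def FR (F : SimpleGraph V) (G : ℕ → SimpleGraph V) (P : ℕ → Prop) : SimpleGraph V where
  Adj a b := F.Adj a b ∧ ∃ j, P j ∧ (G j).Adj a b
  symm := ⟨fun _ _ h => ⟨h.1.symm, h.2.imp fun _ h => ⟨h.1, h.2.symm⟩⟩⟩
  loopless := ⟨fun _ h => h.1.ne rfl⟩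

lemma key_local {F : SimpleGraph V} {G : ℕ → SimpleGraph V} {J : ℕ → Set V}
    (hF : ∀ u v, F.Adj u v → ∃ j, (G j).Adj u v)
    (hodd : ∀ i, Odd i → ∀ x y, (G i).Reachable x y → (F ⊓ G i).Reachable x y)
    (hsupp : ∀ i u v, (G i).Adj u v → u ∈ J i)
    (hdis : ∀ i j u, u ∈ J i → u ∈ J j → i ≤ j + 1)
    (htight : ∀ i, Even i → ∀ p p' q q', p ∈ J i → p ∈ J (i+1) → p' ∈ J i → p' ∈ J (i+1) →
      q ∈ J (i+1) → q ∈ J (i+2) → q' ∈ J (i+1) → q' ∈ J (i+2) →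
      (G (i+1)).Reachable p q → (G (i+1)).Reachable p' q' → F.Reachable p p' →
      (G (i+1)).Reachable p p')
    (i : ℕ) (hi : Even i) (x y : V) (hx : x ∈ J i) (hy : y ∈ J i) (hxy : F.Reachable x y) :
    (FR F G (fun j => i ≤ j + 1 ∧ j ≤ i + 1)).Reachable x y := by
  have hsupp' : ∀ i u v, (G i).Adj u v → v ∈ J i := fun i u v h => hsupp i v u h.symm
  have step1 : (FR F G (fun j => i ≤ j + 1)).Reachable x y := by
    refine reach_side (H := F) (N := FR F G (fun j => i ≤ j + 1)) (U := {a | ∃ j, i ≤ j + 1 ∧ a ∈ J j})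
      (U' := {a | ∃ j, j + 2 ≤ i ∧ a ∈ J j}) (S := {a | ∃ j, j + 2 = i ∧ a ∈ J j ∧ a ∈ J (j+1)})
      (X := J i) (fun _ _ h => h.1) ?_ ?_ ?_ ?_ ?_ hx hy hxy
    · rintro a b ⟨-, j, hj, h⟩
      exact ⟨j, hj, hsupp _ _ _ h⟩
    · intro a b hab
      obtain ⟨j, hj⟩ := hF a b hab
      by_cases h : i ≤ j + 1
      · exact Or.inl ⟨hab, j, h, hj⟩
      · exact Or.inr ⟨j, by omega, hsupp' _ _ _ hj⟩
    · rintro a ⟨j, hj, ha⟩ ⟨l, hl, ha'⟩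
      have := hdis _ _ _ ha ha'
      obtain rfl : j = l + 1 := by omega
      exact ⟨l, by omega, ha', ha⟩
    · intro a ha; exact ⟨i, by omega, ha⟩
    · rintro p ⟨m, rfl, hp, hp1⟩ p' ⟨m', hm', hp', hp1'⟩ x hx y hy hpx hpy hpp
      obtain rfl : m = m' := by omega
      have sep : ∀ p x, p ∈ J (m+1) → x ∈ J (m+2) →
          (FR F G (fun j => m + 2 ≤ j + 1)).Reachable p x →
          ∃ z ∈ {a | a ∈ J (m+1) ∧ a ∈ J (m+2)}, (F ⊓ G (m+1)).Reachable p z := by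
        intro p x hp hx h
        refine reach_sep (U1 := J (m+1)) (U2 := {a | ∃ j, m + 2 ≤ j ∧ a ∈ J j}) h ?_ ?_ hp
          ⟨m+2, le_rfl, hx⟩
        · rintro a b ⟨hab, j, hj, h⟩
          rcases Nat.lt_or_ge j (m+2) with h2 | h2
          · obtain rfl : j = m + 1 := by omega
            exact Or.inl ⟨⟨hab, h⟩, hsupp' _ _ _ h⟩
          · exact Or.inr ⟨j, h2, hsupp _ _ _ h⟩
        · rintro a ha ⟨j, hj, ha'⟩
          have := hdis _ _ _ ha' ha
          obtain rfl : j = m + 2 := by omega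
          exact ⟨ha, ha'⟩
      obtain ⟨q, ⟨hq, hq2⟩, hpq⟩ := sep p x hp1 hx hpx
      obtain ⟨q', ⟨hq', hq2'⟩, hpq'⟩ := sep p' y hp1' hy hpy
      have hm : Even m := by
        rcases hi with ⟨c, hc⟩; exact ⟨c - 1, by omega⟩
      have := htight m hm p p' q q' hp hp1 hp' hp1' hq hq2 hq' hq2' (hpq.mono inf_le_right)
        (hpq'.mono inf_le_right) hpp
      refine (hodd (m+1) hm.add_one _ _ this).mono ?_
      intro a b hab
      exact ⟨hab.1, m+1, by omega, hab.2⟩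
  refine reach_side (H := FR F G (fun j => i ≤ j + 1))
      (U := {a | ∃ j, (i ≤ j + 1 ∧ j ≤ i + 1) ∧ a ∈ J j})
      (U' := {a | ∃ j, i + 2 ≤ j ∧ a ∈ J j}) (S := {a | a ∈ J (i+1) ∧ a ∈ J (i+2)})
      (X := J i) ?_ ?_ ?_ ?_ ?_ ?_ hx hy step1
  · rintro a b ⟨h, j, hj, h'⟩; exact ⟨h, j, hj.1, h'⟩
  · rintro a b ⟨-, j, hj, h⟩
    exact ⟨j, hj, hsupp _ _ _ h⟩
  · rintro a b ⟨hab, j, hj, h⟩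
    by_cases h2 : j ≤ i + 1
    · exact Or.inl ⟨hab, j, ⟨hj, h2⟩, h⟩
    · exact Or.inr ⟨j, by omega, hsupp' _ _ _ h⟩
  · rintro a ⟨j, hj, ha⟩ ⟨l, hl, ha'⟩
    have := hdis _ _ _ ha' ha
    obtain rfl : j = i + 1 := by omega
    obtain rfl : l = i + 2 := by omega
    exact ⟨ha, ha'⟩
  · intro a ha; exact ⟨i, by omega, ha⟩
  · rintro p ⟨hp1, hp2⟩ p' ⟨hp1', hp2'⟩ x hx y hy hpx hpy hpp
    have sep : ∀ p x, p ∈ J (i+1) → x ∈ J i →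
        (FR F G (fun j => i ≤ j + 1 ∧ j ≤ i + 1)).Reachable p x →
        ∃ z ∈ {a | a ∈ J i ∧ a ∈ J (i+1)}, (F ⊓ G (i+1)).Reachable p z := by
      intro p x hp hx h
      refine reach_sep (U1 := J (i+1)) (U2 := {a | ∃ j, j ≤ i ∧ a ∈ J j}) h ?_ ?_ hp
        ⟨i, le_rfl, hx⟩
      · rintro a b ⟨hab, j, hj, h⟩
        rcases Nat.lt_or_ge i j with h2 | h2
        · obtain rfl : j = i + 1 := by omega
          exact Or.inl ⟨⟨hab, h⟩, hsupp' _ _ _ h⟩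
        · exact Or.inr ⟨j, h2, hsupp _ _ _ h⟩
      · rintro a ha ⟨j, hj, ha'⟩
        have := hdis _ _ _ ha ha'
        obtain rfl : j = i := by omega
        exact ⟨ha', ha⟩
    obtain ⟨q, ⟨hq, hq2⟩, hpq⟩ := sep p x hp1 hx hpx
    obtain ⟨q', ⟨hq', hq2'⟩, hpq'⟩ := sep p' y hp1' hy hpy
    have hpq := hpq.mono inf_le_right
    have hpq' := hpq'.mono inf_le_right
    have hFR : FR F G (fun j => i ≤ j + 1) ≤ F := fun _ _ h => h.1
    have e1 := hodd (i+1) hi.add_one _ _ hpq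
    have e2 := hodd (i+1) hi.add_one _ _ hpq'
    have := htight i hi q q' p p' hq hq2 hq' hq2' hp1 hp2 hp1' hp2' hpq.symm hpq'.symm
      ((e1.mono inf_le_left).symm.trans ((hpp.mono hFR).trans (e2.mono inf_le_left)))
    refine (hodd (i+1) hi.add_one _ _ (hpq.trans (this.trans hpq'.symm))).mono ?_
    intro a b hab
    exact ⟨hab.1, i+1, by omega, hab.2⟩

lemma reach_of_walk {G F : SimpleGraph V} (h : ∀ u v, G.Adj u v → F.Reachable u v) {x y : V}
    (hxy : G.Reachable x y) : F.Reachable x y := by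
  obtain ⟨p⟩ := hxy
  induction p with
  | nil => exact Reachable.refl _
  | cons hab q ih => exact (h _ _ hab).trans ih

lemma reach_mem {G : SimpleGraph V} {J : Set V} (h : ∀ u v, G.Adj u v → u ∈ J) {x y : V}
    (hxy : G.Reachable x y) : x = y ∨ (x ∈ J ∧ y ∈ J) := by
  obtain ⟨p⟩ := hxy
  induction p with
  | nil => exact Or.inl rfl
  | cons hab q ih =>
    right
    refine ⟨h _ _ hab, ?_⟩
    rcases ih with rfl | ⟨-, h2⟩
    · exact h _ _ hab.symm
    · exact h2

/-- union of the levels satisfying `P` -/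
def lev (G : ℕ → SimpleGraph V) (P : ℕ → Prop) : SimpleGraph V where
  Adj a b := ∃ j, P j ∧ (G j).Adj a b
  symm := ⟨fun _ _ h => h.imp fun _ h => ⟨h.1, h.2.symm⟩⟩
  loopless := ⟨fun _ ⟨_, h⟩ => h.2.ne rfl⟩

lemma acyclic_lev {F : ℕ → SimpleGraph V} {J : ℕ → Set V} {P : ℕ → Prop}
    (hac : ∀ i, (F i).IsAcyclic) (hsupp : ∀ i u v, (F i).Adj u v → u ∈ J i)
    (hdis : ∀ i j u, P i → P j → u ∈ J i → u ∈ J j → i = j) : (lev F P).IsAcyclic := by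
  rw [isAcyclic_iff_forall_adj_isBridge]
  rintro x y ⟨i, hi, hxy⟩
  have hb := isAcyclic_iff_forall_adj_isBridge.1 (hac i) hxy
  rw [isBridge_iff] at hb ⊢
  intro hr
  apply hb
  obtain ⟨p⟩ := hr
  have : ∀ a b (p : ((lev F P).deleteEdges {s(x, y)}).Walk a b), a ∈ J i →
      ((F i).deleteEdges {s(x, y)}).Reachable a b := by
    intro a b p
    induction p with
    | nil => intro _; exact Reachable.refl _
    | cons hab q ih =>
      intro ha
      rw [deleteEdges_adj] at hab
      obtain ⟨⟨j, hj, hab⟩, hne⟩ := hab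
      obtain rfl := hdis i j _ hi hj ha (hsupp _ _ _ hab)
      have : ((F i).deleteEdges {s(x, y)}).Adj _ _ := deleteEdges_adj.2 ⟨hab, hne⟩
      exact this.reachable.trans (ih (hsupp _ _ _ hab.symm))
  exact this x y p (hsupp _ _ _ hxy)

lemma glue [Finite V] (G : ℕ → SimpleGraph V) (J : ℕ → Set V) (k w : ℕ)
    (hsupp : ∀ i u v, (G i).Adj u v → u ∈ J i)
    (hdis : ∀ i j u, u ∈ J i → u ∈ J j → i ≤ j + 1)
    (hk : ∀ i, (J i ∩ J (i+1)).ncard ≤ k)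
    (hgood : ∀ i, Good (G i) w)
    (htight : ∀ i, Even i → ∀ p p' q q', p ∈ J i → p ∈ J (i+1) → p' ∈ J i → p' ∈ J (i+1) →
      q ∈ J (i+1) → q ∈ J (i+2) → q' ∈ J (i+1) → q' ∈ J (i+2) →
      (G (i+1)).Reachable p q → (G (i+1)).Reachable p' q' →
      (lev G (fun _ => True)).Reachable p p' →
      (G (i+1)).Reachable p p') :
    Good (lev G (fun _ => True)) (1 + 4 * (w + 2 * k * w)) := by
  classical
  choose F0 hle hac hreach S hS hconn hedge hcard using hgood
  have hsuppF : ∀ i u v, (F0 i).Adj u v → u ∈ J i := fun i u v h => hsupp i u v (hle i h)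
  have hoddac : (lev F0 Odd).IsAcyclic := by
    refine acyclic_lev hac hsuppF ?_
    rintro i j u ⟨a, ha⟩ ⟨b, hb⟩ h1 h2
    have := hdis _ _ _ h1 h2
    have := hdis _ _ _ h2 h1
    omega
  obtain ⟨F, f1, f2, f3, f4⟩ := exists_isAcyclic_reachable_eq_le_of_le_of_isAcyclic
    (G := lev F0 (fun _ => True)) (H := lev F0 Odd)
    (fun _ _ ⟨j, _, h⟩ => ⟨j, trivial, h⟩) hoddac
  have hlevle : lev F0 (fun _ => True) ≤ lev G (fun _ => True) :=
    fun _ _ ⟨j, _, h⟩ => ⟨j, trivial, hle j h⟩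
  have hFG : F ≤ lev G (fun _ => True) := f2.trans hlevle
  have hGF : ∀ x y, (lev G (fun _ => True)).Reachable x y → F.Reachable x y := by
    intro x y h
    rw [f4]
    refine reach_of_walk ?_ h
    rintro u v ⟨j, -, hj⟩
    exact (hreach j u v hj.reachable).mono (fun _ _ h => ⟨j, trivial, h⟩)
  have hGjF : ∀ j x y, (G j).Reachable x y → F.Reachable x y := fun j x y h =>
    hGF x y (h.mono (fun _ _ h => ⟨j, trivial, h⟩))
  have hreachS : ∀ j u x, x ∈ S j u → (F0 j).Reachable u x := fun j u x hx =>
    (hconn j u x hx).mono (rest_le _ _)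
  have key := key_local (F := F) (G := G) (J := J)
    (fun u v h => by obtain ⟨j, -, h⟩ := hFG h; exact ⟨j, h⟩)
    (by
      intro i hi x y h
      refine (hreach i x y h).mono ?_
      intro a b hab
      exact ⟨f1 ⟨i, hi, hab⟩, hle i hab⟩) hsupp hdis
    (fun i hi p p' q q' a1 a2 a3 a4 a5 a6 a7 a8 a9 a10 a11 =>
      htight i hi p p' q q' a1 a2 a3 a4 a5 a6 a7 a8 a9 a10 (a11.mono hFG))
  -- affected vertices
  let aff : ℕ → Set V := fun j => {u | ∃ x y, (F0 j).Adj x y ∧ ¬ F.Adj x y ∧ x ∈ S j u ∧ y ∈ S j u}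
  have haffJ : ∀ j, ∀ u ∈ aff j, u ∈ J j := by
    rintro j u ⟨x, y, hxy, -, hx, hy⟩
    rcases reach_mem (hsuppF j) (hreachS j u x hx) with rfl | h
    · exact hsuppF _ _ _ hxy
    · exact h.1
  have haffE : ∀ j, ∀ u ∈ aff j, Even j := by
    rintro j u ⟨x, y, hxy, hn, hx, hy⟩
    rw [← Nat.not_odd_iff_even]
    intro ho
    exact hn (f1 ⟨j, ho, hxy⟩)
  -- bound on the removed edges
  have hrem : ∀ j, Even j → ((F0 j).edgeSet \ (F0 j ⊓ F).edgeSet).ncard ≤ 2 * k := by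
    intro j hj
    have hb : ({b | b ∈ J j ∧ ∃ i, Odd i ∧ b ∈ J i} : Set V).ncard ≤ 2 * k := by
      have h1 : ({b | b ∈ J j ∧ ∃ i, Odd i ∧ b ∈ J i} : Set V) ⊆
          (J (j-1) ∩ J (j-1+1)) ∪ (J j ∩ J (j+1)) := by
        rintro b ⟨hb, i, ⟨c, hc⟩, hi⟩
        obtain ⟨d, hd⟩ := hj
        have h1 := hdis _ _ _ hb hi
        have h2 := hdis _ _ _ hi hb
        have : i = j + 1 ∨ (i = j - 1 ∧ j = j - 1 + 1) := by omega
        rcases this with rfl | ⟨h3, h4⟩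
        · exact Or.inr ⟨hb, hi⟩
        · left; rw [← h4, ← h3]; exact ⟨hi, hb⟩
      have h2 := Set.ncard_le_ncard h1 (Set.toFinite _)
      have h3 := Set.ncard_union_le (J (j-1) ∩ J (j-1+1)) (J j ∩ J (j+1))
      have h4 := hk j
      have h5 := hk (j-1)
      omega
    refine (removed_le _ _ _ inf_le_left (hac j) ?_).trans hb
    intro x y hxy hn
    have hn : ¬ F.Adj x y := fun h => hn ⟨hxy, h⟩
    have hr : F.Reachable x y := hGjF j x y (hle j hxy).reachable
    by_contra hcon
    push Not at hcon
    have hall : ∀ z, F.Reachable x z → (F0 j ⊓ F).Reachable x z := by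
      intro z hz
      obtain ⟨p⟩ := hz
      have : ∀ a b (p : F.Walk a b), (F0 j ⊓ F).Reachable x a → (F0 j ⊓ F).Reachable x b := by
        intro a b p
        induction p with
        | nil => exact id
        | @cons a b c hab q ih =>
          intro ha
          apply ih
          refine ha.trans (Adj.reachable ⟨?_, hab⟩)
          have haJ : a ∈ J j := by
            rcases reach_mem (hsuppF j) (ha.mono inf_le_left) with rfl | h
            · exact hsuppF _ _ _ hxy
            · exact h.2
          obtain ⟨l, -, hl⟩ := f2 hab
          have hal := hsuppF _ _ _ hl
          have hle : ¬ Odd l := fun ho => hcon a ⟨haJ, l, ho, hal⟩ ha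
          rw [Nat.not_odd_iff_even] at hle
          have h1 := hdis _ _ _ hal haJ
          have h2 := hdis _ _ _ haJ hal
          obtain ⟨c, hc⟩ := hle
          obtain ⟨d, hd⟩ := hj
          obtain rfl : l = j := by omega
          exact hl
      exact this x z p (Reachable.refl _)
    have := hall y hr
    have hbr := isAcyclic_iff_forall_adj_isBridge.1 (hac j) hxy
    rw [isBridge_iff] at hbr
    apply hbr
    refine this.mono ?_
    intro a b hab
    refine deleteEdges_adj.2 ⟨hab.1, fun h => ?_⟩
    have h : s(a, b) = s(x, y) := h
    apply hn
    rw [← mem_edgeSet, ← h]; exact hab.2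
  have haffcard : ∀ j, (aff j).ncard ≤ 2 * k * w := by
    intro j
    rcases (aff j).eq_empty_or_nonempty with h | ⟨u, hu⟩
    · rw [h]; simp
    have hj := haffE j u hu
    set R := (F0 j).edgeSet \ (F0 j ⊓ F).edgeSet with hR
    have hRf : R.Finite := Set.toFinite _
    have hsub : aff j ⊆ ⋃ e ∈ hRf.toFinset, {u | e.out.1 ∈ S j u} := by
      rintro u ⟨x, y, hxy, hn, hx, hy⟩
      simp only [Set.mem_iUnion, Set.Finite.mem_toFinset]
      refine ⟨s(x, y), ⟨hxy, fun h => hn (mem_edgeSet _ |>.1 h).2⟩, ?_⟩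
      have : (Quot.out s(x, y)).1 ∈ s(x, y) := Sym2.out_fst_mem _
      rw [Sym2.mem_iff] at this
      rcases this with h | h
      · show (Quot.out s(x, y)).1 ∈ S j u
        rw [h]; exact hx
      · show (Quot.out s(x, y)).1 ∈ S j u
        rw [h]; exact hy
    calc (aff j).ncard ≤ (⋃ e ∈ hRf.toFinset, {u | e.out.1 ∈ S j u}).ncard :=
          Set.ncard_le_ncard hsub (Set.toFinite _)
      _ ≤ ∑ e ∈ hRf.toFinset, ({u | e.out.1 ∈ S j u} : Set V).ncard :=
          Finset.set_ncard_biUnion_le _ _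
      _ ≤ ∑ e ∈ hRf.toFinset, w := Finset.sum_le_sum (fun e _ => hcard j _)
      _ = R.ncard * w := by
          rw [Finset.sum_const, smul_eq_mul, Set.ncard_eq_toFinset_card R hRf]
      _ ≤ 2 * k * w := Nat.mul_le_mul_right _ (hrem j hj)
  let M : ℕ → SimpleGraph V := fun i => FR F G (fun j => i ≤ j + 1 ∧ j ≤ i + 1)
  let S' : V → Set V := fun u => {z | ∃ j, (u ∈ aff j ∧ (M j).Reachable u z) ∨ (u ∉ aff j ∧ z ∈ S j u)}
  have hSS' : ∀ j u x, x ∈ S j u → x ∈ S' u := by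
    intro j u x hx
    refine ⟨j, ?_⟩
    by_cases hu : u ∈ aff j
    · left
      refine ⟨hu, ?_⟩
      have hr := hreachS j u x hx
      have huJ := haffJ j u hu
      refine key j (haffE j u hu) u x huJ ?_ (hGjF j u x (hr.mono (hle j)))
      rcases reach_mem (hsuppF j) hr with rfl | h
      · exact huJ
      · exact h.2
    · exact Or.inr ⟨hu, hx⟩
  refine ⟨F, hFG, f3, hGF, S', fun u => hSS' 0 u u (hS 0 u), ?_, ?_, ?_⟩
  · rintro u x ⟨j, ⟨hu, hx⟩ | ⟨hu, hx⟩⟩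
    · exact rest_reach (F' := M j) (fun _ _ h => h.1) u x hx (fun z hz => ⟨j, Or.inl ⟨hu, hz⟩⟩)
    · refine (hconn j u x hx).mono (rest_mono (fun z hz => hSS' j u z hz) ?_)
      intro a b hab ha hb
      by_contra hn
      exact hu ⟨a, b, hab, hn, ha, hb⟩
  · rintro u v ⟨j, -, huv⟩
    obtain ⟨x, hx, hx'⟩ := hedge j u v huv
    exact ⟨x, hSS' j u x hx, hSS' j v x hx'⟩
  · intro x
    obtain ⟨T, hT4, hT⟩ : ∃ T : Finset ℕ, T.card ≤ 4 ∧ ∀ l, x ∈ J l → ∀ j, j ≤ l + 1 → l ≤ j + 1 →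
        j ∈ T := by
      by_cases hxJ : ∃ j, x ∈ J j
      · refine ⟨Finset.Icc (Nat.find hxJ - 1) (Nat.find hxJ + 2), ?_, ?_⟩
        · rw [Nat.card_Icc]; omega
        · intro l hl j h1 h2
          have h3 := Nat.find_min' hxJ hl
          have h4 := hdis _ _ _ hl (Nat.find_spec hxJ)
          rw [Finset.mem_Icc]
          omega
      · refine ⟨∅, by simp, fun l hl => (hxJ ⟨l, hl⟩).elim⟩
    have hsub : {u | x ∈ S' u} ⊆ {x} ∪ ⋃ j ∈ T, ({u | x ∈ S j u} ∪ aff j) := by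
      rintro u ⟨j, ⟨hu, hx⟩ | ⟨hu, hx⟩⟩
      · rcases reach_mem (G := M j) (J := {a | ∃ l, (j ≤ l + 1 ∧ l ≤ j + 1) ∧ a ∈ J l})
          (fun a b ⟨_, l, hl, h⟩ => ⟨l, hl, hsupp _ _ _ h⟩) hx with rfl | ⟨-, l, hl, hxl⟩
        · exact Or.inl rfl
        · right
          simp only [Set.mem_iUnion]
          exact ⟨j, hT l hxl j hl.1 hl.2, Or.inr hu⟩
      · rcases reach_mem (hsuppF j) (hreachS j u x hx) with rfl | h
        · exact Or.inl rfl
        · right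
          simp only [Set.mem_iUnion]
          exact ⟨j, hT j h.2 j (by omega) (by omega), Or.inl hx⟩
    calc ({u | x ∈ S' u} : Set V).ncard
        ≤ ({x} ∪ ⋃ j ∈ T, ({u | x ∈ S j u} ∪ aff j)).ncard :=
          Set.ncard_le_ncard hsub (Set.toFinite _)
      _ ≤ 1 + (⋃ j ∈ T, ({u | x ∈ S j u} ∪ aff j)).ncard := by
          refine (Set.ncard_union_le _ _).trans ?_
          rw [Set.ncard_singleton]
      _ ≤ 1 + ∑ j ∈ T, ({u | x ∈ S j u} ∪ aff j).ncard :=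
          Nat.add_le_add_left (Finset.set_ncard_biUnion_le _ _) _
      _ ≤ 1 + ∑ j ∈ T, (w + 2 * k * w) := by
          refine Nat.add_le_add_left (Finset.sum_le_sum (fun j _ => ?_)) _
          exact (Set.ncard_union_le _ _).trans (Nat.add_le_add (hcard j x) (haffcard j))
      _ ≤ 1 + 4 * (w + 2 * k * w) := by
          rw [Finset.sum_const, smul_eq_mul]
          exact Nat.add_le_add_left (Nat.mul_le_mul_right _ hT4) _

def seg (G : SimpleGraph V) (W : ℕ → Set V) (a b : ℕ) : SimpleGraph V where
  Adj u v := G.Adj u v ∧ ∃ t, a ≤ t ∧ t ≤ b ∧ u ∈ W t ∧ v ∈ W t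
  symm := ⟨fun _ _ ⟨h, t, h1, h2, h3, h4⟩ => ⟨h.symm, t, h1, h2, h4, h3⟩⟩
  loopless := ⟨fun _ h => h.1.ne rfl⟩

def bags (W : ℕ → Set V) (a b : ℕ) : Set V := {u | ∃ t, a ≤ t ∧ t ≤ b ∧ u ∈ W t}

def Conv (W : ℕ → Set V) : Prop :=
  ∀ u i j l, i ≤ j → j ≤ l → u ∈ W i → u ∈ W l → u ∈ W j

def TC (G : SimpleGraph V) (W : ℕ → Set V) (c d : ℕ) : Set (seg G W c d).ConnectedComponent :=
  {C | (∃ x ∈ W c, (seg G W c d).connectedComponentMk x = C) ∧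
       ∃ y ∈ W d, (seg G W c d).connectedComponentMk y = C}

lemma seg_mono (G : SimpleGraph V) (W : ℕ → Set V) {a b c d : ℕ} (h1 : a ≤ c) (h2 : d ≤ b) :
    seg G W c d ≤ seg G W a b := by
  rintro u v ⟨h, t, h3, h4, h5⟩
  exact ⟨h, t, by omega, by omega, h5⟩

lemma seg_supp (G : SimpleGraph V) (W : ℕ → Set V) (a b : ℕ) (u v : V)
    (h : (seg G W a b).Adj u v) : u ∈ bags W a b := by
  obtain ⟨-, t, h1, h2, h3, -⟩ := h
  exact ⟨t, h1, h2, h3⟩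

lemma bags_inter {W : ℕ → Set V} (hW : Conv W) {a t b : ℕ} {u : V}
    (h1 : u ∈ bags W a t) (h2 : u ∈ bags W t b) : u ∈ W t := by
  obtain ⟨s, hs1, hs2, hs⟩ := h1
  obtain ⟨s', hs1', hs2', hs'⟩ := h2
  exact hW u s t s' hs2 hs1' hs hs'

lemma TC_ncard_le [Finite V] (G : SimpleGraph V) (W : ℕ → Set V) (c d : ℕ) :
    (TC G W c d).ncard ≤ (W c).ncard := by
  refine le_trans (Set.ncard_le_ncard (t := (seg G W c d).connectedComponentMk '' W c) ?_
    (Set.toFinite _)) (Set.ncard_image_le (Set.toFinite _))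
  rintro C ⟨⟨x, hx, h⟩, -⟩
  exact ⟨x, hx, h⟩

lemma through_sub (G : SimpleGraph V) {W : ℕ → Set V} (hW : Conv W) {a b c d : ℕ}
    (hac : a ≤ c) (hcd : c ≤ d) (hdb : d ≤ b) {x y : V} (hx : x ∈ W a) (hy : y ∈ W b)
    (h : (seg G W a b).Reachable x y) :
    ∃ z' ∈ W c, ∃ z ∈ W d, (seg G W c d).Reachable z' z ∧ (seg G W a b).Reachable x z' := by
  obtain ⟨z, hz, hxz⟩ := reach_sep (H1 := seg G W a d) (U1 := bags W a d) (U2 := bags W d b)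
    (S := W d) h (by
      rintro u v ⟨huv, t, h1, h2, h3, h4⟩
      rcases le_total t d with h | h
      · exact Or.inl ⟨⟨huv, t, h1, h, h3, h4⟩, t, h1, h, h4⟩
      · exact Or.inr ⟨t, h, h2, h3⟩) (fun u h1 h2 => bags_inter hW h1 h2)
      ⟨a, le_rfl, by omega, hx⟩ ⟨b, hdb, le_rfl, hy⟩
  obtain ⟨z', hz', hxz'⟩ := reach_sep (H1 := seg G W c d) (U1 := bags W c d) (U2 := bags W a c)
    (S := W c) hxz.symm (by
      rintro u v ⟨huv, t, h1, h2, h3, h4⟩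
      rcases le_total t c with h | h
      · exact Or.inr ⟨t, h1, h, h3⟩
      · exact Or.inl ⟨⟨huv, t, h, h2, h3, h4⟩, t, h, h2, h4⟩)
      (fun u h1 h2 => bags_inter hW h2 h1)
      ⟨d, hcd, le_rfl, hz⟩ ⟨a, le_rfl, hac, hx⟩
  exact ⟨z', hz', z, hz, hxz'.symm,
    (hxz.mono (seg_mono G W le_rfl hdb)).trans (hxz'.mono (seg_mono G W hac hdb))⟩

lemma tight [Finite V] (G : SimpleGraph V) {W : ℕ → Set V} (hW : Conv W) {a b c d : ℕ}
    (hac : a ≤ c) (hcd : c ≤ d) (hdb : d ≤ b)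
    (hrank : (TC G W c d).ncard ≤ (TC G W a b).ncard) {p p' q q' : V}
    (hp : p ∈ W c) (hp' : p' ∈ W c) (hq : q ∈ W d) (hq' : q' ∈ W d)
    (h1 : (seg G W c d).Reachable p q) (h2 : (seg G W c d).Reachable p' q')
    (h3 : (seg G W a b).Reachable p p') : (seg G W c d).Reachable p p' := by
  let π : (seg G W c d).ConnectedComponent → (seg G W a b).ConnectedComponent :=
    ConnectedComponent.map (Hom.ofLE (seg_mono G W hac hdb))
  have hsub : TC G W a b ⊆ π '' TC G W c d := by
    rintro C ⟨⟨x, hx, rfl⟩, y, hy, hxy⟩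
    obtain ⟨z', hz', z, hz, hr, hr'⟩ := through_sub G hW hac hcd hdb hx hy
      (ConnectedComponent.exact hxy).symm
    refine ⟨(seg G W c d).connectedComponentMk z', ⟨⟨z', hz', rfl⟩, z, hz,
      ConnectedComponent.sound hr.symm⟩, ?_⟩
    exact ConnectedComponent.sound hr'.symm
  have hle := Set.ncard_le_ncard hsub (Set.toFinite _)
  have hle2 := Set.ncard_image_le (f := π) (Set.toFinite (TC G W c d))
  have hinj := (Set.ncard_image_iff (Set.toFinite (TC G W c d))).1 (by omega : (π '' TC G W c d).ncard = _)
  have := hinj (x₁ := (seg G W c d).connectedComponentMk p)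
    (x₂ := (seg G W c d).connectedComponentMk p')
    ⟨⟨p, hp, rfl⟩, q, hq, ConnectedComponent.sound h1.symm⟩
    ⟨⟨p', hp', rfl⟩, q', hq', ConnectedComponent.sound h2.symm⟩ (ConnectedComponent.sound h3)
  exact ConnectedComponent.exact this

lemma merge [Finite V] (G : SimpleGraph V) {W : ℕ → Set V} (hW : Conv W) {K w : ℕ}
    (hK : ∀ t, (W t).ncard ≤ K) (hw : 1 ≤ w) {a t b : ℕ} (hat : a ≤ t) (htb : t ≤ b)
    (h1 : Good (seg G W a t) w) (h2 : Good (seg G W t b) w) :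
    Good (seg G W a b) (1 + 4 * (w + 2 * K * w)) := by
  let Gs : ℕ → SimpleGraph V := fun i => if i = 0 then seg G W a t else
    if i = 1 then seg G W t b else ⊥
  let J : ℕ → Set V := fun i => if i = 0 then bags W a t else if i = 1 then bags W t b else ∅
  have hJ : ∀ i u, u ∈ J i → i ≤ 1 := by
    intro i u hu
    by_contra hi
    simp only [J] at hu
    rw [if_neg (by omega), if_neg (by omega)] at hu
    exact hu
  have : seg G W a b = lev Gs (fun _ => True) := by
    ext u v
    constructor
    · rintro ⟨h, s, h1, h2, h3⟩
      rcases le_total s t with h4 | h4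
      · exact ⟨0, trivial, h, s, h1, h4, h3⟩
      · exact ⟨1, trivial, h, s, h4, h2, h3⟩
    · rintro ⟨i, -, h⟩
      simp only [Gs] at h
      split_ifs at h
      · exact seg_mono G W le_rfl htb h
      · exact seg_mono G W hat le_rfl h
      · exact h.elim
  rw [this]
  refine glue Gs J K w ?_ ?_ ?_ ?_ ?_
  · intro i u v h
    simp only [Gs] at h
    simp only [J]
    split_ifs at h ⊢
    · exact seg_supp _ _ _ _ _ _ h
    · exact seg_supp _ _ _ _ _ _ h
    · exact h.elim
  · intro i j u hi hj
    have := hJ i u hi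
    omega
  · intro i
    by_cases hi : i = 0
    · subst hi
      refine (Set.ncard_le_ncard (t := W t) ?_ (Set.toFinite _)).trans (hK t)
      rintro u ⟨h1, h2⟩
      exact bags_inter hW h1 h2
    · have : J i ∩ J (i+1) = ∅ := by
        ext u
        simp only [Set.mem_inter_iff, Set.mem_empty_iff_false, iff_false]
        rintro ⟨-, h⟩
        have := hJ _ _ h
        omega
      rw [this]; simp
  · intro i
    simp only [Gs]
    split_ifs
    · exact h1
    · exact h2
    · exact good_bot.mono hw
  · intro i _ p p' q q' _ _ _ _ _ h
    have := hJ _ _ h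
    omega

lemma rank_ind (K w0 : ℕ) : ∀ d : ℕ, ∃ h : ℕ, ∀ (V : Type) [Finite V] (G : SimpleGraph V)
    (W : ℕ → Set V), Conv W → (∀ t, (W t).ncard ≤ K) →
    (∀ a b, a ≤ b → (W a ∩ W b).Nonempty → Good (seg G W a b) w0) →
    ∀ a b, a ≤ b → ((W a ∩ W b).Nonempty ∨ K + 1 ≤ (TC G W a b).ncard + d) →
      Good (seg G W a b) h := by
  intro d
  induction d with
  | zero =>
    refine ⟨w0, ?_⟩
    intro V _ G W hW hK h0 a b hab h
    rcases h with h | h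
    · exact h0 a b hab h
    · have := TC_ncard_le G W a b
      have := hK a
      omega
  | succ d ih =>
    obtain ⟨h, ih⟩ := ih
    obtain ⟨w1, hw1⟩ : ∃ w1, w1 = h + 2 * K + 1 := ⟨_, rfl⟩
    obtain ⟨w2, hw2⟩ : ∃ w2, w2 = 1 + 4 * (w1 + 2 * K * w1) := ⟨_, rfl⟩
    refine ⟨1 + 4 * (w2 + 2 * K * w2), ?_⟩
    intro V _ G W hW hK h0 a b hab hyp
    have hw12 : w1 ≤ w2 := by rw [hw2]; nlinarith [Nat.zero_le (2 * K * w1)]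
    have hw23 : w2 ≤ 1 + 4 * (w2 + 2 * K * w2) := by nlinarith [Nat.zero_le (2 * K * w2)]
    by_cases hyp' : (W a ∩ W b).Nonempty ∨ K + 1 ≤ (TC G W a b).ncard + d
    · exact (ih V G W hW hK h0 a b hab hyp').mono (by omega)
    have hrk : (TC G W a b).ncard + (d + 1) = K + 1 := by
      push Not at hyp'
      rcases hyp with h | h
      · rw [hyp'.1] at h; exact h.ne_empty rfl |>.elim
      · omega
    have single : ∀ c, Good (seg G W c c) w1 := by
      intro c
      refine (good_small (seg G W c c) (W c) ?_).mono ?_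
      · rintro u v ⟨-, t, h1, h2, h3, -⟩
        obtain rfl : t = c := by omega
        exact h3
      · have := hK c; omega
    rcases hab.eq_or_lt with rfl | hlt
    · exact (single a).mono (by omega)
    have double : ∀ c, Good (seg G W c (c+1)) w1 := by
      intro c
      refine (good_small (seg G W c (c+1)) (W c ∪ W (c+1)) ?_).mono ?_
      · rintro u v ⟨-, t, h1, h2, h3, -⟩
        have : t = c ∨ t = c + 1 := by omega
        rcases this with rfl | rfl
        · exact Or.inl h3
        · exact Or.inr h3
      · have := hK c
        have := hK (c+1)
        have := Set.ncard_union_le (W c) (W (c+1))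
        omega
    let P : ℕ → ℕ → Prop := fun c t => t = b ∨
      (¬ (W c ∩ W t).Nonempty ∧ (TC G W c t).ncard ≤ (TC G W a b).ncard)
    have hnxt : ∀ c, ∃ n, (b ≤ c → n = c) ∧ (c < b → c < n ∧ n ≤ b ∧ P c n ∧
        ∀ t, c < t → t < n → ¬ P c t) := by
      intro c
      rcases Nat.lt_or_ge c b with hc | hc
      · classical
        have hex : ∃ n, c < n ∧ P c n := ⟨b, hc, Or.inl rfl⟩
        refine ⟨Nat.find hex, fun h => by omega, fun _ => ⟨(Nat.find_spec hex).1,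
          Nat.find_min' hex ⟨hc, Or.inl rfl⟩, (Nat.find_spec hex).2, ?_⟩⟩
        intro t h1 h2 h3
        exact Nat.find_min hex h2 ⟨h1, h3⟩
      · exact ⟨c, fun _ => rfl, fun h => by omega⟩
    choose nxt hn1 hn2 using hnxt
    have seggood : ∀ c, c < b → Good (seg G W c (nxt c)) w2 := by
      intro c hc
      obtain ⟨g1, g2, g3, g4⟩ := hn2 c hc
      obtain ⟨t, ht⟩ : ∃ t, nxt c = t + 1 := ⟨nxt c - 1, by omega⟩
      rw [ht, hw2]
      refine merge G hW hK (by omega) (t := t) (by omega) (by omega) ?_ (double t)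
      rcases Nat.lt_or_ge c t with h1 | h1
      · have := g4 t h1 (by omega)
        simp only [P, not_or, not_and_or, not_not, not_le] at this
        refine (ih V G W hW hK h0 c t h1.le ?_).mono (by omega)
        rcases this.2 with h2 | h2
        · exact Or.inl h2
        · right; omega
      · obtain rfl : c = t := by omega
        exact single c
    let c : ℕ → ℕ := fun i => nxt^[i] a
    have hc0 : c 0 = a := rfl
    have hcs : ∀ i, c (i+1) = nxt (c i) := fun i => Function.iterate_succ_apply' _ _ _
    have hcb : ∀ i, c i ≤ b := by
      intro i
      induction i with
      | zero => exact hab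
      | succ i ihi =>
        rw [hcs]
        rcases ihi.eq_or_lt with h1 | h1
        · rw [hn1 _ h1.ge]; exact ihi
        · exact (hn2 _ h1).2.1
    have hcm : Monotone c := by
      apply monotone_nat_of_le_succ
      intro i
      rw [hcs]
      rcases (hcb i).eq_or_lt with h1 | h1
      · rw [hn1 _ h1.ge]
      · exact (hn2 _ h1).1.le
    have hcl : ∀ i, c i = b ∨ a + i ≤ c i := by
      intro i
      induction i with
      | zero => right; exact le_rfl
      | succ i ihi =>
        rw [hcs]
        rcases (hcb i).eq_or_lt with h1 | h1
        · left; rw [hn1 _ h1.ge, h1]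
        · right
          have := (hn2 _ h1).1
          omega
    have hP : ∀ i, c (i+1) < b → ¬ (W (c i) ∩ W (c (i+1))).Nonempty ∧
        (TC G W (c i) (c (i+1))).ncard ≤ (TC G W a b).ncard := by
      intro i hi
      have h1 : c i < b := lt_of_le_of_lt (hcm (Nat.le_succ i)) hi
      have := (hn2 _ h1).2.2.1
      rw [← hcs] at this
      rcases this with h2 | h2
      · omega
      · exact h2
    have hcov : ∀ t, a ≤ t → t ≤ b → ∃ i, c i < b ∧ c i ≤ t ∧ t ≤ c (i+1) := by
      intro t h1 h2
      classical
      have hex : ∃ i, t ≤ c i := ⟨b, by rcases hcl b with h | h <;> omega⟩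
      have hs := Nat.find_spec hex
      rcases Nat.eq_zero_or_eq_succ_pred (Nat.find hex) with h3 | h3
      · rw [h3, hc0] at hs
        exact ⟨0, by rw [hc0]; exact hlt, by rw [hc0]; exact h1,
          hs.trans (by rw [← hc0]; exact hcm (Nat.zero_le _))⟩
      · have h4 := Nat.find_min hex (m := (Nat.find hex).pred) (by omega)
        refine ⟨(Nat.find hex).pred, by omega, by omega, ?_⟩
        rw [h3] at hs
        exact hs
    classical
    let Gs : ℕ → SimpleGraph V := fun i => if c i < b then seg G W (c i) (c (i+1)) else ⊥
    let J : ℕ → Set V := fun i => {u | c i < b ∧ u ∈ bags W (c i) (c (i+1))}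
    have hseg : seg G W a b = lev Gs (fun _ => True) := by
      ext u v
      constructor
      · rintro ⟨h, s, h1, h2, h3⟩
        obtain ⟨i, h4, h5, h6⟩ := hcov s h1 h2
        refine ⟨i, trivial, ?_⟩
        simp only [Gs]
        rw [if_pos h4]
        exact ⟨h, s, h5, h6, h3⟩
      · rintro ⟨i, -, h⟩
        simp only [Gs] at h
        split_ifs at h
        · exact seg_mono G W (hcm (Nat.zero_le i)) (hcb _) h
        · exact h.elim
    have hJJ : ∀ i u, u ∈ J i → u ∈ J (i+1) → u ∈ W (c (i+1)) := by
      intro i u h1 h2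
      exact bags_inter hW h1.2 h2.2
    rw [hseg]
    refine glue Gs J K w2 ?_ ?_ ?_ ?_ ?_
    · intro i u v h
      simp only [Gs] at h
      split_ifs at h with h1
      · exact ⟨h1, seg_supp _ _ _ _ _ _ h⟩
      · exact h.elim
    · rintro i j u ⟨h1, t, h2, h3, h4⟩ ⟨h5, t', h6, h7, h8⟩
      by_contra hij
      have m1 : c (j+2) ≤ c i := hcm (by omega)
      have m2 : c (j+1) ≤ c (j+2) := hcm (by omega)
      have := (hP (j+1) (by show c (j+2) < b; omega)).1
      apply this
      exact ⟨u, hW u t' _ t h7 (by omega) h8 h4, hW u t' _ t (by show t' ≤ c (j+2); omega)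
        (by show c (j+2) ≤ t; omega) h8 h4⟩
    · intro i
      refine (Set.ncard_le_ncard (t := W (c (i+1))) ?_ (Set.toFinite _)).trans (hK _)
      rintro u ⟨h1, h2⟩
      exact hJJ i u h1 h2
    · intro i
      simp only [Gs]
      split_ifs with h1
      · rw [hcs]; exact seggood _ h1
      · exact good_bot.mono (by omega)
    · intro i _ p p' q q' p1 p2 p3 p4 q1 q2 q3 q4 r1 r2 r3
      rw [← hseg] at r3
      have hG : Gs (i+1) = seg G W (c (i+1)) (c (i+2)) := by
        simp only [Gs]; rw [if_pos p2.1]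
      rw [hG] at r1 r2 ⊢
      exact tight G hW (hcm (Nat.zero_le (i+1))) (hcm (by omega)) (hcb _) (hP (i+1) q2.1).2
        (hJJ i p p1 p2) (hJJ i p' p3 p4) (hJJ (i+1) q q1 q2) (hJJ (i+1) q' q3 q4) r1 r2 r3

lemma main_k : ∀ k : ℕ, ∃ w : ℕ, ∀ (V : Type) [Finite V] (G : SimpleGraph V)
    (W : ℕ → Set V), Conv W → (∀ t, (W t).ncard ≤ k) → ∀ a b, Good (seg G W a b) w := by
  intro k
  induction k with
  | zero =>
    refine ⟨1, ?_⟩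
    intro V _ G W hW hk a b
    have : seg G W a b = ⊥ := by
      ext u v
      simp only [bot_adj, iff_false]
      rintro ⟨-, t, -, -, h, -⟩
      have := hk t
      rw [Nat.le_zero, Set.ncard_eq_zero (Set.toFinite _)] at this
      rw [this] at h; exact h
    rw [this]; exact good_bot
  | succ k ih =>
    obtain ⟨w, ih⟩ := ih
    obtain ⟨h, hh⟩ := rank_ind (k+1) (w+1) (k+2)
    refine ⟨h + 1, ?_⟩
    intro V _ G W hW hk a b
    rcases Nat.lt_or_ge b a with hab | hab
    · have : seg G W a b = ⊥ := by
        ext u v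
        simp only [bot_adj, iff_false]
        rintro ⟨-, t, h1, h2, -⟩
        omega
      rw [this]; exact good_bot.mono (by omega)
    refine (hh V G W hW hk ?_ a b hab (Or.inr (by omega))).mono (by omega)
    rintro a b hab ⟨u, hua, hub⟩
    have := good_apex (seg G W a b) {u} w ?_
    · rwa [Set.ncard_singleton] at this
    let W' : ℕ → Set V := fun t => {v | (a ≤ t ∧ t ≤ b) ∧ v ∈ W t ∧ v ≠ u}
    have heq : rest (seg G W a b) {u}ᶜ = seg G W' a b := by
      ext x y
      constructor
      · rintro ⟨⟨h, t, h1, h2, h3, h4⟩, h5, h6⟩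
        exact ⟨h, t, h1, h2, ⟨⟨h1, h2⟩, h3, h5⟩, ⟨⟨h1, h2⟩, h4, h6⟩⟩
      · rintro ⟨h, t, h1, h2, h3, h4⟩
        exact ⟨⟨h, t, h1, h2, h3.2.1, h4.2.1⟩, h3.2.2, h4.2.2⟩
    rw [heq]
    refine ih V G W' ?_ ?_ a b
    · rintro v i j l hij hjl ⟨h1, h2, h3⟩ ⟨h4, h5, h6⟩
      exact ⟨by omega, hW v i j l hij hjl h2 h5, h3⟩
    · intro t
      by_cases ht : a ≤ t ∧ t ≤ b
      · have hut : u ∈ W t := hW u a t b ht.1 ht.2 hua hub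
        have h1 : W' t ⊆ W t \ {u} := fun v hv => ⟨hv.2.1, hv.2.2⟩
        have h2 := Set.ncard_le_ncard h1 (Set.toFinite _)
        rw [Set.ncard_sdiff_singleton_of_mem hut] at h2
        have := hk t
        omega
      · have : W' t = ∅ := by
          ext v
          simp only [Set.mem_empty_iff_false, iff_false]
          rintro ⟨h, -⟩
          exact ht h
        rw [this]; simp

end SpanTD

/-- There is a function `f : ℕ⁺ → ℕ` such that every connected finite graph `G`
of pathwidth less than `k` has a tree decomposition of width at most `f k`
indexed by a spanning tree `T` of `G`, in which moreover every vertex belongs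
to its own bag. -/
theorem mainTheorem :
    ∃ f : ℕ+ → ℕ, ∀ (k : ℕ+) (V : Type) (_ : Fintype V) (G : SimpleGraph V),
      G.Connected → PathwidthLt G k →
      ∃ (T : SimpleGraph V) (W : V → Set V),
        T ≤ G ∧ T.IsTree ∧ IsTreeDecompOn G T W ∧
        (∀ x : V, (W x).ncard ≤ f k + 1) ∧ (∀ x : V, x ∈ W x) := by
  choose w hw using SpanTD.main_k
  refine ⟨fun k => w k, ?_⟩
  intro k V _ G hG ⟨m, B, ⟨hB1, hB2, hB3⟩, hB4⟩
  let W : ℕ → Set V := fun t => {v | ∃ h : t < m, v ∈ B ⟨t, h⟩}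
  have hconv : SpanTD.Conv W := by
    rintro u i j l hij hjl ⟨h1, h2⟩ ⟨h3, h4⟩
    exact ⟨by omega, hB2 u ⟨i, h1⟩ ⟨j, by omega⟩ ⟨l, h3⟩ hij hjl h2 h4⟩
  have hcard : ∀ t, (W t).ncard ≤ k := by
    intro t
    by_cases ht : t < m
    · have : W t = B ⟨t, ht⟩ := by
        ext v
        exact ⟨fun ⟨_, h⟩ => h, fun h => ⟨ht, h⟩⟩
      rw [this]; exact hB4 _
    · have : W t = ∅ := by
        ext v
        simp only [Set.mem_empty_iff_false, iff_false]
        rintro ⟨h, -⟩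
        exact ht h
      rw [this]; simp
  have hgood := hw k V G W hconv hcard 0 m
  have heq : SpanTD.seg G W 0 m = G := by
    ext u v
    constructor
    · exact fun h => h.1
    · intro h
      obtain ⟨i, h1, h2⟩ := hB3 u v h
      exact ⟨h, i, Nat.zero_le _, i.2.le, ⟨i.2, h1⟩, ⟨i.2, h2⟩⟩
  rw [heq] at hgood
  obtain ⟨F, h1, h2, h3, S, h4, h5, h6, h7⟩ := hgood
  have := hG.nonempty
  refine ⟨F, fun x => {u | x ∈ S u}, h1, ⟨⟨fun x y => h3 x y (hG.preconnected x y)⟩, h2⟩,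
    ⟨?_, ?_⟩, fun x => (h7 x).trans (Nat.le_succ _), fun x => h4 x⟩
  · intro u
    have hne : Nonempty {x | u ∈ {u | x ∈ S u}} := ⟨⟨u, h4 u⟩⟩
    have key : ∀ (a b : V) (p : (SpanTD.rest F (S u)).Walk a b) (ha : a ∈ S u) (hb : b ∈ S u),
        (F.induce {x | u ∈ {u | x ∈ S u}}).Reachable ⟨a, ha⟩ ⟨b, hb⟩ := by
      intro a b p
      induction p with
      | nil => intro _ _; exact Reachable.refl _
      | cons hab q ih =>
        intro ha hb
        refine Reachable.trans (Adj.reachable ?_) (ih hab.2.2 hb)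
        exact hab.1
    have key2 : ∀ x : {x | u ∈ {u | x ∈ S u}},
        (F.induce {x | u ∈ {u | x ∈ S u}}).Reachable ⟨u, h4 u⟩ x := by
      rintro ⟨x, hx⟩
      obtain ⟨p⟩ := h5 u x hx
      exact key u x p (h4 u) hx
    exact ⟨fun x y => (key2 x).symm.trans (key2 y)⟩
  · intro u v huv
    exact h6 u v huv
end

section
/- For every positive integer k and every connected finite graph G of pathwidth less than k, there exist a tree T that is a spanning tree of G and bags (W_x)_{x ∈ V(T)} such that (T, (W_x)_{x ∈ V(T)}) is a tree decomposition of G of width at most 9k·2^(3k+4k²) − 1, and moreover x ∈ W_x for every vertex x of G. -/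
open SimpleGraph

namespace PWProof

variable {V : Type}

def res (G : SimpleGraph V) (S : Set V) : SimpleGraph V where
  Adj u v := G.Adj u v ∧ u ∈ S ∧ v ∈ S
  symm := ⟨fun _ _ h => ⟨h.1.symm, h.2.2, h.2.1⟩⟩
  loopless := ⟨fun _ h => h.1.ne rfl⟩

theorem res_adj {G : SimpleGraph V} {S : Set V} {u v : V} :
    (res G S).Adj u v ↔ G.Adj u v ∧ u ∈ S ∧ v ∈ S := Iff.rfl

theorem res_mono {G H : SimpleGraph V} {S T : Set V} (h : G ≤ H) (h' : S ⊆ T) :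
    res G S ≤ res H T := fun _ _ e => ⟨h e.1, h' e.2.1, h' e.2.2⟩

theorem res_le (G : SimpleGraph V) (S : Set V) : res G S ≤ G := fun _ _ e => e.1

theorem res_res (G : SimpleGraph V) (S T : Set V) : res (res G S) T = res G (S ∩ T) := by
  ext u v
  simp only [res_adj, Set.mem_inter_iff]
  tauto

theorem reach_ind {G : SimpleGraph V} {p : V → Prop} {u v : V} (h : G.Reachable u v) (h0 : p u)
    (hs : ∀ v w, G.Adj v w → G.Reachable u v → p v → p w) : p v := by
  rw [reachable_iff_reflTransGen] at h
  induction h with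
  | refl => exact h0
  | tail h1 h2 ih => exact hs _ _ h2 ((reachable_iff_reflTransGen _ _).2 h1) ih

/-- reachability inside a closed set -/
theorem reach_res_of_closed {F : SimpleGraph V} {S : Set V} {u v : V} (h : F.Reachable u v)
    (hu : u ∈ S) (hc : ∀ x y, F.Adj x y → x ∈ S → y ∈ S) : (res F S).Reachable u v := by
  have := reach_ind (p := fun x => x ∈ S ∧ (res F S).Reachable u x) h ⟨hu, Reachable.refl _⟩
    (fun x y e _ hp => ⟨hc x y e hp.1,
      hp.2.trans (Adj.reachable (show (res F S).Adj x y from ⟨e, hp.1, hc x y e hp.1⟩))⟩)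
  exact this.2

theorem reach_res_comp {F : SimpleGraph V} {u v : V} (h : F.Reachable u v) :
    (res F {y | F.Reachable u y}).Reachable u v :=
  reach_res_of_closed h (Reachable.refl _) (fun _ _ e hx => Reachable.trans hx e.reachable)

theorem reach_mem {F : SimpleGraph V} {S : Set V} {u v : V} (h : (res F S).Reachable u v)
    (hu : u ∈ S) : v ∈ S :=
  reach_ind (p := fun x => x ∈ S) h hu (fun _ _ e _ _ => e.2.2)

def Good (G : SimpleGraph V) (c : ℕ) : Prop :=
  ∃ (F : SimpleGraph V) (W : V → Set V), F ≤ G ∧ F.IsAcyclic ∧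
    (∀ u v, G.Reachable u v → F.Reachable u v) ∧
    (∀ x, x ∈ W x) ∧
    (∀ u x, u ∈ W x → (res F {y | u ∈ W y}).Reachable u x) ∧
    (∀ u v, G.Adj u v → ∃ x, u ∈ W x ∧ v ∈ W x) ∧
    (∀ x, (W x).ncard ≤ c)

theorem Good.mono {G : SimpleGraph V} {c d : ℕ} (h : Good G c) (hcd : c ≤ d) : Good G d := by
  obtain ⟨F, W, h1, h2, h3, h4, h5, h6, h7⟩ := h
  exact ⟨F, W, h1, h2, h3, h4, h5, h6, fun x => (h7 x).trans hcd⟩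

theorem good_bot : Good (⊥ : SimpleGraph V) 1 := by
  refine ⟨⊥, fun x => {x}, le_rfl, isAcyclic_bot, fun _ _ h => h, fun x => rfl, ?_, ?_, ?_⟩
  · rintro u x (rfl : u = x); exact Reachable.refl _
  · intro u v h; exact absurd h (by simp)
  · intro x; simp

theorem good_of_empty {G : SimpleGraph V} {S : Set V} (h : S = ∅) : Good (res G S) 1 := by
  have : res G S = ⊥ := by
    ext u v; simp [res_adj, h]
  rw [this]; exact good_bot

theorem extend [Finite V] {G F' F : SimpleGraph V} {W' : V → Set V} {M : Set V} {S : V → Set V} {c d : ℕ}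
    (hF'F : F' ≤ F) (hFG : F ≤ G) (hac : F.IsAcyclic)
    (hr : ∀ u v, G.Reachable u v → F.Reachable u v)
    (h4 : ∀ x, x ∈ W' x)
    (h5 : ∀ u x, u ∈ W' x → (res F' {y | u ∈ W' y}).Reachable u x)
    (h6 : ∀ u v, (res G Mᶜ).Adj u v → ∃ x, u ∈ W' x ∧ v ∈ W' x)
    (h7 : ∀ x, (W' x).ncard ≤ c)
    (hS : ∀ u ∈ M, ∀ x ∈ S u, (res F (S u)).Reachable u x)
    (hN : ∀ u ∈ M, ∀ v, G.Adj u v → v ∈ S u)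
    (hd : ∀ x, {u | u ∈ M ∧ x ∈ S u}.ncard ≤ d) : Good G (c + d) := by
  refine ⟨F, fun x => W' x ∪ {u | u ∈ M ∧ x ∈ S u}, hFG, hac, hr, fun x => Or.inl (h4 x),
    ?_, ?_, ?_⟩
  · rintro u x (h | h)
    · exact (h5 u x h).mono (res_mono hF'F (fun y hy => Or.inl hy))
    · exact (hS u h.1 x h.2).mono (res_mono le_rfl (fun y hy => Or.inr ⟨h.1, hy⟩))
  · intro u v e
    by_cases hu : u ∈ M
    · exact ⟨v, Or.inr ⟨hu, hN u hu v e⟩, Or.inl (h4 v)⟩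
    · by_cases hv : v ∈ M
      · exact ⟨u, Or.inl (h4 u), Or.inr ⟨hv, hN v hv u e.symm⟩⟩
      · obtain ⟨x, hx⟩ := h6 u v ⟨e, hu, hv⟩
        exact ⟨x, Or.inl hx.1, Or.inl hx.2⟩
  · intro x
    exact (Set.ncard_union_le _ _).trans (add_le_add (h7 x) (hd x))

theorem good_bin [Finite V] {G : SimpleGraph V} {M : Set V} {c d : ℕ} (h : Good (res G Mᶜ) c)
    (hM : M.ncard ≤ d) : Good G (c + d) := by
  obtain ⟨F', W', h1, h2, h3, h4, h5, h6, h7⟩ := h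
  obtain ⟨F, hF'F, hFG, hac, hr⟩ :=
    G.exists_isAcyclic_reachable_eq_le_of_le_of_isAcyclic (h1.trans (res_le _ _)) h2
  have hr' : ∀ u v, G.Reachable u v → F.Reachable u v := fun u v huv => by rw [hr]; exact huv
  refine extend (S := fun u => {x | F.Reachable u x}) (M := M) hF'F hFG hac hr' h4 h5 h6 h7 ?_ ?_ ?_
  · intro u _ x hx; exact reach_res_comp hx
  · intro u _ v e; exact hr' _ _ e.reachable
  · intro x
    exact (Set.ncard_le_ncard (fun u hu => hu.1) (Set.toFinite _)).trans hM

theorem good_union {G : SimpleGraph V} (lab : V → ℕ) {c : ℕ}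
    (hl : ∀ u v, G.Adj u v → lab u = lab v)
    (h : ∀ l, Good (res G {v | lab v = l}) c) : Good G c := by
  choose F W h1 h2 h3 h4 h5 h6 h7 using h
  let F0 : SimpleGraph V :=
    { Adj := fun u v => lab u = lab v ∧ (F (lab u)).Adj u v
      symm := ⟨fun u v e => ⟨e.1.symm, by rw [← e.1]; exact e.2.symm⟩⟩
      loopless := ⟨fun u e => e.2.ne rfl⟩ }
  have toF0 : ∀ {l u v}, (F l).Adj u v → F0.Adj u v := by
    intro l u v e
    have := h1 l e
    have hu : lab u = l := this.2.1
    have hv : lab v = l := this.2.2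
    exact ⟨hu.trans hv.symm, by rw [hu]; exact e⟩
  have labW : ∀ l u x, u ∈ W l x → lab x = l → lab u = l := by
    intro l u x hu hx
    by_contra hne
    have := reach_ind (p := fun y => y = u) (h5 l u x hu) rfl (by
      rintro v w e _ rfl
      exact absurd (h1 l e.1).2.1 hne)
    subst this; exact hne hx
  refine ⟨F0, fun x => W (lab x) x, ?_, ?_, ?_, ?_, ?_, ?_, ?_⟩
  · intro u v e; exact (h1 _ e.2).1
  · rw [isAcyclic_iff_forall_adj_isBridge]
    intro u v e
    rw [isBridge_iff]
    intro hreach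
    have hb := (isAcyclic_iff_forall_adj_isBridge.1 (h2 (lab u))) e.2
    rw [isBridge_iff] at hb
    apply hb
    refine (reach_ind (p := fun y => lab y = lab u ∧
      ((F (lab u)).deleteEdges {s(u, v)}).Reachable u y) hreach ⟨rfl, Reachable.refl _⟩ ?_).2
    rintro x y e' _ ⟨hx, hp⟩
    rw [deleteEdges_adj] at e'
    refine ⟨e'.1.1.symm.trans hx, hp.trans (Adj.reachable ?_)⟩
    rw [deleteEdges_adj]
    exact ⟨by rw [← hx]; exact e'.1.2, e'.2⟩
  · intro u v huv
    have : (res G {x | lab x = lab u}).Reachable u v :=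
      reach_res_of_closed huv rfl (fun x y e hx => (hl x y e).symm.trans hx)
    exact (h3 _ _ _ this).mono (fun x y e => toF0 e)
  · intro x; exact h4 _ x
  · intro u x hu
    have hlu := labW _ u x hu rfl
    refine (h5 _ u x hu).mono ?_
    rintro a b ⟨e, ha, hb⟩
    have h := h1 _ e
    refine ⟨toF0 e, ?_, ?_⟩
    · have := h.2.1
      simp only [Set.mem_ofPred_eq] at this ha ⊢
      rw [this]; exact ha
    · have := h.2.2
      simp only [Set.mem_ofPred_eq] at this hb ⊢
      rw [this]; exact hb
  · intro u v e
    obtain ⟨x, hx, hx'⟩ := h6 (lab u) u v ⟨e, rfl, (hl u v e).symm⟩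
    have hxl : lab x = lab u := by
      by_contra hne
      have := reach_ind (p := fun y => lab y = lab u) (h5 _ u x hx) rfl
        (fun v w e _ _ => (h1 _ e.1).2.2)
      exact hne this
    refine ⟨x, ?_, ?_⟩ <;> simpa only [hxl]
  · intro x; exact h7 _ x

theorem layered [Finite V] {G : SimpleGraph V} (pos : V → ℕ) {c k : ℕ}
    (hpos : ∀ v, 1 ≤ pos v)
    (hadj : ∀ u v, G.Adj u v → ∃ l, 2 * l ≤ pos u ∧ pos u ≤ 2 * l + 2 ∧ 2 * l ≤ pos v ∧
      pos v ≤ 2 * l + 2)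
    (hlev : ∀ e, {u | pos u = 2 * e}.ncard ≤ k)
    (locR : ∀ e x y, pos x = 2 * e → pos y = 2 * e →
      (res G {v | 2 * e ≤ pos v}).Reachable x y →
      (res G {v | 2 * e ≤ pos v ∧ pos v ≤ 2 * e + 2}).Reachable x y)
    (locL : ∀ e x y, pos x = 2 * e → pos y = 2 * e →
      (res G {v | pos v ≤ 2 * e}).Reachable x y →
      (res G {v | 2 * e ≤ pos v + 2 ∧ pos v ≤ 2 * e}).Reachable x y)
    (h : Good (res G {v | pos v % 2 = 0}ᶜ) c) : Good G (c + 9 * k) := by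
  obtain ⟨F', W', h1, h2, h3, h4, h5, h6, h7⟩ := h
  let G1 : SimpleGraph V :=
    { Adj := fun u v => G.Adj u v ∧ ((pos u % 2 = 1 ∧ pos v % 2 = 1) ∨
        (pos u % 4 ≤ 2 ∧ pos v % 4 ≤ 2 ∧ pos u / 4 = pos v / 4))
      symm := ⟨fun u v e => ⟨e.1.symm, by omega⟩⟩
      loopless := ⟨fun u e => e.1.ne rfl⟩ }
  have hF'G1 : F' ≤ G1 := by
    intro u v e
    have := h1 e
    refine ⟨this.1, Or.inl ⟨?_, ?_⟩⟩
    · have h := this.2.1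
      simp only [Set.mem_compl_iff, Set.mem_ofPred_eq] at h; omega
    · have h := this.2.2
      simp only [Set.mem_compl_iff, Set.mem_ofPred_eq] at h; omega
  obtain ⟨F1, hF'1, hF1G, hac1, hr1⟩ :=
    G1.exists_isAcyclic_reachable_eq_le_of_le_of_isAcyclic hF'G1 h2
  obtain ⟨F, hF1F, hFG, hac, hr⟩ :=
    G.exists_isAcyclic_reachable_eq_le_of_le_of_isAcyclic
      (hF1G.trans (fun u v e => e.1)) hac1
  have hr' : ∀ u v, G.Reachable u v → F.Reachable u v := fun u v huv => by rw [hr]; exact huv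
  -- connectivity in the even blocks
  have blockD : ∀ (j : ℕ) (x y : V), (4 * j ≤ pos x ∧ pos x ≤ 4 * j + 2) →
      (res G {v | 4 * j ≤ pos v ∧ pos v ≤ 4 * j + 2}).Reachable x y →
      (res F {v | 4 * j ≤ pos v ∧ pos v ≤ 4 * j + 2}).Reachable x y := by
    intro j x y hx hxy
    have hG1 : G1.Reachable x y := hxy.mono (by
      rintro a b ⟨e, ha, hb⟩
      simp only [Set.mem_ofPred_eq] at ha hb
      exact ⟨e, Or.inr ⟨by omega, by omega, by omega⟩⟩)
    have hF1 : F1.Reachable x y := by rw [hr1]; exact hG1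
    refine (reach_res_of_closed hF1 (S := {v | 4 * j ≤ pos v ∧ pos v ≤ 4 * j + 2}) hx ?_).mono
      (res_mono hF1F le_rfl)
    intro a b e ha
    have he := hF1G e
    obtain ⟨l, hl⟩ := hadj a b he.1
    have he2 := he.2
    simp only [Set.mem_ofPred_eq] at ha ⊢
    omega
  have win : ∀ (j : ℕ) (x y : V), (4 * j + 2 ≤ pos x ∧ pos x ≤ 4 * j + 4) →
      (4 * j + 2 ≤ pos y ∧ pos y ≤ 4 * j + 4) → F.Reachable x y →
      (res F {v | 4 * j ≤ pos v ∧ pos v ≤ 4 * j + 6}).Reachable x y := by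
    intro j x y hx hy hxy
    have key := reach_ind (p := fun v =>
      ((4 * j + 2 ≤ pos v ∧ pos v ≤ 4 * j + 4) ∧
        (res F {v | 4 * j ≤ pos v ∧ pos v ≤ 4 * j + 6}).Reachable x v) ∨
      (pos v < 4 * j + 2 ∧ ∃ a, pos a = 4 * j + 2 ∧
        (res F {v | 4 * j ≤ pos v ∧ pos v ≤ 4 * j + 6}).Reachable x a ∧
        (res G {v | pos v ≤ 4 * j + 2}).Reachable a v) ∨
      (4 * j + 4 < pos v ∧ ∃ a, pos a = 4 * j + 4 ∧
        (res F {v | 4 * j ≤ pos v ∧ pos v ≤ 4 * j + 6}).Reachable x a ∧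
        (res G {v | 4 * j + 4 ≤ pos v}).Reachable a v)) hxy (Or.inl ⟨hx, Reachable.refl _⟩) (by
      intro v w e _ hp
      have eG := hFG e
      obtain ⟨l, hl⟩ := hadj v w eG
      rcases hp with ⟨hv, hp⟩ | ⟨hv, a, ha, hxa, hav⟩ | ⟨hv, a, ha, hxa, hav⟩
      · rcases lt_or_ge (pos w) (4 * j + 2) with hw | hw
        · refine Or.inr (Or.inl ⟨hw, v, by omega, hp, Adj.reachable ⟨eG, ?_, ?_⟩⟩) <;>
            simp only [Set.mem_ofPred_eq] <;> omega
        rcases lt_or_ge (4 * j + 4) (pos w) with hw' | hw'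
        · refine Or.inr (Or.inr ⟨hw', v, by omega, hp, Adj.reachable ⟨eG, ?_, ?_⟩⟩) <;>
            simp only [Set.mem_ofPred_eq] <;> omega
        · refine Or.inl ⟨⟨hw, hw'⟩, hp.trans (Adj.reachable ⟨e, ?_, ?_⟩)⟩ <;>
            simp only [Set.mem_ofPred_eq] <;> omega
      · have haw : (res G {v | pos v ≤ 4 * j + 2}).Reachable a w := by
          refine hav.trans (Adj.reachable ⟨eG, ?_, ?_⟩) <;>
            simp only [Set.mem_ofPred_eq] <;> omega
        rcases lt_or_ge (pos w) (4 * j + 2) with hw | hw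
        · exact Or.inr (Or.inl ⟨hw, a, ha, hxa, haw⟩)
        · have hw2 : pos w = 4 * j + 2 := by omega
          refine Or.inl ⟨by omega, hxa.trans ?_⟩
          have := locL (2 * j + 1) a w (by omega) (by omega)
            (haw.mono (res_mono le_rfl (fun z hz => by
              simp only [Set.mem_ofPred_eq] at hz ⊢; omega)))
          have := blockD j a w (by omega) (this.mono (res_mono le_rfl (fun z hz => by
              simp only [Set.mem_ofPred_eq] at hz ⊢; omega)))
          exact this.mono (res_mono le_rfl (fun z hz => by
              simp only [Set.mem_ofPred_eq] at hz ⊢; omega))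
      · have haw : (res G {v | 4 * j + 4 ≤ pos v}).Reachable a w := by
          refine hav.trans (Adj.reachable ⟨eG, ?_, ?_⟩) <;>
            simp only [Set.mem_ofPred_eq] <;> omega
        rcases lt_or_ge (4 * j + 4) (pos w) with hw | hw
        · exact Or.inr (Or.inr ⟨hw, a, ha, hxa, haw⟩)
        · have hw2 : pos w = 4 * j + 4 := by omega
          refine Or.inl ⟨by omega, hxa.trans ?_⟩
          have := locR (2 * j + 2) a w (by omega) (by omega)
            (haw.mono (res_mono le_rfl (fun z hz => by
              simp only [Set.mem_ofPred_eq] at hz ⊢; omega)))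
          have := blockD (j + 1) a w (by omega) (this.mono (res_mono le_rfl (fun z hz => by
              simp only [Set.mem_ofPred_eq] at hz ⊢; omega)))
          exact this.mono (res_mono le_rfl (fun z hz => by
              simp only [Set.mem_ofPred_eq] at hz ⊢; omega)))
    rcases key with h | h | h
    · exact h.2
    · omega
    · omega
  refine extend (M := {v | pos v % 2 = 0}) (S := fun u => {x |
    (res F {v | 4 * ((pos u - 2) / 4) ≤ pos v ∧ pos v ≤ 4 * ((pos u - 2) / 4) + 6}).Reachable u x})
    (hF'1.trans hF1F) hFG hac hr' h4 h5 h6 h7 ?_ ?_ ?_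
  · intro u _ x hx
    exact (reach_res_comp hx).mono (res_mono (res_le _ _) le_rfl)
  · intro u hu v e
    have hu' : pos u % 2 = 0 := hu
    have := hpos u
    obtain ⟨l, hl⟩ := hadj u v e
    obtain ⟨j, hj⟩ : ∃ j, j = (pos u - 2) / 4 := ⟨_, rfl⟩
    show (res F {v | 4 * ((pos u - 2) / 4) ≤ pos v ∧
      pos v ≤ 4 * ((pos u - 2) / 4) + 6}).Reachable u v
    rw [← hj]
    rcases lt_or_ge (pos v) (4 * j + 2) with hv | hv
    · have := blockD j u v (by omega) (Adj.reachable ⟨e, by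
        simp only [Set.mem_ofPred_eq]; omega, by simp only [Set.mem_ofPred_eq]; omega⟩)
      exact this.mono (res_mono le_rfl (fun z hz => by
              simp only [Set.mem_ofPred_eq] at hz ⊢; omega))
    rcases lt_or_ge (4 * j + 4) (pos v) with hv' | hv'
    · have := blockD (j + 1) u v (by omega) (Adj.reachable ⟨e, by
        simp only [Set.mem_ofPred_eq]; omega, by simp only [Set.mem_ofPred_eq]; omega⟩)
      exact this.mono (res_mono le_rfl (fun z hz => by
              simp only [Set.mem_ofPred_eq] at hz ⊢; omega))
    · exact win j u v (by omega) (by omega) (hr' _ _ e.reachable)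
  · intro x
    have hsub : {u | u ∈ {v | pos v % 2 = 0} ∧ x ∈ {x | (res F {v | 4 * ((pos u - 2) / 4) ≤ pos v ∧
        pos v ≤ 4 * ((pos u - 2) / 4) + 6}).Reachable u x}} ⊆
        ⋃ i ∈ Finset.range 9, {u | pos u % 2 = 0 ∧ pos u + 4 = pos x + i} := by
      rintro u ⟨hu, hx⟩
      have hu' : pos u % 2 = 0 := hu
      have := hpos u
      have hm := reach_mem hx (by simp only [Set.mem_ofPred_eq]; omega)
      simp only [Set.mem_ofPred_eq] at hm
      simp only [Set.mem_iUnion, Finset.mem_range, Set.mem_ofPred_eq]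
      exact ⟨pos u + 4 - pos x, by omega, hu', by omega⟩
    refine (Set.ncard_le_ncard hsub (Set.toFinite _)).trans ?_
    refine (Finset.set_ncard_biUnion_le _ _).trans ?_
    refine (Finset.sum_le_card_nsmul _ _ k ?_).trans (by simp)
    intro i _
    refine (Set.ncard_le_ncard ?_ (Set.toFinite _)).trans (hlev ((pos x + i - 4) / 2))
    rintro u ⟨hu, hx⟩
    simp only [Set.mem_ofPred_eq]; omega

def Xs (lo hi : V → ℕ) (s e : ℕ) : Set V := {u | s ≤ lo u ∧ hi u < e}
def As (lo hi : V → ℕ) (i : ℕ) : Set V := {u | lo u < i ∧ i ≤ hi u}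
def Ps (lo hi : V → ℕ) (s e : ℕ) : Set V := {u | lo u < s ∧ e ≤ hi u}
def Ks (G : SimpleGraph V) (lo hi : V → ℕ) (s e : ℕ) : SimpleGraph V :=
  res G {u | lo u < e ∧ s ≤ hi u ∧ u ∉ Ps lo hi s e}

def Thru (G : SimpleGraph V) (lo hi : V → ℕ) (s e : ℕ) (x : V) : Prop :=
  ∃ a b, a ∈ As lo hi s ∧ a ∉ Ps lo hi s e ∧ b ∈ As lo hi e ∧ b ∉ Ps lo hi s e ∧
    (Ks G lo hi s e).Reachable x a ∧ (Ks G lo hi s e).Reachable x b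

def Thr (G : SimpleGraph V) (lo hi : V → ℕ) (s e : ℕ) :
    Set (Ks G lo hi s e).ConnectedComponent :=
  {C | ∃ x, Thru G lo hi s e x ∧ (Ks G lo hi s e).connectedComponentMk x = C}

noncomputable def rank (G : SimpleGraph V) (lo hi : V → ℕ) (k s e : ℕ) : ℕ :=
  (Ps lo hi s e).ncard * (k + 1) + (Thr G lo hi s e).ncard

section seg

set_option linter.unusedSectionVars false

variable [Finite V] {G : SimpleGraph V} {lo hi : V → ℕ} {k : ℕ}

theorem Ps_sub {s s' e' e : ℕ} (h1 : s ≤ s') (h3 : e' ≤ e) :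
    Ps lo hi s e ⊆ Ps lo hi s' e' := fun _ hu => ⟨hu.1.trans_le h1, h3.trans hu.2⟩

theorem Ks_le {s s' e' e : ℕ} (h1 : s ≤ s') (h3 : e' ≤ e)
    (hP : Ps lo hi s' e' = Ps lo hi s e) : Ks G lo hi s' e' ≤ Ks G lo hi s e := by
  refine res_mono le_rfl ?_
  rintro u ⟨a, b, c⟩
  exact ⟨a.trans_le h3, h1.trans b, by rw [← hP]; exact c⟩

theorem thru_sub (hint : ∀ u v, G.Adj u v → lo u ≤ hi v)
    {s s' e' e : ℕ} (h1 : s ≤ s') (h2 : s' ≤ e') (h3 : e' ≤ e)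
    (hP : Ps lo hi s' e' = Ps lo hi s e) {x : V} (hx : Thru G lo hi s e x) :
    ∃ y, Thru G lo hi s' e' y ∧ (Ks G lo hi s e).Reachable x y := by
  obtain ⟨a, b, ha, haP, hb, hbP, hxa, hxb⟩ := hx
  have hab : (Ks G lo hi s e).Reachable a b := hxa.symm.trans hxb
  suffices ∃ y, Thru G lo hi s' e' y ∧ (Ks G lo hi s e).Reachable a y by
    obtain ⟨y, hy, hay⟩ := this
    exact ⟨y, hy, hxa.trans hay⟩
  by_contra hcon
  have key := reach_ind (p := fun v => v ∉ Ps lo hi s e ∧ (hi v < s' ∨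
    (lo v < e' ∧ s' ≤ hi v ∧ ∃ a', a' ∈ As lo hi s' ∧ a' ∉ Ps lo hi s' e' ∧
      (Ks G lo hi s' e').Reachable a' v ∧ (Ks G lo hi s e).Reachable a a'))) hab ?_ ?_
  · obtain ⟨_, h | ⟨hb1, hb2, a', ha', ha'P, ha'b, haa'⟩⟩ := key
    · have := hb.2; omega
    · exact hcon ⟨a', ⟨a', b, ha', ha'P, ⟨hb1, h3.trans hb.2⟩, by rw [hP]; exact hbP,
        Reachable.refl _, ha'b⟩, haa'⟩
  · refine ⟨haP, ?_⟩
    rcases lt_or_ge (hi a) s' with h | h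
    · exact Or.inl h
    · refine Or.inr ⟨by have := ha.1; omega, h, a, ⟨by have := ha.1; omega, h⟩,
        by rw [hP]; exact haP, Reachable.refl _, Reachable.refl _⟩
  · rintro v w e1 hav ⟨hvP, hp⟩
    have hw := e1.2.2
    have hwP : w ∉ Ps lo hi s e := hw.2.2
    have i1 := hint _ _ e1.1
    have i2 := hint _ _ e1.1.symm
    have haw := hav.trans e1.reachable
    refine ⟨hwP, ?_⟩
    rcases lt_or_ge (hi w) s' with h | h
    · exact Or.inl h
    rcases hp with hp | ⟨hv1, hv2, a', ha', ha'P, ha'v, haa'⟩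
    · refine Or.inr ⟨by omega, h, w, ⟨by omega, h⟩, by rw [hP]; exact hwP,
        Reachable.refl _, haw⟩
    · rcases lt_or_ge (lo w) e' with h' | h'
      · refine Or.inr ⟨h', h, a', ha', ha'P, ha'v.trans (Adj.reachable
          ⟨e1.1, ⟨hv1, hv2, by rw [hP]; exact hvP⟩, ⟨h', h, by rw [hP]; exact hwP⟩⟩), haa'⟩
      · exfalso
        exact hcon ⟨a', ⟨a', v, ha', ha'P, ⟨hv1, by omega⟩, by rw [hP]; exact hvP,
          Reachable.refl _, ha'v⟩, haa'⟩

theorem thr_image (hint : ∀ u v, G.Adj u v → lo u ≤ hi v)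
    {s s' e' e : ℕ} (h1 : s ≤ s') (h2 : s' ≤ e') (h3 : e' ≤ e)
    (hP : Ps lo hi s' e' = Ps lo hi s e) :
    Thr G lo hi s e ⊆ (ConnectedComponent.map (Hom.ofLE (Ks_le (G := G) h1 h3 hP))) ''
      Thr G lo hi s' e' := by
  rintro C ⟨x, hx, rfl⟩
  obtain ⟨y, hy, hxy⟩ := thru_sub hint h1 h2 h3 hP hx
  refine ⟨_, ⟨y, hy, rfl⟩, ?_⟩
  rw [ConnectedComponent.map_mk]
  exact ConnectedComponent.sound hxy.symm

theorem thr_le (hA : ∀ i, (As lo hi i).ncard ≤ k) (s e : ℕ) : (Thr G lo hi s e).ncard ≤ k := by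
  refine le_trans ?_ (hA s)
  have : Thr G lo hi s e ⊆ (Ks G lo hi s e).connectedComponentMk '' As lo hi s := by
    rintro C ⟨x, ⟨a, b, ha, haP, hb, hbP, hxa, hxb⟩, rfl⟩
    exact ⟨a, ha, ConnectedComponent.sound hxa.symm⟩
  exact (Set.ncard_le_ncard this (Set.toFinite _)).trans (Set.ncard_image_le (Set.toFinite _))

theorem Ps_le (hA : ∀ i, (As lo hi i).ncard ≤ k) {s e : ℕ} (h : s ≤ e) :
    (Ps lo hi s e).ncard ≤ k :=
  (Set.ncard_le_ncard (t := As lo hi s) (fun _ hu => ⟨hu.1, h.trans hu.2⟩)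
    (Set.toFinite _)).trans (hA s)

theorem rank_lt (hA : ∀ i, (As lo hi i).ncard ≤ k) {s e : ℕ} (h : s ≤ e) :
    rank G lo hi k s e < (k + 1) * (k + 1) := by
  have h1 := Ps_le hA h
  have h2 := thr_le (G := G) hA s e
  unfold rank
  nlinarith

theorem rank_mono (hint : ∀ u v, G.Adj u v → lo u ≤ hi v) (hA : ∀ i, (As lo hi i).ncard ≤ k)
    {s s' e' e : ℕ} (h1 : s ≤ s') (h2 : s' ≤ e') (h3 : e' ≤ e) :
    rank G lo hi k s e ≤ rank G lo hi k s' e' ∧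
    (rank G lo hi k s' e' = rank G lo hi k s e → Ps lo hi s' e' = Ps lo hi s e ∧
      (Thr G lo hi s' e').ncard = (Thr G lo hi s e).ncard) := by
  have hsub := Ps_sub (lo := lo) (hi := hi) h1 h3
  have hle := Set.ncard_le_ncard hsub (Set.toFinite _)
  have t1 := thr_le (G := G) hA s e
  have t2 := thr_le (G := G) hA s' e'
  rcases hle.lt_or_eq with hlt | heq
  · have : rank G lo hi k s e < rank G lo hi k s' e' := by
      unfold rank; nlinarith
    exact ⟨this.le, fun h => absurd h this.ne'⟩
  · have hP : Ps lo hi s' e' = Ps lo hi s e :=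
      (Set.eq_of_subset_of_ncard_le hsub heq.ge (Set.toFinite _)).symm
    have := Set.ncard_le_ncard (thr_image (G := G) hint h1 h2 h3 hP) (Set.toFinite _)
    have h4 := this.trans (Set.ncard_image_le (Set.toFinite _))
    unfold rank
    rw [hP]
    exact ⟨by omega, fun h => ⟨rfl, by omega⟩⟩

theorem thru_inj (hint : ∀ u v, G.Adj u v → lo u ≤ hi v) (hA : ∀ i, (As lo hi i).ncard ≤ k)
    {s s' e' e : ℕ} (h1 : s ≤ s') (h2 : s' ≤ e') (h3 : e' ≤ e)
    (hr : rank G lo hi k s' e' = rank G lo hi k s e) {x y : V}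
    (hx : Thru G lo hi s' e' x) (hy : Thru G lo hi s' e' y)
    (hxy : (Ks G lo hi s e).Reachable x y) : (Ks G lo hi s' e').Reachable x y := by
  obtain ⟨hP, ht⟩ := (rank_mono hint hA h1 h2 h3).2 hr
  have h4 := Set.ncard_le_ncard (thr_image (G := G) hint h1 h2 h3 hP) (Set.toFinite _)
  have h5 := Set.ncard_image_le (f := ConnectedComponent.map (Hom.ofLE (Ks_le (G := G) h1 h3 hP)))
    (s := Thr G lo hi s' e') (Set.toFinite _)
  have hinj := Set.injOn_of_ncard_image_eq (le_antisymm h5 (by omega)) (Set.toFinite _)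
  apply ConnectedComponent.exact
  apply hinj ⟨x, hx, rfl⟩ ⟨y, hy, rfl⟩
  rw [ConnectedComponent.map_mk, ConnectedComponent.map_mk]
  exact ConnectedComponent.sound hxy

theorem escape {Y H B : Set V}
    (hB : ∀ v w, G.Adj v w → v ∈ Y → v ∈ H → w ∈ Y → w ∉ H → v ∈ B) {x y : V} (hxY : x ∈ Y)
    (hxH : x ∈ H) (h : (res G Y).Reachable x y) :
    ((res G (Y ∩ H)).Reachable x y) ∨
      ∃ b ∈ B, b ∈ Y ∧ (res G (Y ∩ H)).Reachable x b := by
  by_contra hcon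
  push Not at hcon
  have := reach_ind (p := fun v => v ∈ Y ∧ v ∈ H ∧ (res G (Y ∩ H)).Reachable x v) h
    ⟨hxY, hxH, Reachable.refl _⟩ (by
      rintro v w e - ⟨hv, hv', hp⟩
      by_cases hw : w ∈ H
      · exact ⟨e.2.2, hw, hp.trans (Adj.reachable ⟨e.1, ⟨hv, hv'⟩, ⟨e.2.2, hw⟩⟩)⟩
      · exact absurd hp (hcon.2 v (hB v w e.1 hv hv' e.2.2 hw) hv))
  exact hcon.1 this.2.2

theorem locR_core (hlh : ∀ u, lo u ≤ hi u) (hint : ∀ u v, G.Adj u v → lo u ≤ hi v) (hA : ∀ i, (As lo hi i).ncard ≤ k)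
    {s s' e' e : ℕ} (h1 : s ≤ s') (h2 : s' ≤ e') (h3 : e' ≤ e)
    (hr : rank G lo hi k s' e' = rank G lo hi k s e)
    (hsub : ∀ v, lo v < e' → s' ≤ hi v → v ∉ Ps lo hi s e → v ∈ Xs lo hi s e)
    {x y : V} (hxX : x ∈ Xs lo hi s e) (hyX : y ∈ Xs lo hi s e)
    (hx : x ∈ As lo hi s') (hy : y ∈ As lo hi s')
    (h : (res G {v | v ∈ Xs lo hi s e ∧ s' ≤ hi v}).Reachable x y) :
    (res G {v | v ∈ Xs lo hi s e ∧ s' ≤ hi v ∧ lo v < e'}).Reachable x y := by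
  obtain ⟨hP, ht⟩ := (rank_mono hint hA h1 h2 h3).2 hr
  have nP : ∀ v, v ∈ Xs lo hi s e → v ∉ Ps lo hi s e := by
    intro v hv hv'
    have := hv.1; have := hv'.1; omega
  have hset : {v | v ∈ Xs lo hi s e ∧ s' ≤ hi v} ∩ {v | lo v < e'} =
      {v | v ∈ Xs lo hi s e ∧ s' ≤ hi v ∧ lo v < e'} := by
    ext v; simp only [Set.mem_inter_iff, Set.mem_ofPred_eq]; tauto
  have hle : res G {v | v ∈ Xs lo hi s e ∧ s' ≤ hi v ∧ lo v < e'} ≤ Ks G lo hi s' e' :=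
    res_mono le_rfl (fun v hv => ⟨hv.2.2, hv.2.1, by rw [hP]; exact nP v hv.1⟩)
  have hge : Ks G lo hi s' e' ≤ res G {v | v ∈ Xs lo hi s e ∧ s' ≤ hi v ∧ lo v < e'} :=
    res_mono le_rfl (fun v hv => ⟨hsub v hv.1 hv.2.1 (by rw [← hP]; exact hv.2.2),
      hv.2.1, hv.1⟩)
  have hB : ∀ v w, G.Adj v w → v ∈ {v | v ∈ Xs lo hi s e ∧ s' ≤ hi v} → v ∈ {v | lo v < e'} →
      w ∈ {v | v ∈ Xs lo hi s e ∧ s' ≤ hi v} → w ∉ {v | lo v < e'} → v ∈ As lo hi e' := by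
    intro v w e hv hv' hw hw'
    have := hint _ _ e.symm
    simp only [Set.mem_ofPred_eq] at hv' hw'
    exact ⟨hv', by omega⟩
  have thr : ∀ z, z ∈ Xs lo hi s e → z ∈ As lo hi s' → ∀ b, b ∈ As lo hi e' → b ∈ Xs lo hi s e →
      (res G {v | v ∈ Xs lo hi s e ∧ s' ≤ hi v ∧ lo v < e'}).Reachable z b →
      Thru G lo hi s' e' z := fun z hz hz' b hb hb' hr => ⟨z, b, hz', by rw [hP]; exact nP z hz,
        hb, by rw [hP]; exact nP b hb', Reachable.refl _, hr.mono hle⟩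
  have ex := escape hB (x := x) (y := y) ⟨hxX, hx.2⟩ (hx.1.trans_le h2) h
  have ey := escape hB (x := y) (y := x) ⟨hyX, hy.2⟩ (hy.1.trans_le h2) h.symm
  rw [hset] at ex ey
  rcases ex with ex | ⟨b, hb, hbY, hxb⟩
  · exact ex
  rcases ey with ey | ⟨b', hb', hbY', hyb⟩
  · exact ey.symm
  refine (thru_inj hint hA h1 h2 h3 hr (thr x hxX hx b hb hbY.1 hxb)
    (thr y hyX hy b' hb' hbY'.1 hyb) (h.mono (res_mono le_rfl ?_))).mono hge
  intro v hv
  have := hv.1.2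
  have := hlh v
  exact ⟨by omega, h1.trans hv.2, nP v hv.1⟩

theorem locL_core (hlh : ∀ u, lo u ≤ hi u) (hint : ∀ u v, G.Adj u v → lo u ≤ hi v) (hA : ∀ i, (As lo hi i).ncard ≤ k)
    {s s' e' e : ℕ} (h1 : s ≤ s') (h2 : s' ≤ e') (h3 : e' ≤ e)
    (hr : rank G lo hi k s' e' = rank G lo hi k s e)
    (hsub : ∀ v, lo v < e' → s' ≤ hi v → v ∉ Ps lo hi s e → v ∈ Xs lo hi s e)
    {x y : V} (hxX : x ∈ Xs lo hi s e) (hyX : y ∈ Xs lo hi s e)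
    (hx : x ∈ As lo hi e') (hy : y ∈ As lo hi e')
    (h : (res G {v | v ∈ Xs lo hi s e ∧ lo v < e'}).Reachable x y) :
    (res G {v | v ∈ Xs lo hi s e ∧ s' ≤ hi v ∧ lo v < e'}).Reachable x y := by
  obtain ⟨hP, ht⟩ := (rank_mono hint hA h1 h2 h3).2 hr
  have nP : ∀ v, v ∈ Xs lo hi s e → v ∉ Ps lo hi s e := by
    intro v hv hv'
    have := hv.1; have := hv'.1; omega
  have hset : {v | v ∈ Xs lo hi s e ∧ lo v < e'} ∩ {v | s' ≤ hi v} =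
      {v | v ∈ Xs lo hi s e ∧ s' ≤ hi v ∧ lo v < e'} := by
    ext v; simp only [Set.mem_inter_iff, Set.mem_ofPred_eq]; tauto
  have hle : res G {v | v ∈ Xs lo hi s e ∧ s' ≤ hi v ∧ lo v < e'} ≤ Ks G lo hi s' e' :=
    res_mono le_rfl (fun v hv => ⟨hv.2.2, hv.2.1, by rw [hP]; exact nP v hv.1⟩)
  have hge : Ks G lo hi s' e' ≤ res G {v | v ∈ Xs lo hi s e ∧ s' ≤ hi v ∧ lo v < e'} :=
    res_mono le_rfl (fun v hv => ⟨hsub v hv.1 hv.2.1 (by rw [← hP]; exact hv.2.2),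
      hv.2.1, hv.1⟩)
  have hB : ∀ v w, G.Adj v w → v ∈ {v | v ∈ Xs lo hi s e ∧ lo v < e'} → v ∈ {v | s' ≤ hi v} →
      w ∈ {v | v ∈ Xs lo hi s e ∧ lo v < e'} → w ∉ {v | s' ≤ hi v} → v ∈ As lo hi s' := by
    intro v w e hv hv' hw hw'
    have := hint _ _ e
    simp only [Set.mem_ofPred_eq] at hv' hw'
    exact ⟨by omega, hv'⟩
  have thr : ∀ z, z ∈ Xs lo hi s e → z ∈ As lo hi e' → ∀ b, b ∈ As lo hi s' → b ∈ Xs lo hi s e →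
      (res G {v | v ∈ Xs lo hi s e ∧ s' ≤ hi v ∧ lo v < e'}).Reachable z b →
      Thru G lo hi s' e' z := fun z hz hz' b hb hb' hr => ⟨b, z, hb, by rw [hP]; exact nP b hb',
        hz', by rw [hP]; exact nP z hz, hr.mono hle, Reachable.refl _⟩
  have ex := escape hB (x := x) (y := y) ⟨hxX, hx.1⟩ (h2.trans hx.2) h
  have ey := escape hB (x := y) (y := x) ⟨hyX, hy.1⟩ (h2.trans hy.2) h.symm
  rw [hset] at ex ey
  rcases ex with ex | ⟨b, hb, hbY, hxb⟩
  · exact ex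
  rcases ey with ey | ⟨b', hb', hbY', hyb⟩
  · exact ey.symm
  refine (thru_inj hint hA h1 h2 h3 hr (thr x hxX hx b hb hbY.1 hxb)
    (thr y hyX hy b' hb' hbY'.1 hyb) (h.mono (res_mono le_rfl ?_))).mono hge
  intro v hv
  have := hv.1.1
  have := hlh v
  exact ⟨hv.2.trans_le h3, by omega, nP v hv.1⟩

theorem exists_seq (r : ℕ → ℕ → ℕ) (μ : ℕ) (e : ℕ) : ∀ (d s : ℕ), s + d = e →
    ∃ (n : ℕ) (c : ℕ → ℕ), Monotone c ∧ c 0 = s ∧ c n ≤ e ∧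
      (∀ l < n, c l < c (l + 1) ∧ r (c l) (c (l + 1)) = μ ∧
        ∀ y, c l < y → y < c (l + 1) → r (c l) y ≠ μ) ∧
      (∀ y, c n < y → y ≤ e → r (c n) y ≠ μ) := by
  intro d
  induction d using Nat.strong_induction_on with
  | _ d ih =>
    intro s hs
    by_cases hex : ∃ y, s < y ∧ y ≤ e ∧ r s y = μ
    · classical
      have hy := Nat.find_spec hex
      have hmin := fun m (hm : m < Nat.find hex) => Nat.find_min hex hm
      obtain ⟨n, c, hc1, hc2, hc3, hc4, hc5⟩ := ih (e - Nat.find hex) (by omega) (Nat.find hex)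
        (by omega)
      refine ⟨n + 1, fun l => Nat.casesOn l s c, ?_, rfl, hc3, ?_, hc5⟩
      · apply monotone_nat_of_le_succ
        intro l
        cases l with
        | zero => show s ≤ c 0; omega
        | succ l => exact hc1 (Nat.le_succ l)
      · intro l hl
        cases l with
        | zero =>
          show s < c 0 ∧ r s (c 0) = μ ∧ ∀ y, s < y → y < c 0 → r s y ≠ μ
          rw [hc2]
          exact ⟨hy.1, hy.2.2, fun y h1 h2 h3 => hmin y h2 ⟨h1, by omega, h3⟩⟩
        | succ l => exact hc4 l (by omega)
    · push Not at hex
      exact ⟨0, fun _ => s, fun _ _ _ => le_rfl, rfl, (by show s ≤ e; omega), by intro l hl; omega, hex⟩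

theorem seq_good (hlh : ∀ u, lo u ≤ hi u) (hint : ∀ u v, G.Adj u v → lo u ≤ hi v)
    (hA : ∀ i, (As lo hi i).ncard ≤ k) (n : ℕ) (c : ℕ → ℕ) (hc : Monotone c) (d : ℕ) (hd : 1 ≤ d)
    (hr : ∀ l < n, rank G lo hi k (c l) (c (l + 1)) = rank G lo hi k (c 0) (c n))
    (hg : ∀ l < n, Good (res G (Xs lo hi (c l) (c (l + 1)))) d) :
    Good (res G (Xs lo hi (c 0) (c n))) (d + 9 * k) := by
  classical
  have hP : ∀ l < n, Ps lo hi (c l) (c (l + 1)) = Ps lo hi (c 0) (c n) := fun l hl =>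
    ((rank_mono hint hA (hc (Nat.zero_le l)) (hc (Nat.le_succ l)) (hc hl)).2 (hr l hl)).1
  have hb : ∀ i, ∃ l, c 0 ≤ i → i < c n → c l ≤ i ∧ i < c (l + 1) := by
    intro i
    by_cases h : c 0 ≤ i ∧ i < c n
    · have hex : ∃ m, i < c m := ⟨n, h.2⟩
      have h1 := Nat.find_spec hex
      have h0 : Nat.find hex ≠ 0 := by
        intro h0; rw [h0] at h1; omega
      obtain ⟨l, hl⟩ := Nat.exists_eq_succ_of_ne_zero h0
      have h2 := Nat.find_min hex (m := l) (by omega)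
      rw [hl] at h1
      exact ⟨l, fun _ _ => ⟨by omega, h1⟩⟩
    · exact ⟨0, fun a b => absurd ⟨a, b⟩ h⟩
  choose b hb using hb
  have lt_of : ∀ {i j : ℕ}, c i < c j → i < j := fun h => hc.reflect_lt h
  set X := Xs lo hi (c 0) (c n) with hX
  -- block indices
  have blk : ∀ v ∈ X, (∀ l, l ≤ b (hi v) ↔ c l ≤ hi v) ∧ (∀ l, b (lo v) ≤ l ↔ lo v < c (l + 1)) ∧
      b (lo v) ≤ b (hi v) ∧ b (hi v) ≤ b (lo v) + 1 ∧ b (hi v) < n := by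
    intro v hv
    have hv1 := hv.1
    have hv2 := hv.2
    have hv3 := hlh v
    have hl := hb (lo v) hv1 (by omega)
    have hh := hb (hi v) (by omega) hv2
    have e1 : ∀ l, l ≤ b (hi v) ↔ c l ≤ hi v := by
      intro l
      constructor
      · intro h; exact (hc h).trans hh.1
      · intro h; have := lt_of (h.trans_lt hh.2); omega
    have e2 : ∀ l, b (lo v) ≤ l ↔ lo v < c (l + 1) := by
      intro l
      constructor
      · intro h; exact hl.2.trans_le (hc (Nat.succ_le_succ h))
      · intro h; have := lt_of (hl.1.trans_lt h); omega
    have e5 : b (hi v) < n := by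
      by_contra h
      have := hc (not_lt.1 h)
      omega
    refine ⟨e1, e2, (e1 _).2 (by omega), ?_, e5⟩
    by_contra hcon
    have hlt : b (lo v) + 1 < n := by omega
    have hmem : v ∈ Ps lo hi (c (b (lo v) + 1)) (c (b (lo v) + 1 + 1)) :=
      ⟨hl.2, (e1 _).1 (by omega)⟩
    rw [hP _ hlt] at hmem
    have := hmem.1
    omega
  have hsub : ∀ l, 1 ≤ l → l + 1 < n → ∀ v, lo v < c (l + 1) → c l ≤ hi v →
      v ∉ Ps lo hi (c 0) (c n) → v ∈ X := by
    intro l hl hln v h1 h2 hvP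
    constructor
    · by_contra hcon
      apply hvP
      rw [← hP 0 (by omega)]
      exact ⟨by omega, (hc (by omega : 0 + 1 ≤ l)).trans h2⟩
    · by_contra hcon
      apply hvP
      rw [← hP (n - 1) (by omega)]
      have h3 : n - 1 + 1 = n := by omega
      exact ⟨h1.trans_le (hc (by omega)), by rw [h3]; omega⟩
  let pos : V → ℕ := fun v => if v ∈ X then b (lo v) + b (hi v) + 1 else 1
  have posX : ∀ v ∈ X, pos v = b (lo v) + b (hi v) + 1 := fun v hv => if_pos hv
  have posN : ∀ v, v ∉ X → pos v = 1 := fun v hv => if_neg hv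
  have evenX : ∀ v l, pos v = 2 * l → v ∈ X := by
    intro v l h
    by_contra hv
    rw [posN v hv] at h; omega
  have evenA : ∀ v l, pos v = 2 * l → v ∈ As lo hi (c l) ∧ 1 ≤ l ∧ l < n := by
    intro v l h
    have hv := evenX v l h
    obtain ⟨e1, e2, e3, e4, e5⟩ := blk v hv
    rw [posX v hv] at h
    have hl : l = b (lo v) + 1 := by omega
    refine ⟨⟨?_, (e1 l).1 (by omega)⟩, by omega, by omega⟩
    rw [hl]; exact (e2 _).1 le_rfl
  refine layered pos ?_ ?_ ?_ ?_ ?_ ?_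
  · intro v
    by_cases hv : v ∈ X
    · rw [posX v hv]; omega
    · rw [posN v hv]
  · rintro u v ⟨e, hu, hv⟩
    have i1 := hint _ _ e
    have i2 := hint _ _ e.symm
    obtain ⟨e1, e2, e3, e4, e5⟩ := blk u hu
    obtain ⟨f1, f2, f3, f4, f5⟩ := blk v hv
    have g1 : b (lo u) ≤ b (hi v) := by
      rw [f1]; exact le_trans (hb (lo u) hu.1 (by have := hlh u; have := hu.2; omega)).1 i1
    have g2 : b (lo v) ≤ b (hi u) := by
      rw [e1]; exact le_trans (hb (lo v) hv.1 (by have := hlh v; have := hv.2; omega)).1 i2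
    rw [posX u hu, posX v hv]
    exact ⟨max (b (lo u)) (b (lo v)), by omega, by omega, by omega, by omega⟩
  · intro l
    exact (Set.ncard_le_ncard (fun v hv => (evenA v l hv).1) (Set.toFinite _)).trans (hA (c l))
  · intro l x y hx hy h
    have hxX := evenX x l hx
    have hyX := evenX y l hy
    obtain ⟨hxA, hl1, hln⟩ := evenA x l hx
    have hyA := (evenA y l hy).1
    rw [res_res] at h ⊢
    rcases Nat.lt_or_ge (l + 1) n with hlast | hlast
    · have := locR_core hlh hint hA (hc (Nat.zero_le l)) (hc (Nat.le_succ l)) (hc hln) (hr l hln)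
        (hsub l hl1 hlast) hxX hyX hxA hyA (h.mono (res_mono le_rfl (by
          rintro v ⟨hv, hv'⟩
          obtain ⟨e1, e2, e3, e4, e5⟩ := blk v hv
          simp only [Set.mem_ofPred_eq] at hv'
          rw [posX v hv] at hv'
          exact ⟨hv, (e1 l).1 (by omega)⟩)))
      refine this.mono (res_mono le_rfl ?_)
      rintro v ⟨hv, hv1, hv2⟩
      obtain ⟨e1, e2, e3, e4, e5⟩ := blk v hv
      rw [← e1] at hv1
      rw [← e2] at hv2
      refine ⟨hv, ?_⟩
      simp only [Set.mem_ofPred_eq]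
      rw [posX v hv]
      omega
    · refine h.mono (res_mono le_rfl ?_)
      rintro v ⟨hv, hv'⟩
      obtain ⟨e1, e2, e3, e4, e5⟩ := blk v hv
      refine ⟨hv, ?_⟩
      simp only [Set.mem_ofPred_eq] at hv' ⊢
      rw [posX v hv] at hv' ⊢
      omega
  · intro l x y hx hy h
    have hxX := evenX x l hx
    have hyX := evenX y l hy
    obtain ⟨hxA, hl1, hln⟩ := evenA x l hx
    have hyA := (evenA y l hy).1
    rw [res_res] at h ⊢
    obtain ⟨m, rfl⟩ : ∃ m, l = m + 1 := ⟨l - 1, by omega⟩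
    rcases Nat.eq_zero_or_pos m with hm | hm
    · refine h.mono (res_mono le_rfl ?_)
      rintro v ⟨hv, hv'⟩
      refine ⟨hv, ?_⟩
      simp only [Set.mem_ofPred_eq] at hv' ⊢
      omega
    · have := locL_core hlh hint hA (hc (Nat.zero_le m)) (hc (Nat.le_succ m)) (hc (by omega))
        (hr m (by omega)) (hsub m hm hln) hxX hyX hxA hyA (h.mono (res_mono le_rfl (by
          rintro v ⟨hv, hv'⟩
          obtain ⟨e1, e2, e3, e4, e5⟩ := blk v hv
          simp only [Set.mem_ofPred_eq] at hv'
          rw [posX v hv] at hv'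
          exact ⟨hv, (e2 m).1 (by omega)⟩)))
      refine this.mono (res_mono le_rfl ?_)
      rintro v ⟨hv, hv1, hv2⟩
      obtain ⟨e1, e2, e3, e4, e5⟩ := blk v hv
      rw [← e1] at hv1
      rw [← e2] at hv2
      refine ⟨hv, ?_⟩
      simp only [Set.mem_ofPred_eq]
      rw [posX v hv]
      omega
  · refine good_union pos ?_ ?_
    · rintro u v ⟨⟨e, hu, hv⟩, hu', hv'⟩
      have i1 := hint _ _ e
      have i2 := hint _ _ e.symm
      obtain ⟨e1, e2, e3, e4, e5⟩ := blk u hu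
      obtain ⟨f1, f2, f3, f4, f5⟩ := blk v hv
      have g1 : b (lo u) ≤ b (hi v) := by
        rw [f1]; exact le_trans (hb (lo u) hu.1 (by have := hlh u; have := hu.2; omega)).1 i1
      have g2 : b (lo v) ≤ b (hi u) := by
        rw [e1]; exact le_trans (hb (lo v) hv.1 (by have := hlh v; have := hv.2; omega)).1 i2
      simp only [Set.mem_compl_iff, Set.mem_ofPred_eq] at hu' hv'
      rw [posX u hu] at hu' ⊢
      rw [posX v hv] at hv' ⊢
      omega
    · intro p
      rw [res_res, res_res]
      by_cases hp : ∃ l < n, p = 2 * l + 1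
      · obtain ⟨l, hl, rfl⟩ := hp
        convert hg l hl using 2
        ext v
        constructor
        · rintro ⟨hv, -, hv'⟩
          obtain ⟨e1, e2, e3, e4, e5⟩ := blk v hv
          simp only [Set.mem_ofPred_eq] at hv'
          rw [posX v hv] at hv'
          refine ⟨(e1 l).1 (by omega) |> fun _ => ?_, ?_⟩
          · have h0 := hb (lo v) hv.1 (by have := hlh v; have := hv.2; omega)
            have : b (lo v) = l := by omega
            rw [this] at h0; exact h0.1
          · by_contra hcon
            have := (e1 (l + 1)).2 (by omega)
            omega
        · rintro ⟨hv1, hv2⟩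
          have hv : v ∈ X := ⟨(hc (Nat.zero_le l)).trans hv1, hv2.trans_le (hc hl)⟩
          obtain ⟨e1, e2, e3, e4, e5⟩ := blk v hv
          have hv3 := hlh v
          have h0 := (e1 l).2 (by omega)
          have h1 := (e2 l).2 (by omega)
          have h2 : ¬ (l + 1 ≤ b (hi v)) := by rw [e1]; omega
          have h3 : l ≤ b (lo v) := by
            by_contra hcon
            have hlo := hb (lo v) hv.1 (by have := hv.2; omega)
            have := hc (show b (lo v) + 1 ≤ l by omega)
            omega
          refine ⟨hv, ?_, ?_⟩
          · simp only [Set.mem_compl_iff, Set.mem_ofPred_eq]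
            rw [posX v hv]; omega
          · simp only [Set.mem_ofPred_eq]
            rw [posX v hv]; omega
      · refine (good_of_empty ?_).mono hd
        ext v
        simp only [Set.mem_empty_iff_false, iff_false]
        rintro ⟨hv, hv2, hv'⟩
        obtain ⟨e1, e2, e3, e4, e5⟩ := blk v hv
        simp only [Set.mem_compl_iff, Set.mem_ofPred_eq] at hv2 hv'
        rw [posX v hv] at hv2 hv'
        exact hp ⟨b (lo v), by omega, by omega⟩

theorem main_ind (hlh : ∀ u, lo u ≤ hi u) (hint : ∀ u v, G.Adj u v → lo u ≤ hi v)
    (hbag : ∀ i, {u | lo u ≤ i ∧ i ≤ hi u}.ncard ≤ k) : ∀ (j s e : ℕ), s ≤ e →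
    (k + 1) * (k + 1) ≤ rank G lo hi k s e + j →
    Good (res G (Xs lo hi s e)) (1 + 11 * k * j) := by
  have hA : ∀ i, (As lo hi i).ncard ≤ k := fun i =>
    (Set.ncard_le_ncard (t := {u | lo u ≤ i ∧ i ≤ hi u}) (fun u hu => ⟨hu.1.le, hu.2⟩)
      (Set.toFinite _)).trans (hbag i)
  have hemp : ∀ s, Xs lo hi s s = ∅ := by
    intro s; ext v
    simp only [Set.mem_empty_iff_false, iff_false]
    rintro ⟨h1, h2⟩
    have := hlh v
    omega
  intro j
  induction j with
  | zero =>
    intro s e hse h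
    have := rank_lt (G := G) hA hse
    omega
  | succ j ih =>
    intro s e hse h
    obtain ⟨n, c, hc, hc0, hcn, hstep, hlast⟩ :=
      exists_seq (rank G lo hi k) (rank G lo hi k s e) e (e - s) s (by omega)
    have hs_le : ∀ l, s ≤ c l := fun l => hc0 ▸ hc (Nat.zero_le l)
    -- pieces of larger rank
    have piece : ∀ a b, s ≤ a → a ≤ b → b ≤ e → (a < b → rank G lo hi k a b ≠ rank G lo hi k s e) →
        Good (res G (Xs lo hi a b)) (1 + 11 * k * j) := by
      intro a b h1 h2 h3 h4
      rcases h2.lt_or_eq with hlt | rfl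
      · refine ih a b h2 ?_
        have := (rank_mono (G := G) hint hA h1 h2 h3).1
        have := h4 hlt
        omega
      · exact (good_of_empty (hemp a)).mono (by omega)
    have hblocks : ∀ l < n, Good (res G (Xs lo hi (c l) (c (l + 1)))) (1 + 11 * k * j + k) := by
      intro l hl
      obtain ⟨s1, s2, s3⟩ := hstep l hl
      have hcl : c (l + 1) ≤ e := (hc hl).trans hcn
      have := piece (c l) (c (l + 1) - 1) (hs_le l) (by omega) (by omega)
        (fun hlt => s3 _ hlt (by omega))
      refine good_bin (M := {u | lo u ≤ c (l + 1) - 1 ∧ c (l + 1) - 1 ≤ hi u}) ?_ (hbag _)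
      rw [res_res]
      convert this using 2
      ext v
      have hv := hlh v
      simp only [Xs, Set.mem_inter_iff, Set.mem_compl_iff, Set.mem_ofPred_eq]
      omega
    have hseq : Good (res G (Xs lo hi (c 0) (c n))) (1 + 11 * k * j + k + 9 * k) := by
      refine seq_good hlh hint hA n c hc _ (by omega) ?_ hblocks
      intro l hl
      have h1 := (hstep l hl).2.1
      have h2 : rank G lo hi k (c 0) (c n) ≤ rank G lo hi k (c l) (c (l + 1)) :=
        (rank_mono (G := G) hint hA (hc (Nat.zero_le l)) (hc (Nat.le_succ l)) (hc hl)).1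
      have h3 : rank G lo hi k s e ≤ rank G lo hi k (c 0) (c n) :=
        (rank_mono (G := G) hint hA (hs_le 0) (hc (Nat.zero_le n)) hcn).1
      omega
    rw [hc0] at hseq
    have hrem := piece (c n) e (hs_le n) hcn le_rfl (fun hlt => hlast e hlt le_rfl)
    have heq : 1 + 11 * k * (j + 1) = 1 + 11 * k * j + k + 9 * k + k := by ring
    rw [heq]
    refine good_bin (M := As lo hi (c n)) ?_ (hA _)
    rw [res_res]
    refine good_union (fun v => if lo v < c n then 0 else 1) ?_ ?_
    · rintro u v ⟨e1, ⟨hu, hu'⟩, ⟨hv, hv'⟩⟩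
      have i1 := hint _ _ e1
      have i2 := hint _ _ e1.symm
      simp only [As, Set.mem_compl_iff, Set.mem_ofPred_eq] at hu' hv'
      have := hlh u
      have := hlh v
      show (if lo u < c n then 0 else 1) = (if lo v < c n then 0 else 1)
      split_ifs <;> omega
    · intro p
      rw [res_res]
      have hsn := hs_le n
      by_cases hp0 : p = 0
      · convert hseq using 2
        ext v
        have hv := hlh v
        simp only [As, Xs, Set.mem_inter_iff, Set.mem_compl_iff, Set.mem_ofPred_eq]
        split_ifs <;> omega
      · by_cases hp1 : p = 1
        · have h2 : Good (res G (Xs lo hi (c n) e)) (1 + 11 * k * j + k + 9 * k) :=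
            hrem.mono (by omega)
          convert h2 using 2
          ext v
          have hv := hlh v
          simp only [As, Xs, Set.mem_inter_iff, Set.mem_compl_iff, Set.mem_ofPred_eq]
          split_ifs <;> omega
        · refine (good_of_empty ?_).mono (by omega)
          ext v
          simp only [Set.mem_inter_iff, Set.mem_ofPred_eq, Set.mem_empty_iff_false, iff_false]
          rintro ⟨_, h⟩
          split_ifs at h <;> omega

end seg

theorem induce_conn {F : SimpleGraph V} {S : Set V} {u : V} (hu : u ∈ S)
    (h : ∀ x ∈ S, (res F S).Reachable u x) : (F.induce S).Connected := by
  have key : ∀ x (hx : x ∈ S), (F.induce S).Reachable ⟨u, hu⟩ ⟨x, hx⟩ := by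
    intro x hx
    have := reach_ind (p := fun y => ∃ hy : y ∈ S, (F.induce S).Reachable ⟨u, hu⟩ ⟨y, hy⟩)
      (h x hx) ⟨hu, Reachable.refl _⟩ (by
        rintro v w ⟨e, hv, hw⟩ _ ⟨hv', hp⟩
        exact ⟨hw, hp.trans (Adj.reachable (show (F.induce S).Adj ⟨v, hv'⟩ ⟨w, hw⟩ from e))⟩)
    exact this.2
  haveI : Nonempty S := ⟨⟨u, hu⟩⟩
  refine ⟨fun x y => ?_⟩
  exact (key x.1 x.2).symm.trans (key y.1 y.2)

theorem exists_lohi [Finite V] {G : SimpleGraph V} {k : ℕ} (h : PathwidthLt G k) :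
    ∃ lo hi : V → ℕ, (∀ u, lo u ≤ hi u) ∧ (∀ u v, G.Adj u v → lo u ≤ hi v) ∧
      (∀ i, {u | lo u ≤ i ∧ i ≤ hi u}.ncard ≤ k) ∧ ∃ m, ∀ u, hi u < m := by
  obtain ⟨m, W, ⟨h1, h2, h3⟩, h4⟩ := h
  have hlo : ∀ u, ∃ i, u ∈ W i ∧ ∀ j, u ∈ W j → i ≤ j := by
    intro u
    obtain ⟨i, hi, hm⟩ := Set.exists_min_image {i | u ∈ W i} id (Set.toFinite _) (h1 u)
    exact ⟨i, hi, hm⟩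
  have hhi : ∀ u, ∃ i, u ∈ W i ∧ ∀ j, u ∈ W j → j ≤ i := by
    intro u
    obtain ⟨i, hi, hm⟩ := Set.exists_max_image {i | u ∈ W i} id (Set.toFinite _) (h1 u)
    exact ⟨i, hi, hm⟩
  choose lo l1 l2 using hlo
  choose hi r1 r2 using hhi
  refine ⟨fun u => lo u, fun u => hi u, fun u => l2 u _ (r1 u), ?_, ?_, m, fun u => (hi u).2⟩
  · intro u v e
    obtain ⟨i, hu, hv⟩ := h3 u v e
    exact (l2 u i hu).trans (r2 v i hv)
  · intro i
    by_cases him : i < m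
    · refine (Set.ncard_le_ncard ?_ (Set.toFinite _)).trans (h4 ⟨i, him⟩)
      rintro u ⟨a, b⟩
      exact h2 u _ _ _ (Fin.le_def.2 a) (Fin.le_def.2 b) (l1 u) (r1 u)
    · have : {u | (lo u : ℕ) ≤ i ∧ i ≤ (hi u : ℕ)} = ∅ := by
        ext u
        simp only [Set.mem_ofPred_eq, Set.mem_empty_iff_false, iff_false]
        have := (hi u).2
        omega
      rw [this]; simp

theorem bound (k : ℕ) (hk : 0 < k) :
    1 + 11 * k * ((k + 1) * (k + 1)) ≤ 9 * k * 2 ^ (3 * k + 4 * k ^ 2) := by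
  have h1 : k + 1 ≤ 2 ^ k := Nat.lt_two_pow_self
  have h2 : (k + 1) * (k + 1) ≤ 2 ^ (2 * k) := by
    rw [two_mul, pow_add]; exact Nat.mul_le_mul h1 h1
  have h3 : 2 ^ (2 * k) * 2 ≤ 2 ^ (3 * k + 4 * k ^ 2) := by
    rw [← pow_succ]; exact Nat.pow_le_pow_right (by norm_num) (by nlinarith)
  nlinarith

end PWProof

/-- Every connected finite graph `G` of pathwidth less than `k` has a tree
decomposition of width at most `9k·2^(3k+4k²) − 1` indexed by a spanning tree
`T` of `G`, in which moreover every vertex belongs to its own bag. -/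
theorem mainTheoremExplicit (k : ℕ) (hk : 0 < k) (V : Type) [Fintype V] (G : SimpleGraph V)
    (hconn : G.Connected) (hpw : PathwidthLt G k) :
    ∃ (T : SimpleGraph V) (W : V → Set V),
      T ≤ G ∧ T.IsTree ∧ IsTreeDecompOn G T W ∧
      (∀ x : V, (W x).ncard ≤ (9 * k * 2 ^ (3 * k + 4 * k ^ 2) - 1) + 1) ∧
      (∀ x : V, x ∈ W x) := by
  obtain ⟨lo, hi, hlh, hint, hbag, m, hm⟩ := PWProof.exists_lohi hpw
  have h := PWProof.main_ind hlh hint hbag ((k + 1) * (k + 1)) 0 m (Nat.zero_le _) (by omega)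
  have hX : PWProof.res G (PWProof.Xs lo hi 0 m) = G := by
    ext u v
    rw [PWProof.res_adj]
    exact ⟨fun h => h.1, fun h => ⟨h, ⟨Nat.zero_le _, hm u⟩, ⟨Nat.zero_le _, hm v⟩⟩⟩
  rw [hX] at h
  obtain ⟨F, W, h1, h2, h3, h4, h5, h6, h7⟩ := h
  haveI := hconn.nonempty
  refine ⟨F, W, h1, ⟨⟨fun u v => h3 u v (hconn.preconnected u v)⟩, h2⟩,
    ⟨fun u => PWProof.induce_conn (h4 u) (fun x hx => h5 u x hx), h6⟩, fun x => ?_, h4⟩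
  have := PWProof.bound k hk
  have := h7 x
  omega
end

section
/- Let G be a connected finite graph and let (F, (W_x)_{x ∈ V(F)}) be a suitable forest decomposition of G. Then the forest F is connected (hence F is a spanning tree of G). -/
open SimpleGraph

/-- `(F, W)` is a suitable forest decomposition of `G`: `F` is a forest that is
a subgraph of `G` on the same vertex set, for every vertex `u` of `G` the set of
nodes whose bag contains `u` induces a nonempty connected subgraph of `F`, every
edge of `G` is contained in some bag, and every vertex belongs to its own bag. -/
def IsSuitableForestDecomp {V : Type*} (G F : SimpleGraph V) (W : V → Set V) : Prop :=
  F.IsAcyclic ∧ F ≤ G ∧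
  (∀ u : V, (F.induce {x | u ∈ W x}).Connected) ∧
  (∀ u v : V, G.Adj u v → ∃ x, u ∈ W x ∧ v ∈ W x) ∧
  (∀ u : V, u ∈ W u)

/-- The complexity `cmp G` of a graph `G`: the minimum width (maximum bag size
minus one) of a suitable forest decomposition of `G`. -/
noncomputable def complexity {V : Type*} (G : SimpleGraph V) : ℕ :=
  sInf {w | ∃ (F : SimpleGraph V) (W : V → Set V),
    IsSuitableForestDecomp G F W ∧ ∀ x, (W x).ncard ≤ w + 1}

/-- If `G` is a connected finite graph and `(F, W)` is a suitable forest
decomposition of `G`, then `F` is connected (hence a spanning tree of `G`). -/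
theorem suitableForest_connected {V : Type*} [Fintype V] (G F : SimpleGraph V)
    (W : V → Set V) (hG : G.Connected) (h : IsSuitableForestDecomp G F W) :
    F.Connected := by
  obtain ⟨_, _, hc, he, hs⟩ := h
  have key : ∀ u x : V, u ∈ W x → F.Reachable u x := fun u x hx =>
    ((hc u).preconnected ⟨u, hs u⟩ ⟨x, hx⟩).map (Embedding.induce {x | u ∈ W x}).toHom
  have := hG.nonempty
  refine ⟨fun a b => ?_⟩
  obtain ⟨p⟩ := hG.preconnected a b
  induction p with
  | nil => exact Reachable.refl _
  | cons hadj _ ih =>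
    obtain ⟨x, hu, hv⟩ := he _ _ hadj
    exact ((key _ x hu).trans (key _ x hv).symm).trans ih
end

section
/- Let G be a finite graph and let {A, B} be a near partition of V(G), i.e., A and B are disjoint (possibly empty) subsets of V(G) with A ∪ B = V(G). Then cmp(G) ≤ max{cmp(G[A]), cmp(G[B])} + |N_G(B)|, where N_G(B) is the set of vertices outside B having a neighbor in B. -/
open SimpleGraph

lemma aux_complexity_spec {V : Type*} [Finite V] (G : SimpleGraph V) :
    ∃ (F : SimpleGraph V) (W : V → Set V),
      IsSuitableForestDecomp G F W ∧ ∀ x, (W x).ncard ≤ complexity G + 1 := by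
  have hne : {w | ∃ (F : SimpleGraph V) (W : V → Set V),
    IsSuitableForestDecomp G F W ∧ ∀ x, (W x).ncard ≤ w + 1}.Nonempty := by
    obtain ⟨F, hle, hF, hr⟩ := G.exists_isAcyclic_reachable_eq_le
    refine ⟨Nat.card V, F, fun x => {u | F.Reachable u x}, ⟨hF, hle, ?_, ?_, ?_⟩, ?_⟩
    · intro u
      have h := (F.connectedComponentMk u).connected_toSimpleGraph
      have : {x | u ∈ {u | F.Reachable u x}} = (F.connectedComponentMk u).supp := by
        ext x; simp [SimpleGraph.reachable_comm]
      rw [this]; exact h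
    · intro u v h
      refine ⟨u, SimpleGraph.Reachable.refl _, ?_⟩
      change F.Reachable v u
      rw [hr]; exact h.symm.reachable
    · intro u; exact SimpleGraph.Reachable.refl _
    · intro x; exact (Set.ncard_le_card _).trans (Nat.le_succ _)
  exact Nat.sInf_mem hne

lemma aux_no_cycle {V : Type*} (H : SimpleGraph V) (A : Set V)
    (hA : ∀ u v, H.Adj u v → u ∈ A → v ∈ A) (hac : (H.induce A).IsAcyclic)
    (u : V) (hu : u ∈ A) (p : H.Walk u u) : ¬ p.IsCycle := by
  have key : ∀ (u v : V) (p : H.Walk u v), u ∈ A → ∀ x ∈ p.support, x ∈ A := by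
    intro u v p
    induction p with
    | nil => intro hu x hx; simp at hx; exact hx ▸ hu
    | cons h p ih =>
      intro hu x hx
      rw [SimpleGraph.Walk.support_cons, List.mem_cons] at hx
      rcases hx with rfl | hx
      · exact hu
      · exact ih (hA _ _ h hu) x hx
  intro hp
  have hm := SimpleGraph.Walk.map_induce p (key u u p hu)
  apply hac (p.induce A (key u u p hu))
  rw [← SimpleGraph.Walk.isCycle_map_iff_of_injective
    (f := (SimpleGraph.Embedding.induce (G := H) A).toHom) Subtype.val_injective, hm]
  exact hp

lemma aux_conn {V : Type*} (F : SimpleGraph V) (A : Set V) (FA : SimpleGraph A)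
    (hle : ∀ a b : A, FA.Adj a b → F.Adj a b) (S : Set A) (T : Set V)
    (hT : T = Subtype.val '' S) (hS : (FA.induce S).Connected) : (F.induce T).Connected := by
  subst hT
  let f : FA.induce S →g F.induce (Subtype.val '' S) :=
    ⟨fun x => ⟨x.1.1, x.1, x.2, rfl⟩, fun {a b} h => hle _ _ h⟩
  refine hS.map f ?_
  rintro ⟨_, x, hx, rfl⟩
  exact ⟨⟨x, hx⟩, rfl⟩

/-- If `{A, B}` is a near partition of the vertex set of a finite graph `G`,
then `cmp(G) ≤ max (cmp G[A]) (cmp G[B]) + |N_G(B)|`, where `N_G(B)` is the set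
of vertices outside `B` having a neighbor in `B`. -/
theorem complexity_nearPartition {V : Type*} [Fintype V] (G : SimpleGraph V)
    (A B : Set V) (hdisj : Disjoint A B) (hunion : A ∪ B = Set.univ) :
    complexity G ≤
      max (complexity (G.induce A)) (complexity (G.induce B)) +
        {v : V | v ∉ B ∧ ∃ b ∈ B, G.Adj v b}.ncard := by
  classical
  obtain ⟨FA, WA, ⟨hA1, hA2, hA3, hA4, hA5⟩, hA6⟩ := aux_complexity_spec (G.induce A)
  obtain ⟨FB, WB, ⟨hB1, hB2, hB3, hB4, hB5⟩, hB6⟩ := aux_complexity_spec (G.induce B)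
  set N : Set V := {v : V | v ∉ B ∧ ∃ b ∈ B, G.Adj v b} with hN
  have hcov : ∀ x, x ∈ A ∨ x ∈ B := fun x => by
    have : x ∈ A ∪ B := hunion ▸ Set.mem_univ x
    exact this
  have hdis : ∀ x, x ∈ A → x ∉ B := fun x h h' => Set.disjoint_left.mp hdisj h h'
  let H : SimpleGraph V :=
    { Adj := fun u v => (∃ (hu : u ∈ A) (hv : v ∈ A), FA.Adj ⟨u, hu⟩ ⟨v, hv⟩) ∨
        (∃ (hu : u ∈ B) (hv : v ∈ B), FB.Adj ⟨u, hu⟩ ⟨v, hv⟩)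
      symm := ⟨by
        rintro u v (⟨hu, hv, h⟩ | ⟨hu, hv, h⟩)
        · exact Or.inl ⟨hv, hu, h.symm⟩
        · exact Or.inr ⟨hv, hu, h.symm⟩⟩
      loopless := ⟨by
        rintro u (⟨hu, hv, h⟩ | ⟨hu, hv, h⟩)
        · exact FA.irrefl h
        · exact FB.irrefl h⟩ }
  have hHA : H.induce A ≤ FA := by
    rintro ⟨u, hu⟩ ⟨v, hv⟩ (⟨_, _, h⟩ | ⟨hu', _, h⟩)
    · exact h
    · exact absurd hu' (hdis u hu)
  have hHB : H.induce B ≤ FB := by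
    rintro ⟨u, hu⟩ ⟨v, hv⟩ (⟨hu', _, h⟩ | ⟨_, _, h⟩)
    · exact absurd hu (hdis u hu')
    · exact h
  have hHac : H.IsAcyclic := by
    intro u p
    rcases hcov u with hu | hu
    · refine aux_no_cycle H A ?_ (hA1.anti hHA) u hu p
      rintro u v (⟨_, hv, _⟩ | ⟨hu, _, _⟩) hu'
      · exact hv
      · exact absurd hu (hdis u hu')
    · refine aux_no_cycle H B ?_ (hB1.anti hHB) u hu p
      rintro u v (⟨hu, _, _⟩ | ⟨_, hv, _⟩) hu'
      · exact absurd hu' (hdis u hu)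
      · exact hv
  have hHG : H ≤ G := by
    rintro u v (⟨_, _, h⟩ | ⟨_, _, h⟩)
    · exact hA2 h
    · exact hB2 h
  obtain ⟨F, hHF, hFG, hFac, hFr⟩ :=
    SimpleGraph.exists_isAcyclic_reachable_eq_le_of_le_of_isAcyclic hHG hHac
  let W : V → Set V := fun x =>
    {u | (∃ (hx : x ∈ A) (hu : u ∈ A), (⟨u, hu⟩ : A) ∈ WA ⟨x, hx⟩) ∨
      (∃ (hx : x ∈ B) (hu : u ∈ B), (⟨u, hu⟩ : B) ∈ WB ⟨x, hx⟩) ∨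
      (u ∈ N ∧ F.Reachable x u)}
  have hFA : ∀ a b : A, FA.Adj a b → F.Adj a b := fun a b h => hHF (Or.inl ⟨a.2, b.2, h⟩)
  have hFB : ∀ a b : B, FB.Adj a b → F.Adj a b := fun a b h => hHF (Or.inr ⟨a.2, b.2, h⟩)
  have hW5 : ∀ u, u ∈ W u := fun u => by
    rcases hcov u with hu | hu
    · exact Or.inl ⟨hu, hu, hA5 _⟩
    · exact Or.inr (Or.inl ⟨hu, hu, hB5 _⟩)
  have hcross : ∀ u v, u ∈ A → v ∈ B → G.Adj u v → u ∈ W v ∧ v ∈ W v := by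
    intro u v hu hv h
    refine ⟨Or.inr (Or.inr ⟨⟨hdis u hu, v, hv, h⟩, ?_⟩), hW5 v⟩
    rw [hFr]; exact h.symm.reachable
  apply Nat.sInf_le
  refine ⟨F, W, ⟨hFac, hFG, ?_, ?_, hW5⟩, ?_⟩
  · intro u
    by_cases huN : u ∈ N
    · have huA : u ∈ A := (hcov u).resolve_right huN.1
      have : {x | u ∈ W x} = (F.connectedComponentMk u).supp := by
        ext x
        simp only [Set.mem_setOf_eq, SimpleGraph.ConnectedComponent.mem_supp_iff,
          SimpleGraph.ConnectedComponent.eq]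
        constructor
        · rintro (⟨hx, hu, h⟩ | ⟨hx, hu, h⟩ | ⟨_, h⟩)
          · have h1 := (hA3 ⟨u, hu⟩).preconnected ⟨⟨x, hx⟩, h⟩ ⟨⟨u, hu⟩, hA5 _⟩
            let f : FA.induce {x | (⟨u, hu⟩ : A) ∈ WA x} →g F :=
              ⟨fun x => x.1.1, fun {a b} h => hFA _ _ h⟩
            exact h1.map f
          · exact absurd hu (hdis u huA)
          · exact h
        · intro h; exact Or.inr (Or.inr ⟨huN, h⟩)
      rw [this]
      exact (F.connectedComponentMk u).connected_toSimpleGraph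
    · rcases hcov u with hu | hu
      · refine aux_conn F A FA hFA {x | ⟨u, hu⟩ ∈ WA x} _ ?_ (hA3 ⟨u, hu⟩)
        ext x
        constructor
        · rintro (⟨hx, hu, h⟩ | ⟨hx, hu', h⟩ | ⟨h, _⟩)
          · exact ⟨⟨x, hx⟩, h, rfl⟩
          · exact absurd hu' (hdis u hu)
          · exact absurd h huN
        · rintro ⟨x, h, rfl⟩
          exact Or.inl ⟨x.2, hu, h⟩
      · refine aux_conn F B FB hFB {x | ⟨u, hu⟩ ∈ WB x} _ ?_ (hB3 ⟨u, hu⟩)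
        ext x
        constructor
        · rintro (⟨hx, hu', h⟩ | ⟨hx, hu, h⟩ | ⟨h, _⟩)
          · exact absurd hu (hdis u hu')
          · exact ⟨⟨x, hx⟩, h, rfl⟩
          · exact absurd h huN
        · rintro ⟨x, h, rfl⟩
          exact Or.inr (Or.inl ⟨x.2, hu, h⟩)
  · intro u v h
    rcases hcov u with hu | hu <;> rcases hcov v with hv | hv
    · obtain ⟨x, h1, h2⟩ := hA4 ⟨u, hu⟩ ⟨v, hv⟩ h
      exact ⟨x, Or.inl ⟨x.2, hu, h1⟩, Or.inl ⟨x.2, hv, h2⟩⟩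
    · exact ⟨v, hcross u v hu hv h⟩
    · exact ⟨u, (hcross v u hv hu h.symm).symm⟩
    · obtain ⟨x, h1, h2⟩ := hB4 ⟨u, hu⟩ ⟨v, hv⟩ h
      exact ⟨x, Or.inr (Or.inl ⟨x.2, hu, h1⟩), Or.inr (Or.inl ⟨x.2, hv, h2⟩)⟩
  · intro x
    rcases hcov x with hx | hx
    · have hsub : W x ⊆ Subtype.val '' (WA ⟨x, hx⟩) ∪ N := by
        rintro u (⟨_, hu, h⟩ | ⟨hx', _, _⟩ | ⟨h, _⟩)
        · exact Or.inl ⟨_, h, rfl⟩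
        · exact absurd hx' (hdis x hx)
        · exact Or.inr h
      have h1 := Set.ncard_le_ncard hsub (Set.toFinite _)
      have h2 := Set.ncard_union_le (Subtype.val '' (WA ⟨x, hx⟩)) N
      have h3 := Set.ncard_image_le (f := Subtype.val) (Set.toFinite (WA ⟨x, hx⟩))
      have h4 := hA6 ⟨x, hx⟩
      have h5 := le_max_left (complexity (G.induce A)) (complexity (G.induce B))
      omega
    · have hsub : W x ⊆ Subtype.val '' (WB ⟨x, hx⟩) ∪ N := by
        rintro u (⟨hx', _, _⟩ | ⟨_, hu, h⟩ | ⟨h, _⟩)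
        · exact absurd hx (hdis x hx')
        · exact Or.inl ⟨_, h, rfl⟩
        · exact Or.inr h
      have h1 := Set.ncard_le_ncard hsub (Set.toFinite _)
      have h2 := Set.ncard_union_le (Subtype.val '' (WB ⟨x, hx⟩)) N
      have h3 := Set.ncard_image_le (f := Subtype.val) (Set.toFinite (WB ⟨x, hx⟩))
      have h4 := hB6 ⟨x, hx⟩
      have h5 := le_max_right (complexity (G.induce A)) (complexity (G.induce B))
      omega
end

section
/- (Simon's Factorization Theorem) Let (S, ·) be a finite semigroup. Then hrank(w) ≤ 3|S| for every nonempty word w ∈ S⁺. -/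
/-- The evaluation of a nonempty word `s₁s₂…sₙ` under a binary operation `op`:
`evalWord op [s₁, …, sₙ] = some (s₁ ⬝ s₂ ⬝ ⋯ ⬝ sₙ)` (and `none` on the empty word). -/
def evalWord {S : Type*} (op : S → S → S) : List S → Option S
  | [] => none
  | a :: l => some (l.foldl op a)

/-- `HRankLE op w h` expresses that the height `hrank(w)` of the nonempty word
`w` is at most `h`.  The height of a word is defined by: `hrank(w) = 1` if
`|w| = 1`, and otherwise `hrank(w)` is `1` plus the minimum, over all
factorizations of `w` that are binary (two nonempty parts) or unranked (at
least two nonempty parts, all evaluating to one common idempotent element), of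
the maximum height of a part. -/
inductive HRankLE {S : Type*} (op : S → S → S) : List S → ℕ → Prop
  | single (s : S) : HRankLE op [s] 1
  | mono {w : List S} {h : ℕ} : HRankLE op w h → HRankLE op w (h + 1)
  | binary {w₁ w₂ : List S} {h : ℕ} : w₁ ≠ [] → w₂ ≠ [] →
      HRankLE op w₁ h → HRankLE op w₂ h → HRankLE op (w₁ ++ w₂) (h + 1)
  | unranked {ws : List (List S)} {h : ℕ} (e : S) : 2 ≤ ws.length →
      (∀ u ∈ ws, u ≠ ([] : List S)) → op e e = e →
      (∀ u ∈ ws, evalWord op u = some e) →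
      (∀ u ∈ ws, HRankLE op u h) → HRankLE op ws.flatten (h + 1)

/-- The height `hrank(w)` of a nonempty word `w`, i.e. the least `h` with
`HRankLE op w h`. -/
noncomputable def hrank {S : Type*} (op : S → S → S) (w : List S) : ℕ :=
  sInf {h | HRankLE op w h}


namespace SimonAux

/-! ### Green's relations in a finite monoid -/

section Green
variable {M : Type*} [Monoid M]

def JLE (x y : M) : Prop := ∃ p q, x = p * y * q
def RR (x y : M) : Prop := (∃ s, x = y * s) ∧ (∃ s, y = x * s)
def LL (x y : M) : Prop := (∃ s, x = s * y) ∧ (∃ s, y = s * x)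

theorem JLE.refl (x : M) : JLE x x := ⟨1, 1, by simp⟩
theorem JLE.trans {x y z : M} (h : JLE x y) (h' : JLE y z) : JLE x z := by
  obtain ⟨p, q, rfl⟩ := h
  obtain ⟨p', q', rfl⟩ := h'
  exact ⟨p * p', q' * q, by simp only [mul_assoc]⟩
theorem JLE.mul_right (x y : M) : JLE (x * y) x := ⟨1, y, by simp⟩
theorem JLE.mul_left (x y : M) : JLE (x * y) y := ⟨x, 1, by simp⟩

theorem RR.symm {x y : M} (h : RR x y) : RR y x := ⟨h.2, h.1⟩
theorem LL.symm {x y : M} (h : LL x y) : LL y x := ⟨h.2, h.1⟩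
theorem RR.trans {x y z : M} (h : RR x y) (h' : RR y z) : RR x z := by
  obtain ⟨⟨a, ha⟩, ⟨b, hb⟩⟩ := h
  obtain ⟨⟨c, hc⟩, ⟨d, hd⟩⟩ := h'
  exact ⟨⟨c * a, by rw [ha, hc, mul_assoc]⟩, ⟨b * d, by rw [hd, hb, mul_assoc]⟩⟩
theorem LL.trans {x y z : M} (h : LL x y) (h' : LL y z) : LL x z := by
  obtain ⟨⟨a, ha⟩, ⟨b, hb⟩⟩ := h
  obtain ⟨⟨c, hc⟩, ⟨d, hd⟩⟩ := h'
  exact ⟨⟨a * c, by rw [ha, hc, mul_assoc]⟩, ⟨d * b, by rw [hd, hb, mul_assoc]⟩⟩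
theorem RR.mul {x y : M} (a : M) (h : RR x y) : RR (a * x) (a * y) := by
  obtain ⟨⟨s, hs⟩, ⟨t, ht⟩⟩ := h
  exact ⟨⟨s, by rw [mul_assoc, ← hs]⟩, ⟨t, by rw [mul_assoc, ← ht]⟩⟩
theorem RR.jle {x y : M} (h : RR x y) : JLE x y := by
  obtain ⟨⟨s, hs⟩, _⟩ := h
  exact ⟨1, s, by simpa using hs⟩

theorem pump {x p q : M} (h : x = p * x * q) (n : ℕ) : x = p ^ n * x * q ^ n := by
  induction n with
  | zero => simp
  | succ n ih =>
    calc x = p ^ n * x * q ^ n := ih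
      _ = p ^ n * (p * x * q) * q ^ n := by rw [← h]
      _ = p ^ (n+1) * x * q ^ (n+1) := by
        rw [pow_succ p, pow_succ' q]; simp only [mul_assoc]

theorem exists_pow [Finite M] (p : M) : ∃ i d : ℕ, p ^ i = p ^ (i + (d + 1)) := by
  obtain ⟨i, j, hij, h⟩ := Finite.exists_ne_map_eq_of_infinite (fun n : ℕ => p ^ n)
  rcases lt_or_gt_of_ne hij with h' | h'
  · obtain ⟨d, rfl⟩ := Nat.exists_eq_add_of_lt h'
    exact ⟨i, d, h⟩
  · obtain ⟨d, rfl⟩ := Nat.exists_eq_add_of_lt h'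
    exact ⟨j, d, h.symm⟩

/-- left stability -/
theorem stabL [Finite M] {x a : M} (h : JLE x (a * x)) : ∃ b, x = b * (a * x) := by
  obtain ⟨p, q, h⟩ := h
  have h1 : x = (p * a) * x * q := by rw [mul_assoc p]; exact h
  obtain ⟨i, d, hd⟩ := exists_pow (p * a)
  have h2 := pump h1 i
  have h3 : x = (p * a) ^ (d + 1) * x := by
    calc x = (p * a) ^ (d + 1 + i) * x * q ^ i := by rw [add_comm, ← hd]; exact h2
      _ = (p * a) ^ (d + 1) * ((p * a) ^ i * x * q ^ i) := by
          rw [pow_add]; simp only [mul_assoc]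
      _ = _ := by rw [← h2]
  refine ⟨(p * a) ^ d * p, ?_⟩
  rw [pow_succ] at h3
  simpa only [mul_assoc] using h3

/-- right stability -/
theorem stabR [Finite M] {x a : M} (h : JLE x (x * a)) : ∃ b, x = (x * a) * b := by
  obtain ⟨p, q, h⟩ := h
  have h1 : x = p * x * (a * q) := by simpa only [mul_assoc] using h
  obtain ⟨i, d, hd⟩ := exists_pow (a * q)
  have h2 := pump h1 i
  have h3 : x = x * (a * q) ^ (d + 1) := by
    calc x = p ^ i * x * (a * q) ^ (i + (d + 1)) := by rw [← hd]; exact h2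
      _ = (p ^ i * x * (a * q) ^ i) * (a * q) ^ (d + 1) := by
          rw [pow_add]; simp only [mul_assoc]
      _ = _ := by rw [← h2]
  refine ⟨q * (a * q) ^ d, ?_⟩
  rw [pow_succ'] at h3
  simpa only [mul_assoc] using h3

/-- `u` is an idempotent in the H-class of `c` -/
def HI (c u : M) : Prop := u * u = u ∧ RR u c ∧ LL u c

theorem HI.unique {c u v : M} (h : HI c u) (h' : HI c v) : u = v := by
  obtain ⟨hu, hR, hL⟩ := h
  obtain ⟨hv, hR', hL'⟩ := h'
  obtain ⟨⟨s, hs⟩, _⟩ := hR.trans hR'.symm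
  obtain ⟨_, ⟨t, ht⟩⟩ := hL.trans hL'.symm
  have h1 : v * u = u := by rw [hs, ← mul_assoc, hv]
  have h2 : v * u = v := by rw [ht, mul_assoc, hu]
  rw [← h1, h2]

open Classical in
noncomputable def eF (c : M) : M := Classical.epsilon (HI c)

theorem eF_eq {c u : M} (h : HI c u) : eF c = u :=
  HI.unique (Classical.epsilon_spec (p := HI c) ⟨u, h⟩) h

open Classical in
noncomputable def al (z x : M) : M := Classical.epsilon (fun a => RR (a * z) x)

theorem al_congr {z x y : M} (h : RR x y) : al z x = al z y := by
  unfold al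
  congr 1
  funext a
  exact propext ⟨fun h' => h'.trans h, fun h' => h'.trans h.symm⟩

theorem al_spec [Finite M] {z x : M} (h1 : JLE z x) (h2 : JLE x z) : RR (al z x * z) x := by
  refine Classical.epsilon_spec (p := fun a => RR (a * z) x) ?_
  obtain ⟨a, b, hab⟩ := h2
  refine ⟨a, ?_, b, hab⟩
  have : JLE (a * z) ((a * z) * b) := by
    rw [← hab]; exact (JLE.mul_left a z).trans h1
  obtain ⟨c, hc⟩ := stabR this
  exact ⟨c, by rw [hab]; exact hc⟩

theorem al_inv [Finite M] {z x : M} (h1 : JLE z x) (h2 : JLE x z) :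
    ∃ b, z = b * (al z x * z) :=
  stabL (h1.trans (al_spec h1 h2).symm.jle)

/-- colour of a gap with prefix product `Q` and next letter `x` -/
noncomputable def col (z Q x : M) : M := al z x * Q

theorem col_RR [Finite M] {z Q x : M} (h1 : JLE z x) (h2 : JLE x z) (hQ : RR Q z) :
    RR (col z Q x) x :=
  (hQ.mul _).trans (al_spec h1 h2)

theorem al_inv' [Finite M] {z Q x : M} (h1 : JLE z x) (h2 : JLE x z) (hQ : RR Q z) :
    ∃ b, Q = b * (al z x * Q) := by
  obtain ⟨b, hb⟩ := al_inv h1 h2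
  obtain ⟨⟨s, hs⟩, _⟩ := hQ
  refine ⟨b, ?_⟩
  calc Q = z * s := hs
    _ = b * (al z x * z) * s := by rw [← hb]
    _ = _ := by rw [hs]; simp only [mul_assoc]

theorem col_HI [Finite M] {z Q x y t : M}
    (h1 : JLE z x) (h2 : JLE x z) (h3 : JLE z y) (h4 : JLE y z)
    (hQ : RR Q z) (hQ' : RR (Q * (x * t)) z) (hu : JLE (x * t) z) (hu' : JLE z (x * t))
    (hc : col z Q x = col z (Q * (x * t)) y) :
    HI (col z Q x) (x * t) := by
  have hR : RR x y := by
    have := col_RR h3 h4 hQ'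
    rw [← hc] at this
    exact (col_RR h1 h2 hQ).symm.trans this
  obtain ⟨b, hb⟩ := al_inv' h1 h2 hQ
  obtain ⟨b', hb'⟩ := al_inv' h1 h2 hQ'
  obtain ⟨c, hcz⟩ := al_inv h1 h2
  have hfix : Q = Q * (x * t) := by
    unfold col at hc
    rw [← al_congr (z := z) hR] at hc
    obtain ⟨⟨s, hs⟩, _⟩ := hQ
    obtain ⟨⟨s', hs'⟩, _⟩ := hQ'
    have e1 : c * (al z x * Q) = Q := by
      rw [hs]; calc c * (al z x * (z * s)) = c * (al z x * z) * s := by simp only [mul_assoc]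
        _ = _ := by rw [← hcz]
    have e2 : c * (al z x * (Q * (x * t))) = Q * (x * t) := by
      rw [hs']; calc c * (al z x * (z * s')) = c * (al z x * z) * s' := by simp only [mul_assoc]
        _ = _ := by rw [← hcz]
    rw [← e2, ← hc, e1]
  have hL : ∃ r, x * t = r * Q := by
    have : JLE (x * t) (Q * (x * t)) := by
      rw [← hfix]; exact hu.trans hQ.symm.jle
    obtain ⟨r, hr⟩ := stabL this
    exact ⟨r, by rw [hfix]; exact hr⟩
  obtain ⟨r, hr⟩ := hL
  refine ⟨?_, ?_, ?_⟩
  · calc (x * t) * (x * t) = r * (Q * (x * t)) := by rw [← mul_assoc r, ← hr]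
      _ = _ := by rw [← hfix, ← hr]
  · have hx : RR (x * t) x := by
      refine ⟨⟨t, rfl⟩, ?_⟩
      exact stabR (h2.trans hu')
    exact hx.trans (col_RR h1 h2 hQ).symm
  · refine LL.trans (y := Q) ⟨⟨r, hr⟩, ⟨Q, hfix⟩⟩ ⟨⟨b, hb⟩, ⟨al z x, rfl⟩⟩

end Green

/-! ### Words -/
section Words
variable {S : Type*} [Semigroup S]

def val (w : List S) : WithOne S := (w.map (fun s => (s : WithOne S))).prod

@[simp] theorem val_nil : val ([] : List S) = 1 := rfl
@[simp] theorem val_cons (a : S) (w : List S) : val (a :: w) = (a : WithOne S) * val w := by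
  simp [val]
@[simp] theorem val_append (u v : List S) : val (u ++ v) = val u * val v := by
  simp [val]

theorem foldl_val (w : List S) (a : S) :
    ((w.foldl (· * ·) a : S) : WithOne S) = (a : WithOne S) * val w := by
  induction w generalizing a with
  | nil => simp
  | cons b w ih => simp only [List.foldl_cons, ih, val_cons, WithOne.coe_mul, mul_assoc]

theorem exists_val {w : List S} (hw : w ≠ []) :
    ∃ s : S, evalWord (· * ·) w = some s ∧ val w = (s : WithOne S) := by
  cases w with
  | nil => exact absurd rfl hw
  | cons a w => exact ⟨_, rfl, by rw [foldl_val, val_cons]⟩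

theorem val_ne_one {w : List S} (hw : w ≠ []) : val w ≠ 1 := by
  obtain ⟨s, _, h⟩ := exists_val hw
  rw [h]; exact WithOne.coe_ne_one

abbrev H (w : List S) (h : ℕ) : Prop := HRankLE (· * ·) w h

theorem H.le {w : List S} {h h' : ℕ} (hw : H w h) (hh : h ≤ h') : H w h' := by
  induction hh with
  | refl => exact hw
  | step _ ih => exact HRankLE.mono ih

theorem H.bin {u v : List S} {a b h : ℕ} (hu : u ≠ []) (hv : v ≠ []) (h1 : H u a) (h2 : H v b)
    (ha : a + 1 ≤ h) (hb : b + 1 ≤ h) : H (u ++ v) h := by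
  obtain ⟨h, rfl⟩ : ∃ k, h = k + 1 := ⟨h - 1, by omega⟩
  exact HRankLE.binary hu hv (h1.le (by omega)) (h2.le (by omega))

theorem H.unr {ws : List (List S)} {h : ℕ} (e : WithOne S) (hne : ws ≠ [])
    (h1 : ∀ u ∈ ws, u ≠ []) (he : e * e = e) (h2 : ∀ u ∈ ws, val u = e)
    (h3 : ∀ u ∈ ws, H u h) : H ws.flatten (h + 1) := by
  rcases ws with _ | ⟨u, _ | ⟨v, ws⟩⟩
  · exact absurd rfl hne
  · simpa using (h3 u (by simp)).le (Nat.le_succ h)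
  · obtain ⟨s, _, hs'⟩ := exists_val (h1 u (by simp))
    have hes : e = s := by rw [← hs', h2 u (by simp)]
    refine HRankLE.unranked s (by simp) h1 ?_ ?_ h3
    · rw [hes] at he
      exact_mod_cast he
    · intro x hx
      obtain ⟨r, hr, hr'⟩ := exists_val (h1 x hx)
      rw [hr]
      have := h2 x hx
      rw [hr', hes] at this
      rw [WithOne.coe_inj.mp this]

/-! ### coloured pieces -/

variable {κ : Type*}

def flatW (l : List (List S × κ)) : List S := (l.map Prod.fst).flatten

@[simp] theorem flatW_append (l l' : List (List S × κ)) :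
    flatW (l ++ l') = flatW l ++ flatW l' := by simp [flatW]
@[simp] theorem flatW_nil : flatW ([] : List (List S × κ)) = [] := rfl
@[simp] theorem flatW_cons (p : List S × κ) (l : List (List S × κ)) :
    flatW (p :: l) = p.1 ++ flatW l := by simp [flatW]
theorem flatW_flatten (us : List (List (List S × κ))) :
    flatW us.flatten = (us.map flatW).flatten := by
  induction us with
  | nil => rfl
  | cons u us ih => simp [ih]

theorem flatW_ne {l : List (List S × κ)} (hl : l ≠ []) (h : ∀ p ∈ l, p.1 ≠ []) :
    flatW l ≠ [] := by
  cases l with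
  | nil => exact absurd rfl hl
  | cons p l =>
    rw [flatW_cons]
    intro h'
    exact h p (by simp) (List.append_eq_nil_iff.mp h').1

def Good (e : κ → WithOne S) (l : List (List S × κ)) : Prop :=
  ∀ l1 p l2 q l3, l = l1 ++ p :: (l2 ++ q :: l3) → p.2 = q.2 →
    val (flatW (l2 ++ [q])) = e q.2 ∧ e q.2 * e q.2 = e q.2

theorem Good.infix {e : κ → WithOne S} {l : List (List S × κ)} (h : Good e l)
    {a b c : List (List S × κ)} (hl : l = a ++ b ++ c) : Good e b := by
  intro l1 p l2 q l3 hb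
  exact h (a ++ l1) p l2 q (l3 ++ c) (by rw [hl, hb]; simp)

def Ends (c : κ) (u : List (List S × κ)) : Prop :=
  ∃ u' q, u = u' ++ [q] ∧ q.2 = c ∧ ∀ p ∈ u', p.2 ≠ c

theorem split (c : κ) (l : List (List S × κ)) :
    ∃ (us : List (List (List S × κ))) (t : List (List S × κ)), l = us.flatten ++ t ∧ (∀ u ∈ us, Ends c u) ∧ ∀ p ∈ t, p.2 ≠ c := by
  classical
  induction l with
  | nil => exact ⟨[], [], by simp⟩
  | cons x l ih =>
    obtain ⟨us, t, rfl, h1, h2⟩ := ih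
    by_cases hx : x.2 = c
    · refine ⟨[x] :: us, t, by simp, ?_, h2⟩
      intro u hu
      rcases List.mem_cons.mp hu with rfl | hu
      · exact ⟨[], x, by simp, hx, by simp⟩
      · exact h1 u hu
    · rcases us with _ | ⟨u, us⟩
      · refine ⟨[], x :: t, by simp, by simp, ?_⟩
        intro p hp
        rcases List.mem_cons.mp hp with rfl | hp
        · exact hx
        · exact h2 p hp
      · refine ⟨(x :: u) :: us, t, by simp, ?_, h2⟩
        intro v hv
        rcases List.mem_cons.mp hv with rfl | hv
        · obtain ⟨u', q, hu, hq, h3⟩ := h1 u (by simp)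
          refine ⟨x :: u', q, by simp [hu], hq, ?_⟩
          intro p hp
          rcases List.mem_cons.mp hp with rfl | hp
          · exact hx
          · exact h3 p hp
        · exact h1 v (by simp [hv])

theorem flatten_ends {c : κ} (us : List (List (List S × κ))) (h : ∀ u ∈ us, Ends c u)
    (hne : us ≠ []) : ∃ x p, us.flatten = x ++ [p] ∧ p.2 = c := by
  rcases List.eq_nil_or_concat us with rfl | ⟨vs, v, rfl⟩
  · exact absurd rfl hne
  · obtain ⟨u', q, hu, hq, _⟩ := h v (by simp)
    exact ⟨vs.flatten ++ u', q, by simp [hu], hq⟩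

theorem middle {e : κ → WithOne S} {l : List (List S × κ)} (hg : Good e l) {c : κ} {h : ℕ}
    (u0 : List (List S × κ)) (us : List (List (List S × κ))) (z : List (List S × κ))
    (hl : l = u0 ++ us.flatten ++ z) (h0 : Ends c u0) (hus : ∀ u ∈ us, Ends c u)
    (hne : us ≠ []) (hpn : ∀ p ∈ l, p.1 ≠ [])
    (hh : ∀ u ∈ us, H (flatW u) h) : H (flatW us.flatten) (h + 1) := by
  rw [flatW_flatten]
  have key : ∀ u ∈ us, val (flatW u) = e c ∧ e c * e c = e c := by
    intro u hu
    obtain ⟨s, t, rfl⟩ := List.append_of_mem hu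
    obtain ⟨x, p, hx, hp⟩ := flatten_ends (c := c) (u0 :: s) (by
      intro v hv
      rcases List.mem_cons.mp hv with rfl | hv
      · exact h0
      · exact hus v (by simp [hv])) (by simp)
    obtain ⟨u', q, rfl, hq, _⟩ := hus u hu
    have := hg x p u' q (t.flatten ++ z) (by
      rw [hl]
      have : u0 ++ s.flatten = x ++ [p] := by simpa using hx
      simp only [List.flatten_append, List.flatten_cons]
      rw [← List.append_assoc, this]; simp) (hp.trans hq.symm)
    rwa [hq] at this
  have hun : ∀ u ∈ us, flatW u ≠ [] := by
    intro u hu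
    refine flatW_ne ?_ ?_
    · obtain ⟨u', q, rfl, _⟩ := hus u hu
      simp
    · intro p hp
      refine hpn p ?_
      rw [hl]
      simp only [List.mem_append, List.mem_flatten]
      exact Or.inl (Or.inr ⟨u, hu, hp⟩)
  obtain ⟨u, hu⟩ := List.exists_mem_of_ne_nil us hne
  refine H.unr (e c) (by simpa using hne) ?_ (key u hu).2 ?_ ?_
  · intro v hv
    obtain ⟨u, hu, rfl⟩ := List.mem_map.mp hv
    exact hun u hu
  · intro v hv
    obtain ⟨u, hu, rfl⟩ := List.mem_map.mp hv
    exact (key u hu).1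
  · intro v hv
    obtain ⟨u, hu, rfl⟩ := List.mem_map.mp hv
    exact hh u hu

/-- heights: first piece at most `B + δ`, others at most `B`. -/
def Hts (B δ : ℕ) (l : List (List S × κ)) : Prop :=
  ∀ p l', l = p :: l' → H p.1 (B + δ) ∧ ∀ q ∈ l', H q.1 B

theorem Hts.all {B : ℕ} {l : List (List S × κ)} (h : ∀ q ∈ l, H q.1 B) : Hts B 0 l := by
  rintro p l' rfl
  exact ⟨h p (by simp), fun q hq => h q (by simp [hq])⟩

theorem Hts.append {B δ : ℕ} {l l' : List (List S × κ)} (h : Hts B δ (l ++ l')) (hl : l ≠ []) :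
    Hts B δ l ∧ ∀ q ∈ l', H q.1 B := by
  rcases l with _ | ⟨p, l⟩
  · exact absurd rfl hl
  · obtain ⟨h1, h2⟩ := h p (l ++ l') rfl
    refine ⟨?_, fun q hq => h2 q (by simp [hq])⟩
    intro p' l'' hh
    obtain ⟨rfl, rfl⟩ := List.cons.inj hh
    exact ⟨h1, fun q hq => h2 q (by simp [hq])⟩

theorem lemA [DecidableEq κ] {e : κ → WithOne S} {B : ℕ} (C : Finset κ) :
    ∀ (δ : ℕ) (d : List (List S × κ)) (z : List S × κ), δ ≤ 1 →
      (∀ p ∈ d ++ [z], p.1 ≠ []) → (∀ p ∈ d, p.2 ∈ C) → Good e (d ++ [z]) →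
      Hts B δ (d ++ [z]) → H (flatW (d ++ [z])) (B + max (3 * C.card) δ) := by
  induction C using Finset.induction_on with
  | empty =>
    intro δ d z hδ hpn hC hg hH
    have : d = [] := List.eq_nil_iff_forall_not_mem.mpr (fun p hp => by simpa using hC p hp)
    subst this
    simpa using (hH z [] rfl).1
  | insert c C hc ih =>
    intro δ d z hδ hpn hC hg hH
    rw [Finset.card_insert_of_notMem hc]
    obtain ⟨us, t, rfl, h1, h2⟩ := split c d
    have hCt : ∀ p ∈ t, p.2 ∈ C := fun p hp => by
      have := hC p (by simp [hp])
      exact Finset.mem_of_mem_insert_of_ne this (h2 p hp)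
    rcases us with _ | ⟨u0, us⟩
    · simp only [List.flatten_nil, List.nil_append] at *
      exact (ih δ t z hδ hpn hCt hg hH).le (by omega)
    · have hsub : ∀ u ∈ u0 :: us, ∀ p ∈ u, p ∈ (u0 :: us).flatten := fun u hu p hp =>
        List.mem_flatten.mpr ⟨u, hu, hp⟩
      have hgood : ∀ u ∈ u0 :: us, Good e u := by
        intro u hu
        obtain ⟨a, b, hab⟩ := List.append_of_mem hu
        rw [hab] at hg
        exact hg.infix (a := a.flatten) (c := b.flatten ++ (t ++ [z])) (by simp)
      have hu0 : u0 ≠ [] := by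
        obtain ⟨u', q, rfl, _⟩ := h1 u0 (by simp)
        simp
      have hH' : Hts B δ (u0 ++ (us.flatten ++ (t ++ [z]))) := by simpa using hH
      obtain ⟨hH0, hH1⟩ := hH'.append hu0
      have step : ∀ u ∈ u0 :: us, ∀ δ' ≤ 1, Hts B δ' u → H (flatW u) (B + max (3 * C.card) δ') := by
        intro u hu δ' hδ' hh
        have hgu := hgood u hu
        have hsu := hsub u hu
        obtain ⟨u', q, rfl, hq, h3⟩ := h1 u hu
        refine ih δ' u' q hδ' ?_ ?_ hgu hh
        · intro p hp
          exact hpn p (by rw [List.append_assoc]; exact List.mem_append_left _ (hsu p hp))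
        · intro p hp
          exact Finset.mem_of_mem_insert_of_ne
            (hC p (List.mem_append_left _ (hsu p (by simp [hp])))) (h3 p hp)
      have A0 := step u0 (by simp) δ hδ hH0
      have hflat : flatW ((u0 :: us).flatten ++ t ++ [z])
          = flatW u0 ++ (flatW us.flatten ++ flatW (t ++ [z])) := by simp
      have nz : flatW (t ++ [z]) ≠ [] :=
        flatW_ne (by simp) (fun p hp => hpn p (by rw [List.append_assoc]; exact List.mem_append_right _ hp))
      have n0 : flatW u0 ≠ [] :=
        flatW_ne hu0 (fun p hp => hpn p (by simp [hp]))
      have Az : H (flatW (t ++ [z])) (B + max (3 * C.card) 0) := by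
        refine ih 0 t z (by omega) ?_ hCt ?_ ?_
        · exact fun p hp => hpn p (by rw [List.append_assoc]; exact List.mem_append_right _ hp)
        · exact hg.infix (a := (u0 :: us).flatten) (c := []) (by simp)
        · exact Hts.all (fun q hq => hH1 q (List.mem_append_right _ hq))
      rw [hflat]
      by_cases hus : us = []
      · subst hus
        simp only [List.flatten_nil, flatW_nil, List.nil_append]
        exact H.bin n0 nz A0 Az (by omega) (by omega)
      · have Am := middle hg (c := c) (h := B + 3 * C.card) u0 us (t ++ [z]) (by simp)
          (h1 u0 (by simp)) (fun u hu => h1 u (by simp [hu])) hus hpn (by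
            intro u hu
            have := step u (by simp [hu]) 0 (by omega) (Hts.all (fun q hq =>
              hH1 q (List.mem_append_left _ (List.mem_flatten.mpr ⟨u, hu, hq⟩))))
            simpa using this)
        have nm : flatW us.flatten ≠ [] := by
          refine flatW_ne ?_ ?_
          · obtain ⟨x, p, hx, _⟩ := flatten_ends us (fun u hu => h1 u (by simp [hu])) hus
            rw [hx]; simp
          · intro p hp
            exact hpn p (by simp only [List.flatten_cons, List.mem_append]; tauto)
        have A2 : H (flatW us.flatten ++ flatW (t ++ [z])) (B + 3 * C.card + 2) :=
          H.bin nm nz Am Az (by omega) (by omega)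
        exact H.bin n0 (by simp [nm]) A0 A2 (by omega) (by omega)

theorem lemA' [DecidableEq κ] {e : κ → WithOne S} {B : ℕ} (C : Finset κ)
    (l : List (List S × κ)) (hl : l ≠ [])
    (hpn : ∀ p ∈ l, p.1 ≠ []) (hC : ∀ p ∈ l, p.2 ∈ C) (hg : Good e l)
    (hH : Hts B 1 l) : H (flatW l) (B + 3 * C.card - 1) := by
  rcases List.eq_nil_or_concat l with rfl | ⟨d, z, hdz⟩
  · exact absurd rfl hl
  obtain ⟨c, hcz⟩ : ∃ c, c = z.2 := ⟨_, rfl⟩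
  have hcC : c ∈ C := hcz ▸ hC z (by rw [hdz]; simp)
  have hcard : (C.erase c).card + 1 = C.card := Finset.card_erase_add_one hcC
  obtain ⟨us, t, hlu, h1, h2⟩ := split c l
  have ht : t = [] := by
    rcases List.eq_nil_or_concat t with rfl | ⟨t', y, rfl⟩
    · rfl
    · exfalso
      have h3 : d ++ [z] = (us.flatten ++ t') ++ [y] := by
        rw [← List.concat_eq_append, ← hdz, hlu]; simp
      have h4 := List.append_inj_right' h3 rfl
      have : z = y := by simpa using h4
      exact h2 y (by simp) (by rw [← this, hcz])
  subst ht
  rw [List.append_nil] at hlu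
  subst hlu
  rcases us with _ | ⟨u0, us⟩
  · exact absurd rfl hl
  have hgood : ∀ u ∈ u0 :: us, Good e u := by
    intro u hu
    obtain ⟨a, b, hab⟩ := List.append_of_mem hu
    rw [hab] at hg
    exact hg.infix (a := a.flatten) (c := b.flatten) (by simp)
  have hsub : ∀ u ∈ u0 :: us, ∀ p ∈ u, p ∈ (u0 :: us).flatten := fun u hu p hp =>
    List.mem_flatten.mpr ⟨u, hu, hp⟩
  have hu0 : u0 ≠ [] := by
    obtain ⟨u', q, rfl, _⟩ := h1 u0 (by simp)
    simp
  have hH' : Hts B 1 (u0 ++ us.flatten) := by simpa using hH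
  obtain ⟨hH0, hH1⟩ := hH'.append hu0
  have step : ∀ u ∈ u0 :: us, ∀ δ' ≤ 1, Hts B δ' u →
      H (flatW u) (B + max (3 * (C.erase c).card) δ') := by
    intro u hu δ' hδ' hh
    have hgu := hgood u hu
    have hsu := hsub u hu
    obtain ⟨u', q, rfl, hq, h3⟩ := h1 u hu
    refine lemA _ δ' u' q hδ' ?_ ?_ hgu hh
    · intro p hp
      exact hpn p (hsu p hp)
    · intro p hp
      exact Finset.mem_erase.mpr ⟨h3 p hp, hC p (hsu p (by simp [hp]))⟩
  have A0 := step u0 (by simp) 1 le_rfl hH0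
  have n0 : flatW u0 ≠ [] := flatW_ne hu0 (fun p hp => hpn p (by simp [hp]))
  by_cases hus : us = []
  · subst hus
    simp only [List.flatten_cons, List.flatten_nil, List.append_nil]
    exact A0.le (by omega)
  · have Am := middle hg (c := c) (h := B + 3 * (C.erase c).card) u0 us [] (by simp)
      (h1 u0 (by simp)) (fun u hu => h1 u (by simp [hu])) hus hpn (by
        intro u hu
        have := step u (by simp [hu]) 0 (by omega) (Hts.all (fun q hq =>
          hH1 q (List.mem_flatten.mpr ⟨u, hu, hq⟩)))
        simpa using this)
    have nm : flatW us.flatten ≠ [] := by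
      refine flatW_ne ?_ ?_
      · obtain ⟨x, p, hx, _⟩ := flatten_ends us (fun u hu => h1 u (by simp [hu])) hus
        rw [hx]; simp
      · intro p hp
        exact hpn p (by simp only [List.flatten_cons, List.mem_append]; tauto)
    rw [List.flatten_cons, flatW_append]
    exact H.bin n0 nm A0 Am (by omega) (by omega)

/-! ### cutting -/

theorem cut (d : WithOne S) (w : List S) : ∃ (v0 : List S) (ys : List (List S)),
    w = v0 ++ ys.flatten ∧ (v0 = [] ∨ ¬ JLE (val v0) d) ∧
    ∀ y ∈ ys, JLE (val y) d ∧ ∃ a v, y = a :: v ∧ (v = [] ∨ ¬ JLE (val v) d) := by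
  classical
  induction w with
  | nil => exact ⟨[], [], by simp⟩
  | cons a w ih =>
    obtain ⟨v0, ys, rfl, h1, h2⟩ := ih
    by_cases h : JLE (val (a :: v0)) d
    · refine ⟨[], (a :: v0) :: ys, by simp, Or.inl rfl, ?_⟩
      intro y hy
      rcases List.mem_cons.mp hy with rfl | hy
      · exact ⟨h, a, v0, rfl, h1⟩
      · exact h2 y hy
    · exact ⟨a :: v0, ys, by simp, Or.inr h, h2⟩

/-! ### colouring -/

noncomputable def cols (z : WithOne S) : WithOne S → List (List S) → List (List S × WithOne S)
  | _, [] => []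
  | P, y :: ys => (y, col z (P * val y) (((ys.map val).head?).getD z)) :: cols z (P * val y) ys

theorem cols_flat (z : WithOne S) (ys : List (List S)) : ∀ P,
    (cols z P ys).map Prod.fst = ys := by
  induction ys with
  | nil => intro P; rfl
  | cons y ys ih => intro P; simp [cols, ih]

theorem cols_spec (z : WithOne S) (l1 : List (List S × WithOne S)) (p : List S × WithOne S)
    (l2 : List (List S × WithOne S)) : ∀ (P : WithOne S) (ys : List (List S)),
    cols z P ys = l1 ++ p :: l2 →
    p.2 = col z (P * val (flatW (l1 ++ [p]))) ((((l2.map Prod.fst).map val).head?).getD z) := by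
  induction l1 with
  | nil =>
    intro P ys h
    cases ys with
    | nil => simp [cols] at h
    | cons y ys =>
      simp only [cols, List.nil_append, List.cons.injEq] at h
      obtain ⟨rfl, rfl⟩ := h
      simp [cols_flat]
  | cons x l1 ih =>
    intro P ys h
    cases ys with
    | nil => simp [cols] at h
    | cons y ys =>
      simp only [cols, List.cons_append, List.cons.injEq] at h
      obtain ⟨rfl, h⟩ := h
      rw [ih _ _ h]
      simp [mul_assoc]

theorem lemC [Finite S] (d : WithOne S) (y0 : List S) (ys : List (List S))
    (hle : ∀ y ∈ y0 :: ys, JLE (val y) d) (hge : JLE d (val (y0 :: ys).flatten)) :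
    (∀ p ∈ cols (val y0) 1 (y0 :: ys), JLE p.2 d ∧ JLE d p.2) ∧
    Good eF (cols (val y0) 1 (y0 :: ys)) := by
  haveI : Finite (WithOne S) := inferInstanceAs (Finite (Option S))
  obtain ⟨z, hz⟩ : ∃ z, z = val y0 := ⟨_, rfl⟩
  rw [← hz]
  obtain ⟨L, hL⟩ : ∃ L, L = cols z 1 (y0 :: ys) := ⟨_, rfl⟩
  have hLf : L.map Prod.fst = y0 :: ys := by rw [hL, cols_flat]
  have hLW : flatW L = (y0 :: ys).flatten := by rw [flatW, hLf]
  have hzd : JLE z d := hz ▸ hle y0 (by simp)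
  -- every nonempty infix evaluates into the J-class
  have hinf : ∀ a b c, L = a ++ b ++ c → b ≠ [] →
      JLE (val (flatW b)) d ∧ JLE d (val (flatW b)) := by
    intro a b c h hb
    constructor
    · rcases b with _ | ⟨p, b⟩
      · exact absurd rfl hb
      · rw [flatW_cons, val_append]
        refine (JLE.mul_right _ _).trans (hle p.1 ?_)
        rw [← hLf, h]; simp
    · rw [← hLW, h] at hge
      refine hge.trans ⟨val (flatW a), val (flatW c), by simp [mul_assoc]⟩
  have hdz : JLE d z := by
    have := hge.trans (y := val (y0 :: ys).flatten) (z := z) (by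
      rw [List.flatten_cons, val_append, hz]; exact JLE.mul_right _ _)
    exact this
  have hpre : ∀ a p b, L = a ++ p :: b → RR (val (flatW (a ++ [p]))) z := by
    intro a p b h
    have hd := (hinf [] (a ++ [p]) b (by simp [h]) (by simp)).2
    have : ∃ s, val (flatW (a ++ [p])) = z * s := by
      rcases a with _ | ⟨x, a⟩
      · have : p.1 = y0 := by
          have := hLf; rw [h] at this; simp at this; exact this.1
        exact ⟨1, by simp [this, hz]⟩
      · have : x.1 = y0 := by
          have := hLf; rw [h] at this; simp at this; exact this.1
        exact ⟨val (flatW (a ++ [p])), by simp [this, hz]⟩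
    obtain ⟨s, hs⟩ := this
    refine ⟨⟨s, hs⟩, ?_⟩
    rw [hs] at hd ⊢
    exact stabR (hzd.trans hd)
  have hnext : ∀ a b, L = a ++ b →
      JLE z ((((b.map Prod.fst).map val).head?).getD z) ∧
      JLE ((((b.map Prod.fst).map val).head?).getD z) z := by
    intro a b h
    rcases b with _ | ⟨q, b⟩
    · simp only [List.map_nil, List.head?_nil, Option.getD_none]
      exact ⟨JLE.refl _, JLE.refl _⟩
    · simp only [List.map_cons, List.head?_cons, Option.getD_some]
      have := hinf a [q] b (by simp [h]) (by simp)
      simp only [flatW_cons, flatW_nil, List.append_nil] at this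
      exact ⟨hzd.trans this.2, this.1.trans hdz⟩
  have hspec : ∀ a p b, L = a ++ p :: b →
      p.2 = col z (val (flatW (a ++ [p]))) ((((b.map Prod.fst).map val).head?).getD z) := by
    intro a p b h
    have := cols_spec z a p b 1 (y0 :: ys) (hL ▸ h)
    rwa [one_mul] at this
  rw [← hL]
  constructor
  · intro p hp
    obtain ⟨a, b, h⟩ := List.append_of_mem hp
    obtain ⟨g1, g2⟩ := hnext (a ++ [p]) b (by simp [h])
    have := col_RR g1 g2 (hpre a p b h)
    rw [← hspec a p b h] at this
    exact ⟨this.jle.trans (g2.trans hzd), (hdz.trans g1).trans this.symm.jle⟩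
  · intro l1 p l2 q l3 h hpq
    obtain ⟨g1, g2⟩ := hnext (l1 ++ [p]) (l2 ++ q :: l3) (by simp [h])
    have h' : L = (l1 ++ p :: l2) ++ q :: l3 := by simp [h]
    obtain ⟨g3, g4⟩ := hnext (l1 ++ p :: l2 ++ [q]) l3 (by simp [h])
    have sp := hspec _ _ _ h
    have sq := hspec _ _ _ h'
    have hp := hpre _ _ _ h
    have hq := hpre _ _ _ h'
    have hu := hinf (l1 ++ [p]) (l2 ++ [q]) l3 (by simp [h]) (by simp)
    obtain ⟨t, ht⟩ : ∃ t, val (flatW (l2 ++ [q])) =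
        (((((l2 ++ q :: l3).map Prod.fst).map val).head?).getD z) * t := by
      rcases l2 with _ | ⟨x, l2⟩
      · exact ⟨1, by simp⟩
      · exact ⟨val (flatW (l2 ++ [q])), by simp⟩
    have hprod : val (flatW (l1 ++ p :: l2 ++ [q])) =
        val (flatW (l1 ++ [p])) * val (flatW (l2 ++ [q])) := by simp [mul_assoc]
    rw [hprod, ht] at hq sq
    rw [ht] at hu
    have key := col_HI g1 g2 g3 g4 hp hq (hu.1.trans hdz) (hzd.trans hu.2)
      (by rw [← sp, ← sq, hpq])
    rw [← sp, hpq] at key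
    rw [eF_eq key, ht]
    exact ⟨rfl, key.1⟩

theorem one_of_mul {a b : WithOne S} (h : a * b = 1) : a = 1 ∧ b = 1 := by
  rcases a with _ | a
  · exact ⟨rfl, (one_mul b).symm.trans h⟩
  · rcases b with _ | b
    · exact ⟨(mul_one _).symm.trans h, rfl⟩
    · change (a : WithOne S) * (b : WithOne S) = 1 at h
      rw [← WithOne.coe_mul] at h
      exact absurd h WithOne.coe_ne_one

open Classical in
noncomputable def up [Fintype (WithOne S)] (d : WithOne S) : Finset (WithOne S) :=
  Finset.univ.filter (fun x => x ≠ 1 ∧ JLE d x)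

open Classical in
noncomputable def dcl [Fintype (WithOne S)] (d : WithOne S) : Finset (WithOne S) :=
  Finset.univ.filter (fun x => JLE x d ∧ JLE d x)

open Classical in
theorem card_up [Fintype (WithOne S)] {d x : WithOne S} (hd : d ≠ 1) (h1 : JLE d x)
    (h2 : ¬ JLE x d) : (up x).card + (dcl d).card ≤ (up d).card := by
  rw [← Finset.card_union_of_disjoint]
  · refine Finset.card_le_card ?_
    intro y hy
    rcases Finset.mem_union.mp hy with hy | hy
    · simp only [up, Finset.mem_filter, Finset.mem_univ, true_and] at hy ⊢
      exact ⟨hy.1, h1.trans hy.2⟩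
    · simp only [up, dcl, Finset.mem_filter, Finset.mem_univ, true_and] at hy ⊢
      refine ⟨?_, hy.2⟩
      rintro rfl
      obtain ⟨p, q, hpq⟩ := hy.1
      exact hd (one_of_mul (one_of_mul hpq.symm).1).2
  · rw [Finset.disjoint_left]
    intro y hy hy'
    simp only [up, dcl, Finset.mem_filter, Finset.mem_univ, true_and] at hy hy'
    exact h2 (hy.2.trans hy'.1)

theorem card_dcl [Fintype (WithOne S)] {d : WithOne S} (hd : d ≠ 1) :
    (dcl d).card ≤ (up d).card := by
  classical
  refine Finset.card_le_card ?_
  intro y hy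
  simp only [up, dcl, Finset.mem_filter, Finset.mem_univ, true_and] at hy ⊢
  refine ⟨?_, hy.2⟩
  rintro rfl
  obtain ⟨p, q, hpq⟩ := hy.1
  exact hd (one_of_mul (one_of_mul hpq.symm).1).2

open Classical in
theorem main [Finite S] [Fintype (WithOne S)] : ∀ (n : ℕ) (w : List S), w ≠ [] →
    (up (val w)).card = n → H w (3 * n) := by
  intro n
  induction n using Nat.strong_induction_on with
  | _ n ih =>
  intro w hw hn
  obtain ⟨d, hd⟩ : ∃ d, d = val w := ⟨_, rfl⟩
  rw [← hd] at hn
  have hd1 : d ≠ 1 := hd ▸ val_ne_one hw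
  have hD : 0 < (dcl d).card := Finset.card_pos.mpr ⟨d, by
    simp only [dcl, Finset.mem_filter, Finset.mem_univ, true_and]
    exact ⟨JLE.refl _, JLE.refl _⟩⟩
  have hDn : (dcl d).card ≤ n := hn ▸ card_dcl hd1
  obtain ⟨v0, ys, hwv, hv0, hys⟩ := cut d w
  have small : ∀ v a b, w = a ++ v ++ b → v ≠ [] → ¬ JLE (val v) d →
      H v (3 * (n - (dcl d).card)) ∧ (dcl d).card < n := by
    intro v a b h hv hnd
    have h1 : JLE d (val v) := ⟨val a, val b, by rw [hd, h]; simp [mul_assoc]⟩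
    have := card_up hd1 h1 hnd
    have hpos : 0 < (up (val v)).card := Finset.card_pos.mpr ⟨val v, by
      simp only [up, Finset.mem_filter, Finset.mem_univ, true_and]
      exact ⟨val_ne_one hv, JLE.refl _⟩⟩
    exact ⟨(ih _ (by omega) v hv rfl).le (by omega), by omega⟩
  rcases ys with _ | ⟨y0, ys⟩
  · exfalso
    simp only [List.flatten_nil, List.append_nil] at hwv
    subst hwv
    rcases hv0 with h | h
    · exact hw h
    · exact h (hd ▸ JLE.refl _)
  obtain ⟨B, hB⟩ : ∃ B, B = 3 * (n - (dcl d).card) + 1 := ⟨_, rfl⟩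
  have hyH : ∀ y ∈ y0 :: ys, H y B := by
    intro y hy
    obtain ⟨_, a, v, rfl, hv⟩ := hys y hy
    by_cases hvn : v = []
    · subst hvn
      exact H.le (h := 1) (HRankLE.single a) (by omega)
    · obtain ⟨s, t, hst⟩ := List.append_of_mem hy
      have := small v (v0 ++ s.flatten ++ [a]) t.flatten (by rw [hwv, hst]; simp) hvn
        (hv.resolve_left hvn)
      exact H.bin (u := [a]) (by simp) hvn (HRankLE.single a) this.1 (by omega) (by omega)
  have hyn : ∀ y ∈ y0 :: ys, y ≠ [] := by
    intro y hy
    obtain ⟨_, a, v, rfl, _⟩ := hys y hy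
    simp
  obtain ⟨c1, c2⟩ := lemC d y0 ys (fun y hy => (hys y hy).1)
    ⟨val v0, 1, by rw [hd, hwv]; simp⟩
  have hfst := cols_flat (val y0) (y0 :: ys) 1
  generalize hL : cols (val y0) 1 (y0 :: ys) = L at c1 c2 hfst
  rcases L with _ | ⟨p, L⟩
  · simp at hfst
  simp only [List.map_cons, List.cons.injEq] at hfst
  obtain ⟨hp, hLy⟩ := hfst
  have hmem : ∀ q ∈ L, q.1 ∈ ys := fun q hq => hLy ▸ List.mem_map_of_mem hq
  have hfin := lemA' (e := eF) (B := B) (dcl d) ((v0 ++ p.1, p.2) :: L) (by simp) ?_ ?_ ?_ ?_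
  · have : flatW ((v0 ++ p.1, p.2) :: L) = w := by
      rw [hwv, flatW_cons, flatW, hLy, hp]; simp
    rw [this] at hfin
    exact hfin.le (by omega)
  · intro q hq
    rcases List.mem_cons.mp hq with rfl | hq
    · have := hyn y0 (by simp)
      simp [hp, this]
    · exact hyn _ (by simp [hmem q hq])
  · intro q hq
    simp only [dcl, Finset.mem_filter, Finset.mem_univ, true_and]
    rcases List.mem_cons.mp hq with rfl | hq
    · exact c1 p (by simp)
    · exact c1 q (by simp [hq])
  · intro l1 p' l2 q l3 h hpq
    rcases l1 with _ | ⟨x, l1⟩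
    · simp only [List.nil_append, List.cons.injEq] at h
      obtain ⟨rfl, rfl⟩ := h
      exact c2 [] p l2 q l3 rfl hpq
    · simp only [List.cons_append, List.cons.injEq] at h
      obtain ⟨_, rfl⟩ := h
      exact c2 (p :: l1) p' l2 q l3 rfl hpq
  · intro p' L' h
    obtain ⟨rfl, rfl⟩ := List.cons.inj h
    refine ⟨?_, fun q hq => hyH _ (by simp [hmem q hq])⟩
    have h0 := hyH y0 (by simp)
    simp only [hp]
    by_cases hv : v0 = []
    · subst hv
      exact h0.le (by omega)
    · exact H.bin hv (hyn y0 (by simp))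
        (small v0 [] (y0 :: ys).flatten (by simpa using hwv) hv (hv0.resolve_left hv)).1 h0
        (by omega) (by omega)

end Words

end SimonAux

/-- Simon's Factorization Theorem: in a finite semigroup `S`, every nonempty
word `w ∈ S⁺` has height at most `3|S|`. -/
theorem simon_factorization {S : Type*} [Semigroup S] [Fintype S]
    (w : List S) (hw : w ≠ []) :
    HRankLE (· * ·) w (3 * Fintype.card S) := by
  classical
  letI : Fintype (WithOne S) := inferInstanceAs (Fintype (Option S))
  refine SimonAux.H.le (SimonAux.main _ w hw rfl) ?_
  have h1 : (SimonAux.up (SimonAux.val w)).card < Fintype.card (WithOne S) := by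
    rw [← Finset.card_univ]
    refine Finset.card_lt_card ⟨Finset.subset_univ _, fun h => ?_⟩
    have := h (Finset.mem_univ 1)
    simp [SimonAux.up] at this
  have h2 : Fintype.card (WithOne S) = Fintype.card S + 1 := Fintype.card_option
  omega
end

section
/- For every c ∈ ℕ there exists a connected finite graph G of pathwidth at most 1 (namely a star K_{1,n} for sufficiently large n) such that there is no pair (P, (W_x)_{x∈V(P)}) where P is a path that is a subgraph of G and (P, (W_x)_{x∈V(P)}) is a tree decomposition of G of width at most c. In particular, there is no function f : ℕ → ℕ such that every connected graph G of pathwidth less than k admits a path decomposition of width at most f(k) indexed by a path that is a subgraph of G. -/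
open SimpleGraph

theorem star_conn (n : ℕ) : (completeBipartiteGraph (Fin 1) (Fin n)).Connected := by
  have key : ∀ v, (completeBipartiteGraph (Fin 1) (Fin n)).Reachable (Sum.inl 0) v := by
    rintro (v | v)
    · rw [Subsingleton.elim v 0]
    · exact SimpleGraph.Adj.reachable (by simp)
  haveI : Nonempty (Fin 1 ⊕ Fin n) := ⟨Sum.inl 0⟩
  exact ⟨fun u v => (key u).symm.trans (key v)⟩

theorem star_pw (n : ℕ) (hn : 0 < n) :
    PathwidthLt (completeBipartiteGraph (Fin 1) (Fin n)) 2 := by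
  refine ⟨n, fun i => {Sum.inl 0, Sum.inr i}, ⟨?_, ?_, ?_⟩, fun i => (Set.ncard_insert_le _ _).trans (by simp)⟩
  · rintro (v | v)
    · exact ⟨⟨0, hn⟩, by simp [Subsingleton.elim v 0]⟩
    · exact ⟨v, by simp⟩
  · rintro (v | v) i j l hij hjl hi hl
    · simp [Subsingleton.elim v 0]
    · simp at hi hl ⊢
      subst hi
      omega
  · rintro (u | u) (v | v) h
    · simp at h
    · exact ⟨v, by simp [Subsingleton.elim u 0]⟩
    · exact ⟨u, by simp [Subsingleton.elim v 0]⟩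
    · simp at h

theorem star_edge {n : ℕ} {u v : Fin 1 ⊕ Fin n}
    (h : (completeBipartiteGraph (Fin 1) (Fin n)).Adj u v) :
    u = Sum.inl 0 ∨ v = Sum.inl 0 := by
  rcases u with u | u
  · left; rw [Subsingleton.elim u 0]
  · rcases v with v | v
    · right; rw [Subsingleton.elim v 0]
    · simp at h

theorem star_path_le {n m : ℕ} (P : (completeBipartiteGraph (Fin 1) (Fin n)).Subgraph)
    (e : P.coe ≃g pathGraph m) : m ≤ 3 := by
  by_contra hm
  push Not at hm
  have h : ∀ i j : Fin m, i.val + 1 = j.val →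
      (e.symm i).val = Sum.inl 0 ∨ (e.symm j).val = Sum.inl 0 := by
    intro i j hij
    have h1 : (pathGraph m).Adj i j := by rw [pathGraph_adj]; exact Or.inl hij
    have h2 : P.coe.Adj (e.symm i) (e.symm j) := e.symm.map_rel_iff.2 h1
    exact star_edge (P.adj_sub h2)
  have inj : ∀ i j : Fin m, (e.symm i).val = Sum.inl 0 → (e.symm j).val = Sum.inl 0 →
      i.val = j.val := by
    intro i j hi hj
    have := e.symm.injective (Subtype.ext (hi.trans hj.symm))
    rw [this]
  have a := h ⟨0, by omega⟩ ⟨1, by omega⟩ rfl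
  have b := h ⟨2, by omega⟩ ⟨3, by omega⟩ rfl
  rcases a with a | a <;> rcases b with b | b <;> simpa using inj _ _ a b

theorem star_no (c : ℕ) :
      ¬ ∃ (P : (completeBipartiteGraph (Fin 1) (Fin (3 * c + 3))).Subgraph) (m : ℕ)
          (_ : 0 < m) (_ : Nonempty (P.coe ≃g pathGraph m))
          (W : P.verts → Set (Fin 1 ⊕ Fin (3 * c + 3))),
          IsTreeDecompOn (completeBipartiteGraph (Fin 1) (Fin (3 * c + 3))) P.coe W ∧
            ∀ x, (W x).ncard ≤ c + 1 := by
  rintro ⟨P, m, -, ⟨e⟩, W, ⟨hW, -⟩, hc⟩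
  have hm := star_path_le P e
  classical
  have hu : (Finset.univ : Finset (Fin 1 ⊕ Fin (3 * c + 3))) ⊆
      Finset.univ.biUnion (fun i : Fin m => (W (e.symm i)).toFinset) := by
    intro u _
    obtain ⟨x, hx⟩ := (hW u).nonempty
    simp only [Finset.mem_biUnion, Finset.mem_univ, true_and, Set.mem_toFinset]
    refine ⟨e x, ?_⟩
    simpa using hx
  have h1 := Finset.card_le_card hu
  have h2 := Finset.card_biUnion_le_card_mul (Finset.univ : Finset (Fin m))
    (fun i : Fin m => (W (e.symm i)).toFinset) (c + 1) (fun i _ => by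
      rw [← Set.ncard_eq_toFinset_card']; exact hc _)
  simp at h1 h2
  have h3 : m * (c + 1) ≤ 3 * (c + 1) := Nat.mul_le_mul_right _ hm
  omega

/-- For every `c ∈ ℕ` there is a connected finite graph of pathwidth at most
`1` — namely a star `K_{1,n}` for sufficiently large `n` — admitting no tree
decomposition of width at most `c` indexed by a path that is a subgraph of it.
In particular, there is no function `f : ℕ → ℕ` such that every connected
finite graph of pathwidth less than `k` admits a path decomposition of width at
most `f k` indexed by a path that is a subgraph of the graph. -/
theorem no_path_indexed_decomposition :
    (∀ c : ℕ, ∃ n : ℕ,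
      (completeBipartiteGraph (Fin 1) (Fin n)).Connected ∧
      PathwidthLt (completeBipartiteGraph (Fin 1) (Fin n)) 2 ∧
      ¬ ∃ (P : (completeBipartiteGraph (Fin 1) (Fin n)).Subgraph) (m : ℕ)
          (_ : 0 < m) (_ : Nonempty (P.coe ≃g pathGraph m))
          (W : P.verts → Set (Fin 1 ⊕ Fin n)),
          IsTreeDecompOn (completeBipartiteGraph (Fin 1) (Fin n)) P.coe W ∧
            ∀ x, (W x).ncard ≤ c + 1) ∧
    ¬ ∃ f : ℕ → ℕ, ∀ (k : ℕ), 0 < k → ∀ (V : Type) (_ : Fintype V) (G : SimpleGraph V),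
        G.Connected → PathwidthLt G k →
        ∃ (P : G.Subgraph) (m : ℕ) (_ : 0 < m) (_ : Nonempty (P.coe ≃g pathGraph m))
          (W : P.verts → Set V),
          IsTreeDecompOn G P.coe W ∧ ∀ x, (W x).ncard ≤ f k + 1 := by
  refine ⟨fun c => ⟨3 * c + 3, star_conn _, star_pw _ (by omega), star_no c⟩, ?_⟩
  rintro ⟨f, hf⟩
  exact star_no (f 2) (hf 2 (by omega) _ inferInstance _ (star_conn _) (star_pw _ (by omega)))
end
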